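/- arXiv:1705.01360 — 2 statements merged into one kernel-verified Lean document; each statement's English description precedes it below -/
import Mathlib

section
/- Let 0 < s < 1. Assume the standing assumptions, that X satisfies the 1-chain condition, that μ satisfies the reverse doubling condition with exponent η = s, and that there is Q > s and c > 0 such that μ(B) ≥ c·rad(B)^Q for all balls B ⊂ X. Let ∅ ≠ E ⊂ X be a closed set, and let 1 < p ≤ q ≤ Qp/(Q−sp) < ∞ and β ∈ ℝ be such that codim_A(E) > max{ Q − (q/p)(Q−sp+β), β/(p−1) }. Then for every 1 ≤ t < ∞ there is a constant C > 0 such that (∫_X |f(x)|^q δ_E(x)^{(q/p)(Q−sp+β)−Q} dμ(x))^{1/q} ≤ C (∫_X (∫_X |f(y)−f(z)|^t / (d(y,z)^{st} μ(B(y,d(y,z)))) dμ(z))^{p/t} δ_E(y)^β dμ(y))^{1/p} holds for all f ∈ Lip_0(X). -/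
open MeasureTheory Metric Set
open scoped ENNReal NNReal

namespace ApDistance

noncomputable section

variable {X : Type*} [MetricSpace X] [MeasurableSpace X] [BorelSpace X]

/-- All balls of positive radius have positive and finite measure. -/
def BallsPosFinite (μ : Measure X) : Prop :=
  ∀ (x : X) (r : ℝ), 0 < r → 0 < μ (ball x r) ∧ μ (ball x r) < ∞

/-- The measure `μ` is doubling with constant `C`. -/
def DoublingWith (μ : Measure X) (C : ℝ) : Prop :=
  ∀ (x : X) (r : ℝ), 0 < r → μ (ball x (2 * r)) ≤ ENNReal.ofReal C * μ (ball x r)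

/-- The measure `μ` is doubling. -/
def Doubling (μ : Measure X) : Prop :=
  ∃ C : ℝ, 0 < C ∧ DoublingWith μ C

/-- The (quantitative) reverse doubling condition with exponent `η`. -/
def ReverseDoubling (μ : Measure X) (η : ℝ) : Prop :=
  ∃ C : ℝ, 0 < C ∧ ∀ (x y : X) (r R : ℝ), 0 < r → 0 < R → ball y r ⊆ ball x R →
    μ (ball y r) ≤ ENNReal.ofReal (C * (r / R) ^ η) * μ (ball x R)

/-- Standing assumptions (S1)-(S2): `X` is unbounded, points have measure zero,
and all annuli are nonempty. -/
def StandingAssumptions (μ : Measure X) : Prop :=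
  ¬ Bornology.IsBounded (univ : Set X) ∧ (∀ x : X, μ {x} = 0) ∧
    ∀ (x : X) (r R : ℝ), 0 < r → r < R → (ball x R \ ball x r).Nonempty

/-- Ahlfors `Q`-regularity of the metric measure space. -/
def AhlforsRegular (μ : Measure X) (Q : ℝ) : Prop :=
  ∃ C : ℝ, 1 ≤ C ∧ ∀ (x : X) (r : ℝ), 0 < r → ENNReal.ofReal r < EMetric.diam (univ : Set X) →
    ENNReal.ofReal (C⁻¹ * r ^ Q) ≤ μ (ball x r) ∧ μ (ball x r) ≤ ENNReal.ofReal (C * r ^ Q)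

/-- The set of admissible exponents in the definition of the (upper) Assouad dimension:
`E ∩ B(x,R)` can be covered by at most `C (R/r)^s` balls of radius `r`. -/
def assouadDimBddSet (E : Set X) : Set ℝ :=
  {s : ℝ | 0 ≤ s ∧ ∃ C : ℝ, 1 ≤ C ∧ ∀ x ∈ E, ∀ r R : ℝ, 0 < r → r < R →
    ENNReal.ofReal R < 2 * EMetric.diam (univ : Set X) →
    ∃ F : Finset X, (F.card : ℝ) ≤ C * (R / r) ^ s ∧ E ∩ ball x R ⊆ ⋃ y ∈ F, ball y r}

/-- The (upper) Assouad dimension of a set `E`. -/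
def assouadDim (E : Set X) : ℝ := sInf (assouadDimBddSet E)

/-- The set of admissible exponents in the definition of the lower Assouad codimension. -/
def assouadCodimBddSet (μ : Measure X) (E : Set X) : Set ℝ :=
  {ρ : ℝ | 0 ≤ ρ ∧ ∃ C : ℝ, 1 ≤ C ∧ ∀ x ∈ E, ∀ r R : ℝ, 0 < r → r < R →
    ENNReal.ofReal R < 2 * EMetric.diam (univ : Set X) →
    μ ({y : X | infDist y E < r} ∩ ball x R) ≤
      ENNReal.ofReal (C * (r / R) ^ ρ) * μ (ball x R)}

/-- The lower Assouad codimension of a set `E` with respect to `μ`. -/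
def assouadCodim (μ : Measure X) (E : Set X) : ℝ := sSup (assouadCodimBddSet μ E)

/-- Porosity of a set `E ⊆ X`. -/
def IsPorous (E : Set X) : Prop :=
  ∃ c : ℝ, 0 < c ∧ c < 1 ∧ ∀ x ∈ E, ∀ r : ℝ, 0 < r →
    ENNReal.ofReal r < 2 * EMetric.diam (univ : Set X) →
    ∃ y : X, ball y (c * r) ⊆ ball x r \ E

/-- A weight: measurable, a.e. positive and finite, locally integrable on balls. -/
def IsWeight (μ : Measure X) (w : X → ℝ≥0∞) : Prop :=
  Measurable w ∧ (∀ᵐ x ∂μ, 0 < w x ∧ w x ≠ ∞) ∧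
    ∀ (x : X) (r : ℝ), 0 < r → ∫⁻ y in ball x r, w y ∂μ ≠ ∞

/-- Membership in the Muckenhoupt class `A_p`, `1 < p < ∞`. -/
def MemAp (μ : Measure X) (w : X → ℝ≥0∞) (p : ℝ) : Prop :=
  IsWeight μ w ∧ ∃ A : ℝ, 0 < A ∧ ∀ (x : X) (r : ℝ), 0 < r →
    ((∫⁻ y in ball x r, w y ∂μ) / μ (ball x r)) *
      ((∫⁻ y in ball x r, w y ^ (-(1 / (p - 1))) ∂μ) / μ (ball x r)) ^ (p - 1) ≤
      ENNReal.ofReal A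

/-- Membership in the Muckenhoupt class `A_1`. -/
def MemA1 (μ : Measure X) (w : X → ℝ≥0∞) : Prop :=
  IsWeight μ w ∧ ∃ A : ℝ, 0 < A ∧ ∀ (x : X) (r : ℝ), 0 < r →
    ((∫⁻ y in ball x r, w y ∂μ) / μ (ball x r)) *
      essSup (fun y => (w y)⁻¹) (μ.restrict (ball x r)) ≤ ENNReal.ofReal A

/-- Membership in the Muckenhoupt class `A_∞`. -/
def MemAinfty (μ : Measure X) (w : X → ℝ≥0∞) : Prop :=
  IsWeight μ w ∧ ∃ C d : ℝ, 0 < C ∧ 0 < d ∧ ∀ (x : X) (r : ℝ), 0 < r →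
    ∀ F : Set X, MeasurableSet F → F ⊆ ball x r →
      ∫⁻ y in F, w y ∂μ ≤
        ENNReal.ofReal C * (μ F / μ (ball x r)) ^ d * ∫⁻ y in ball x r, w y ∂μ

/-- The weight `w = δ_E^{-α} = dist(·,E)^{-α}` (with values in `ℝ≥0∞`). -/
def distWeight (E : Set X) (α : ℝ) : X → ℝ≥0∞ :=
  fun x => ENNReal.ofReal (infDist x E) ^ (-α)

/-- The Aikawa condition with exponent `α` and constant `C`. -/
def AikawaCondition (μ : Measure X) (E : Set X) (α C : ℝ) : Prop :=
  ∀ x ∈ E, ∀ r : ℝ, 0 < r → ENNReal.ofReal r < 2 * EMetric.diam (univ : Set X) →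
    ∫⁻ y in ball x r, ENNReal.ofReal (infDist y E) ^ (-α) ∂μ ≤
      ENNReal.ofReal (C * r ^ (-α)) * μ (ball x r)

/-- The Riesz potential `I_s f`. -/
def rieszPotential (μ : Measure X) (s : ℝ) (f : X → ℝ≥0∞) (x : X) : ℝ≥0∞ :=
  ∫⁻ y, f y * ENNReal.ofReal (dist x y ^ s) / μ (ball x (dist x y)) ∂μ

/-- `Lip_0(X)`: Lipschitz functions vanishing outside some ball. -/
def MemLip0 (f : X → ℝ) : Prop :=
  (∃ K : ℝ≥0, LipschitzWith K f) ∧ ∃ (x : X) (r : ℝ), ∀ y : X, y ∉ ball x r → f y = 0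

/-- The `λ`-chain condition. -/
def ChainCondition (X : Type*) [MetricSpace X] (lam : ℝ) : Prop :=
  ∃ M : ℝ, 1 ≤ M ∧ ∀ (x : X) (r R : ℝ), 0 < r → r < R →
    ∃ (k : ℕ) (c : ℕ → X) (ρ : ℕ → ℝ),
      (∀ i ≤ k, 0 < ρ i) ∧
      ball (c 0) (lam * ρ 0) ⊆ (ball x R)ᶜ ∧
      ball (c k) (lam * ρ k) ⊆ ball x r ∧
      (∀ i ≤ k,
        M⁻¹ * Metric.diam (ball (c i) (lam * ρ i)) ≤ infDist x (ball (c i) (lam * ρ i)) ∧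
        infDist x (ball (c i) (lam * ρ i)) ≤ M * Metric.diam (ball (c i) (lam * ρ i))) ∧
      (∀ i < k, ∃ (z : X) (t : ℝ), 0 < t ∧
        ball z t ⊆ ball (c i) (ρ i) ∩ ball (c (i + 1)) (ρ (i + 1)) ∧
        ball (c i) (ρ i) ∪ ball (c (i + 1)) (ρ (i + 1)) ⊆ ball z (M * t)) ∧
      (∀ y : X, (({i : ℕ | i ≤ k ∧ y ∈ ball (c i) (lam * ρ i)}).ncard : ℝ) ≤ M)

/-- The inner integral appearing in fractional Hardy–Sobolev inequalities:
`y ↦ ∫_X |f(y)-f(z)|^t / (d(y,z)^{st} μ(B(y,d(y,z)))) dμ(z)`. -/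
def fracEnergyKernel (μ : Measure X) (s t : ℝ) (f : X → ℝ) (y : X) : ℝ≥0∞ :=
  ∫⁻ z, ENNReal.ofReal (|f y - f z| ^ t) /
    (ENNReal.ofReal (dist y z ^ (s * t)) * μ (ball y (dist y z))) ∂μ



set_option linter.all false
set_option linter.unusedSectionVars false
set_option linter.style.haveILetI false
set_option linter.deprecated false

/-- Dyadic scale `2^j` as an extended nonnegative real. -/
def ee (j : ℤ) : ℝ≥0∞ := ENNReal.ofReal ((2:ℝ) ^ j)

lemma ee_ne_zero (j : ℤ) : ee j ≠ 0 := by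
  have : (0:ℝ) < (2:ℝ) ^ j := by positivity
  simpa [ee] using this

lemma ee_ne_top (j : ℤ) : ee j ≠ ⊤ := by simp [ee]

lemma ee_eq (j : ℤ) : ee j = (2:ℝ≥0∞) ^ (j:ℝ) := by
  rw [ee, ← Real.rpow_intCast, ← ENNReal.ofReal_rpow_of_pos (by norm_num)]
  norm_num

lemma ee_inv (j : ℤ) : (ee j)⁻¹ = ee (-j) := by
  rw [ee_eq, ee_eq, ← ENNReal.rpow_neg]; push_cast; rfl

lemma exists_ee (x : ℝ≥0∞) (h0 : x ≠ 0) (h1 : x ≠ ⊤) : ∃ n : ℤ, ee n ≤ x ∧ x < ee (n + 1) := by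
  lift x to ℝ≥0 using h1
  have hx : (0:ℝ) < x := by
    have : x ≠ 0 := by simpa using h0
    exact_mod_cast pos_iff_ne_zero.2 this
  obtain ⟨n, hn1, hn2⟩ := exists_mem_Ico_zpow hx (y := (2:ℝ)) (by norm_num)
  refine ⟨n, ?_, ?_⟩
  · rw [ee, ← ENNReal.ofReal_coe_nnreal]
    exact ENNReal.ofReal_le_ofReal hn1
  · rw [ee, ← ENNReal.ofReal_coe_nnreal]
    exact (ENNReal.ofReal_lt_ofReal_iff (by positivity)).2 hn2

lemma ee_lt_iff {i j : ℤ} : ee i < ee j ↔ i < j := by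
  rw [ee, ee, ENNReal.ofReal_lt_ofReal_iff (by positivity)]
  exact zpow_lt_zpow_iff_right₀ (by norm_num)

lemma geo_le (a : ℝ) (ha : 0 < a) : ∃ C : ℝ≥0∞, C ≠ ⊤ ∧ C ≠ 0 ∧ ∀ x : ℝ≥0∞,
    ∑' j : ℤ, (if ee j ≤ x then ee j ^ a else 0) ≤ C * x ^ a := by
  have hlt : (2:ℝ≥0∞) ^ (-a) < 1 := by
    rw [ENNReal.rpow_neg]
    exact ENNReal.inv_lt_one.2 (ENNReal.one_lt_rpow (by norm_num) ha)
  have hC0 : (1 - (2:ℝ≥0∞) ^ (-a))⁻¹ ≠ 0 := by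
    simp
  refine ⟨(1 - (2:ℝ≥0∞) ^ (-a))⁻¹, ?_, hC0, ?_⟩
  · rw [Ne, ENNReal.inv_eq_top]
    exact (tsub_pos_of_lt hlt).ne'
  intro x
  by_cases h0 : x = 0
  · subst h0
    have : ∀ j : ℤ, (if ee j ≤ 0 then ee j ^ a else 0) = 0 := by
      intro j
      rw [if_neg]
      simpa using ee_ne_zero j
    simp only [this, tsum_zero]
    exact bot_le
  by_cases h1 : x = ⊤
  · subst h1
    rw [ENNReal.top_rpow_of_pos ha, ENNReal.mul_top hC0]
    exact le_top
  obtain ⟨n, hn1, hn2⟩ := exists_ee x h0 h1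
  have hinj : Function.Injective (fun i : ℕ => n - (i:ℤ)) := by
    intro i j h
    simp only at h
    omega
  have hsupp : Function.support (fun j : ℤ => (if ee j ≤ x then ee j ^ a else 0)) ⊆
      Set.range (fun i : ℕ => n - (i:ℤ)) := by
    intro j hj
    have hjx : ee j ≤ x := by
      by_contra h
      simp [h] at hj
    have : j < n + 1 := ee_lt_iff.1 (lt_of_le_of_lt hjx hn2)
    exact ⟨(n - j).toNat, by simp only; omega⟩
  rw [← hinj.tsum_eq hsupp]
  calc ∑' i : ℕ, (if ee (n - (i:ℤ)) ≤ x then ee (n - (i:ℤ)) ^ a else 0)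
      ≤ ∑' i : ℕ, ee n ^ a * ((2:ℝ≥0∞) ^ (-a)) ^ i := by
        refine ENNReal.tsum_le_tsum fun i => ?_
        have : ee (n - (i:ℤ)) ^ a = ee n ^ a * ((2:ℝ≥0∞) ^ (-a)) ^ i := by
          rw [ee_eq, ee_eq, ← ENNReal.rpow_natCast, ← ENNReal.rpow_mul, ← ENNReal.rpow_mul,
            ← ENNReal.rpow_mul, ← ENNReal.rpow_add _ _ (by norm_num) (by norm_num)]
          congr 1
          push_cast
          ring
        split_ifs
        · exact this.le
        · exact bot_le
    _ = ee n ^ a * (1 - (2:ℝ≥0∞) ^ (-a))⁻¹ := by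
        rw [ENNReal.tsum_mul_left, ENNReal.tsum_geometric]
    _ ≤ (1 - (2:ℝ≥0∞) ^ (-a))⁻¹ * x ^ a := by
        rw [mul_comm]
        gcongr

lemma geo_ge (a : ℝ) (ha : 0 < a) : ∃ C : ℝ≥0∞, C ≠ ⊤ ∧ C ≠ 0 ∧ ∀ x : ℝ≥0∞,
    ∑' j : ℤ, (if x ≤ ee j then ee j ^ (-a) else 0) ≤ C * x ^ (-a) := by
  obtain ⟨C, hC, hC0, h⟩ := geo_le a ha
  refine ⟨C, hC, hC0, fun x => ?_⟩
  have := h x⁻¹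
  rw [← (Equiv.neg ℤ).tsum_eq, ENNReal.rpow_neg, ← ENNReal.inv_rpow]
  refine le_trans (le_of_eq ?_) this
  congr 1
  ext j
  simp only [Equiv.neg_apply, ← ee_inv, ENNReal.le_inv_iff_le_inv, ENNReal.rpow_neg, ← ENNReal.inv_rpow, inv_inv]

lemma jensen_mul {Ω : Type*} [MeasurableSpace Ω] (ν : Measure Ω) (c a : Ω → ℝ≥0∞)
    (hc : AEMeasurable c ν) (ha : AEMeasurable a ν) (q : ℝ) (hq : 1 ≤ q) :
    (∫⁻ x, c x * a x ∂ν) ^ q ≤ (∫⁻ x, c x ∂ν) ^ (q - 1) * ∫⁻ x, c x * a x ^ q ∂ν := by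
  rcases hq.eq_or_lt with rfl | hq
  · simp
  have hpq : q.HolderConjugate (Real.conjExponent q) := Real.HolderConjugate.conjExponent hq
  set q' := Real.conjExponent q
  have hq0 : 0 < q := by linarith
  have hq'0 : 0 < q' := hpq.symm.pos
  have hsum : 1 / q' + 1 / q = 1 := by
    have := hpq.inv_add_inv_eq_one
    rw [one_div, one_div]; linarith
  have key := ENNReal.lintegral_mul_le_Lp_mul_Lq ν hpq.symm
    (f := fun x => c x ^ (1 / q')) (g := fun x => c x ^ (1 / q) * a x)
    (hc.pow_const _) ((hc.pow_const _).mul ha)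
  have e1 : ∀ x, c x ^ (1 / q') * (c x ^ (1 / q) * a x) = c x * a x := by
    intro x
    rw [← mul_assoc, ← ENNReal.rpow_add_of_nonneg _ _ (by positivity) (by positivity), hsum,
      ENNReal.rpow_one]
  have e2 : ∀ x, (c x ^ (1 / q')) ^ q' = c x := by
    intro x
    rw [← ENNReal.rpow_mul, one_div_mul_cancel hq'0.ne', ENNReal.rpow_one]
  have e3 : ∀ x, (c x ^ (1 / q) * a x) ^ q = c x * a x ^ q := by
    intro x
    rw [ENNReal.mul_rpow_of_nonneg _ _ hq0.le, ← ENNReal.rpow_mul, one_div_mul_cancel hq0.ne',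
      ENNReal.rpow_one]
  simp only [Pi.mul_apply, e1, e2, e3] at key
  calc (∫⁻ x, c x * a x ∂ν) ^ q
      ≤ ((∫⁻ x, c x ∂ν) ^ (1 / q') * (∫⁻ x, c x * a x ^ q ∂ν) ^ (1 / q)) ^ q := by gcongr
    _ = _ := by
      rw [ENNReal.mul_rpow_of_nonneg _ _ hq0.le, ← ENNReal.rpow_mul, ← ENNReal.rpow_mul,
        one_div_mul_cancel hq0.ne', ENNReal.rpow_one]
      congr 2
      have : 1 / q' = 1 - 1 / q := by linarith
      rw [this]; field_simp

lemma jensen_tsum (c a : ℤ → ℝ≥0∞) (q : ℝ) (hq : 1 ≤ q) :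
    (∑' j, c j * a j) ^ q ≤ (∑' j, c j) ^ (q - 1) * ∑' j, c j * a j ^ q := by
  have := jensen_mul (Measure.count : Measure ℤ) c a (measurable_of_countable _).aemeasurable
    (measurable_of_countable _).aemeasurable q hq
  simpa only [lintegral_count] using this

/-- monotonicity change of exponent -/
lemma rpow_le_change (d R : ℝ≥0∞) (a b : ℝ) (hab : a ≤ b) (hb : 0 < b) (hR0 : R ≠ 0) (hR : R ≠ ⊤)
    (h : d ≤ R) : d ^ (-a) ≤ R ^ (b - a) * d ^ (-b) := by
  by_cases h0 : d = 0
  · subst h0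
    rw [ENNReal.zero_rpow_of_neg (y := -b) (by linarith), ENNReal.mul_top]
    · exact le_top
    · exact (ENNReal.rpow_pos (pos_iff_ne_zero.2 hR0) hR).ne'
  have hd : d ≠ ⊤ := ne_top_of_le_ne_top hR h
  have : d ^ (-a) = d ^ (b - a) * d ^ (-b) := by
    rw [← ENNReal.rpow_add _ _ h0 hd]; congr 1; ring
  rw [this]
  gcongr

lemma mul_rpow' (a b : ℝ≥0∞) (z : ℝ) (ha0 : a ≠ 0) (ha : a ≠ ⊤) :
    (a * b) ^ z = a ^ z * b ^ z := by
  rcases le_or_gt 0 z with hz | hz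
  · exact ENNReal.mul_rpow_of_nonneg _ _ hz
  · have hz' : 0 < -z := by linarith
    rw [show z = -(-z) by ring, ENNReal.rpow_neg, ENNReal.rpow_neg a, ENNReal.rpow_neg b,
      ENNReal.mul_rpow_of_nonneg _ _ hz'.le, ENNReal.mul_inv]
    · left; simp [ENNReal.rpow_eq_zero_iff, ha0, hz'.le, not_lt.2]
    · left; simp [ENNReal.rpow_eq_top_iff, ha0, ha]

/-- Doubling package with an extended constant. -/
structure Dbl (μ : Measure X) (D : ℝ≥0∞) : Prop where
  pf : BallsPosFinite μ
  top : D ≠ ⊤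
  dbl : ∀ (x : X) (r : ℝ), 0 < r → μ (ball x (2 * r)) ≤ D * μ (ball x r)

lemma Dbl.pos {μ : Measure X} {D : ℝ≥0∞} (h : Dbl μ D) {x : X} {r : ℝ} (hr : 0 < r) :
    μ (ball x r) ≠ 0 := (h.pf x r hr).1.ne'

lemma Dbl.fin {μ : Measure X} {D : ℝ≥0∞} (h : Dbl μ D) {x : X} {r : ℝ} (hr : 0 < r) :
    μ (ball x r) ≠ ⊤ := (h.pf x r hr).2.ne

lemma Dbl.comp {μ : Measure X} {D : ℝ≥0∞} (h : Dbl μ D) {x y : X} {r : ℝ} (hr : 0 < r)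
    (hxy : dist x y < r) : μ (ball x r) ≤ D * μ (ball y r) := by
  refine le_trans (measure_mono ?_) (h.dbl y r hr)
  intro z hz
  rw [mem_ball] at hz ⊢
  have := dist_triangle z x y
  linarith

lemma Dbl.comp_inv {μ : Measure X} {D : ℝ≥0∞} (h : Dbl μ D) {x y : X} {r : ℝ} (hr : 0 < r)
    (hxy : dist x y < r) : (μ (ball y r))⁻¹ ≤ D * (μ (ball x r))⁻¹ := by
  have h1 := h.comp hr hxy
  have hx0 := h.pos (x := x) hr
  have hx1 := h.fin (x := x) hr
  calc (μ (ball y r))⁻¹ = (μ (ball x r) / μ (ball y r)) * (μ (ball x r))⁻¹ := by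
        rw [ENNReal.div_eq_inv_mul, mul_assoc, ENNReal.mul_inv_cancel hx0 hx1, mul_one]
    _ ≤ D * (μ (ball x r))⁻¹ := by
        gcongr
        exact ENNReal.div_le_of_le_mul h1

lemma Dbl.sigmaFinite {μ : Measure X} {D : ℝ≥0∞} (h : Dbl μ D) [Nonempty X] : SigmaFinite μ := by
  obtain ⟨x⟩ := ‹Nonempty X›
  refine ⟨⟨⟨fun n => ball x (n + 1), fun _ => trivial, fun n => ?_, ?_⟩⟩⟩
  · exact (h.pf x (n + 1) (by positivity)).2
  · rw [eq_univ_iff_forall]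
    intro y
    obtain ⟨n, hn⟩ := exists_nat_gt (dist y x)
    exact mem_iUnion.2 ⟨n, by rw [mem_ball]; linarith⟩

lemma Dbl.secondCountable {μ : Measure X} {D : ℝ≥0∞} (h : Dbl μ D) [Nonempty X] :
    SecondCountableTopology X := by
  haveI := h.sigmaFinite
  refine Metric.secondCountable_of_almost_dense_set fun ε hε => ?_
  obtain ⟨u, -, hdisj, hcov⟩ := Vitali.exists_disjoint_subfamily_covering_enlargement_closedBall
    (univ : Set X) (fun x => x) (fun _ => ε / 5) (ε / 5) (fun _ _ => le_rfl) 5 (by norm_num)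
  refine ⟨u, ?_, ?_⟩
  · have key := Measure.countable_meas_pos_of_disjoint_iUnion (μ := μ)
      (As := fun a : u => closedBall (a : X) (ε / 5)) (fun a => measurableSet_closedBall)
      (fun a b hab => hdisj a.2 b.2 (fun h => hab (Subtype.ext h)))
    have : {i : u | 0 < μ (closedBall (i : X) (ε / 5))} = univ := by
      rw [eq_univ_iff_forall]
      intro i
      exact lt_of_lt_of_le (h.pf i (ε / 5) (by positivity)).1 (measure_mono ball_subset_closedBall)
    rw [this] at key
    exact countable_coe_iff.1 (countable_univ_iff.1 key)
  · intro x
    obtain ⟨b, hb, hsub⟩ := hcov x (mem_univ x)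
    refine ⟨b, hb, ?_⟩
    have := hsub (mem_closedBall_self (by positivity))
    rw [mem_closedBall] at this
    linarith

/-- Average over balls. -/
def av (μ : Measure X) (r : ℝ) (u : X → ℝ≥0∞) (x : X) : ℝ≥0∞ :=
  (∫⁻ y in ball x r, u y ∂μ) / μ (ball x r)

section meas
variable [SecondCountableTopology X]

lemma measurableSet_near (r : ℝ) : MeasurableSet {p : X × X | dist p.2 p.1 < r} :=
  (isOpen_lt (by fun_prop) (by fun_prop)).measurableSet

lemma measurable_vol (μ : Measure X) [SFinite μ] (r : ℝ) :
    Measurable fun x => μ (ball x r) :=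
  measurable_measure_prodMk_left (ν := μ) (measurableSet_near (X := X) r)

lemma measurable_av (μ : Measure X) [SFinite μ] (r : ℝ) {u : X → ℝ≥0∞} (hu : Measurable u) :
    Measurable (av μ r u) := by
  refine Measurable.div ?_ (measurable_vol μ r)
  have : (fun x => ∫⁻ y in ball x r, u y ∂μ) = fun x => ∫⁻ y,
      ({p : X × X | dist p.2 p.1 < r}.indicator (fun p => u p.2)) (x, y) ∂μ := by
    ext x
    rw [← lintegral_indicator measurableSet_ball]
    rfl
  rw [this]
  exact Measurable.lintegral_prod_right'
    ((hu.comp measurable_snd).indicator (measurableSet_near r))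

lemma av_fubini {μ : Measure X} [SFinite μ] {D : ℝ≥0∞} (h : Dbl μ D) {r : ℝ} (hr : 0 < r)
    {u W : X → ℝ≥0∞} (hu : Measurable u) (hW : Measurable W) :
    ∫⁻ x, W x * av μ r u x ∂μ ≤ D * ∫⁻ y, u y * av μ r W y ∂μ := by
  have e1 : ∀ x, W x * av μ r u x = ∫⁻ y, {p : X × X | dist p.2 p.1 < r}.indicator
      (fun p => W p.1 * (μ (ball p.1 r))⁻¹ * u p.2) (x, y) ∂μ := by
    intro x
    have : ∀ y, {p : X × X | dist p.2 p.1 < r}.indicator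
      (fun p => W p.1 * (μ (ball p.1 r))⁻¹ * u p.2) (x, y) =
      (ball x r).indicator (fun y => (W x * (μ (ball x r))⁻¹) * u y) y := fun y => rfl
    simp only [this]
    rw [lintegral_indicator measurableSet_ball, lintegral_const_mul _ hu, av, ENNReal.div_eq_inv_mul,
      mul_assoc]
  have e2 : ∀ y, u y * av μ r W y = ∫⁻ x, {p : X × X | dist p.2 p.1 < r}.indicator
      (fun p => W p.1 * (μ (ball p.2 r))⁻¹ * u p.2) (x, y) ∂μ := by
    intro y
    have : ∀ x, {p : X × X | dist p.2 p.1 < r}.indicator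
      (fun p => W p.1 * (μ (ball p.2 r))⁻¹ * u p.2) (x, y) =
      (ball y r).indicator (fun x => (u y * (μ (ball y r))⁻¹) * W x) x := by
      intro x
      simp only [indicator, mem_ofPred_eq, mem_ball, dist_comm y x]
      split_ifs
      · ring
      · rfl
    simp only [this]
    rw [lintegral_indicator measurableSet_ball, lintegral_const_mul _ hW, av, ENNReal.div_eq_inv_mul,
      mul_assoc]
  simp only [e1, e2]
  have hm : Measurable ({p : X × X | dist p.2 p.1 < r}.indicator
      (fun p => W p.1 * (μ (ball p.1 r))⁻¹ * u p.2)) := by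
    refine Measurable.indicator ?_ (measurableSet_near r)
    exact ((hW.comp measurable_fst).mul ((measurable_vol μ r).comp measurable_fst).inv).mul
      (hu.comp measurable_snd)
  rw [lintegral_lintegral_swap (f := fun x y => {p : X × X | dist p.2 p.1 < r}.indicator
      (fun p => W p.1 * (μ (ball p.1 r))⁻¹ * u p.2) (x, y)) hm.aemeasurable, ← lintegral_const_mul' _ _ h.top]
  refine lintegral_mono fun y => ?_
  rw [← lintegral_const_mul' _ _ h.top]
  refine lintegral_mono fun x => ?_
  simp only [indicator, mem_ofPred_eq]
  split_ifs with hd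
  · calc W x * (μ (ball x r))⁻¹ * u y ≤ W x * (D * (μ (ball y r))⁻¹) * u y := by
          gcongr
          exact h.comp_inv hr hd
      _ = _ := by ring
  · simp

lemma av_integral_le {μ : Measure X} [SFinite μ] {D : ℝ≥0∞} (h : Dbl μ D) {r : ℝ} (hr : 0 < r)
    {u : X → ℝ≥0∞} (hu : Measurable u) :
    ∫⁻ x, av μ r u x ∂μ ≤ D * ∫⁻ y, u y ∂μ := by
  have := av_fubini h hr hu (measurable_const (a := (1:ℝ≥0∞)))
  have e : ∀ y, av μ r (fun _ => 1) y = 1 := by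
    intro y
    simp only [av, lintegral_const, Measure.restrict_apply_univ, one_mul]
    exact ENNReal.div_self (h.pos hr) (h.fin hr)
  simpa [e] using this

end meas

lemma av_mono {μ : Measure X} {r : ℝ} {u v : X → ℝ≥0∞} {x : X}
    (huv : ∀ y ∈ ball x r, u y ≤ v y) : av μ r u x ≤ av μ r v x := by
  unfold av
  refine ENNReal.div_le_div_right ?_ _
  exact setLIntegral_mono' measurableSet_ball huv

lemma av_const {μ : Measure X} {D : ℝ≥0∞} (h : Dbl μ D) {r : ℝ} (hr : 0 < r) (c : ℝ≥0∞) (x : X) :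
    av μ r (fun _ => c) x = c := by
  simp only [av, lintegral_const, Measure.restrict_apply_univ]
  exact ENNReal.mul_div_cancel_right (h.pos hr) (h.fin hr)

lemma av_const_mul {μ : Measure X} {r : ℝ} (c : ℝ≥0∞) {u : X → ℝ≥0∞} (hu : Measurable u) (x : X) :
    av μ r (fun y => c * u y) x = c * av μ r u x := by
  simp only [av, lintegral_const_mul _ hu, mul_div_assoc]

lemma av_add {μ : Measure X} {r : ℝ} {u v : X → ℝ≥0∞} (hu : Measurable u) (x : X) :
    av μ r (fun y => u y + v y) x = av μ r u x + av μ r v x := by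
  simp only [av, lintegral_add_left hu, ENNReal.add_div]

lemma av_jensen {μ : Measure X} {D : ℝ≥0∞} (h : Dbl μ D) {r : ℝ} (hr : 0 < r)
    {u : X → ℝ≥0∞} (hu : Measurable u) (x : X) (p : ℝ) (hp : 1 ≤ p) :
    av μ r u x ^ p ≤ av μ r (fun y => u y ^ p) x := by
  have := jensen_mul (μ.restrict (ball x r)) (fun _ => (μ (ball x r))⁻¹) u
    aemeasurable_const hu.aemeasurable p hp
  rw [lintegral_const_mul _ hu, lintegral_const_mul _ (hu.pow_const _), lintegral_const,
    Measure.restrict_apply_univ, ENNReal.inv_mul_cancel (h.pos hr) (h.fin hr),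
    ENNReal.one_rpow, one_mul] at this
  simpa only [av, ENNReal.div_eq_inv_mul] using this

lemma inv_le_mul_inv {V W K : ℝ≥0∞} (h : W ≤ K * V) (h0 : W ≠ 0) (h1 : W ≠ ⊤) :
    V⁻¹ ≤ K * W⁻¹ := by
  calc V⁻¹ = (W / V) * W⁻¹ := by
        rw [ENNReal.div_eq_inv_mul, mul_assoc, ENNReal.mul_inv_cancel h0 h1, mul_one]
    _ ≤ K * W⁻¹ := by
        gcongr
        exact ENNReal.div_le_of_le_mul h

lemma measurable_kernel [SecondCountableTopology X] (μ : Measure X) [SFinite μ] (s t : ℝ)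
    {f : X → ℝ} (hf : Continuous f) : Measurable (fracEnergyKernel μ s t f) := by
  have hset : MeasurableSet {p : (X × X) × X | dist p.2 p.1.1 < dist p.1.1 p.1.2} :=
    (isOpen_lt (by fun_prop) (by fun_prop)).measurableSet
  have hvol : Measurable fun p : X × X => μ (ball p.1 (dist p.1 p.2)) :=
    measurable_measure_prodMk_left (ν := μ) hset
  have hm : Measurable fun p : X × X => ENNReal.ofReal (|f p.1 - f p.2| ^ t) /
    (ENNReal.ofReal (dist p.1 p.2 ^ (s * t)) * μ (ball p.1 (dist p.1 p.2))) := by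
    refine Measurable.div ?_ (Measurable.mul ?_ hvol)
    · refine ENNReal.measurable_ofReal.comp (Measurable.pow_const ?_ _)
      exact Continuous.measurable (by fun_prop)
    · refine ENNReal.measurable_ofReal.comp (Measurable.pow_const ?_ _)
      exact Continuous.measurable (by fun_prop)
  exact Measurable.lintegral_prod_right' hm

lemma osc {μ : Measure X} {D : ℝ≥0∞} (h : Dbl μ D) (s t : ℝ) (hs : 0 < s) (ht : 1 ≤ t)
    {f : X → ℝ} (hf : Continuous f) {r : ℝ} (hr : 0 < r) {x y : X} (hy : y ∈ ball x r) :
    av μ r (fun z => ENNReal.ofReal |f y - f z|) x ≤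
      (D * D) ^ (1 / t) * ENNReal.ofReal (2 * r) ^ s * fracEnergyKernel μ s t f y ^ (1 / t) := by
  have ht0 : 0 < t := by linarith
  have hfm : Measurable fun z => ENNReal.ofReal |f y - f z| :=
    ENNReal.measurable_ofReal.comp (Continuous.measurable (by fun_prop))
  have hyx : dist y x < r := hy
  have key : av μ r (fun z => ENNReal.ofReal |f y - f z|) x ^ t ≤
      D * D * ENNReal.ofReal (2 * r) ^ (s * t) * fracEnergyKernel μ s t f y := by
    refine (av_jensen h hr hfm x t ht).trans ?_
    have hK : D * D * ENNReal.ofReal (2 * r) ^ (s * t) ≠ ⊤ := by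
      refine ENNReal.mul_ne_top (ENNReal.mul_ne_top h.top h.top) ?_
      exact ENNReal.rpow_ne_top_of_nonneg (by positivity) ENNReal.ofReal_ne_top
    unfold av
    rw [ENNReal.div_eq_inv_mul, ← lintegral_const_mul _ (hfm.pow_const _), fracEnergyKernel,
      ← lintegral_const_mul' _ _ hK]
    refine le_trans (setLIntegral_mono' measurableSet_ball ?_) (setLIntegral_le_lintegral (ball x r) _)
    intro z hz
    have hzx : dist z x < r := hz
    by_cases hyz : y = z
    · subst hyz
      simp [ht0]
    have hd : 0 < dist y z := dist_pos.2 hyz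
    have hd2 : dist y z ≤ 2 * r := by
      have := dist_triangle_right y z x
      linarith
    rw [ENNReal.ofReal_rpow_of_nonneg (abs_nonneg _) ht0.le, div_eq_mul_inv, mul_comm,
      mul_left_comm]
    gcongr
    refine inv_le_mul_inv ?_ ?_ ?_
    · calc ENNReal.ofReal (dist y z ^ (s * t)) * μ (ball y (dist y z))
          ≤ ENNReal.ofReal ((2 * r) ^ (s * t)) * (D * (D * μ (ball x r))) := by
            gcongr ENNReal.ofReal (?_ ^ (s * t)) * ?_
            · calc μ (ball y (dist y z)) ≤ μ (ball y (2 * r)) := measure_mono (ball_subset_ball hd2)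
                _ ≤ D * μ (ball y r) := h.dbl y r hr
                _ ≤ D * (D * μ (ball x r)) := by gcongr; exact h.comp hr hyx
        _ = _ := by
            rw [← ENNReal.ofReal_rpow_of_nonneg (by positivity) (by positivity)]; ring
    · refine mul_ne_zero ?_ (h.pos hd)
      have : 0 < dist y z ^ (s * t) := by positivity
      simpa using this
    · exact ENNReal.mul_ne_top ENNReal.ofReal_ne_top (h.fin hd)
  calc av μ r (fun z => ENNReal.ofReal |f y - f z|) x
      = (av μ r (fun z => ENNReal.ofReal |f y - f z|) x ^ t) ^ (1 / t) := by
        rw [← ENNReal.rpow_mul, mul_one_div_cancel ht0.ne', ENNReal.rpow_one]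
    _ ≤ (D * D * ENNReal.ofReal (2 * r) ^ (s * t) * fracEnergyKernel μ s t f y) ^ (1 / t) := by
        gcongr
    _ = _ := by
        rw [ENNReal.mul_rpow_of_nonneg _ _ (by positivity),
          ENNReal.mul_rpow_of_nonneg _ _ (by positivity), ← ENNReal.rpow_mul]
        congr 3
        field_simp

lemma pointwise [SecondCountableTopology X] {μ : Measure X} [SFinite μ] {D : ℝ≥0∞} (h : Dbl μ D)
    (s t : ℝ) (hs : 0 < s) (ht : 1 ≤ t)
    (Q c : ℝ) (hQ : 0 < Q) (hc : 0 < c)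
    (hlow : ∀ (x : X) (r : ℝ), 0 < r → ENNReal.ofReal (c * r ^ Q) ≤ μ (ball x r)) :
    ∃ C : ℝ≥0∞, C ≠ ⊤ ∧ ∀ f : X → ℝ, MemLip0 f → ∀ x, ENNReal.ofReal |f x| ≤
      C * ∑' j : ℤ, ee j ^ s * av μ (2 ^ j) (fun y => fracEnergyKernel μ s t f y ^ (1 / t)) x := by
  have ht0 : 0 < t := by linarith
  refine ⟨(D * D) ^ (1 / t) * 4 ^ s, ?_, ?_⟩
  · refine ENNReal.mul_ne_top ?_ ?_
    · exact ENNReal.rpow_ne_top_of_nonneg (by positivity) (ENNReal.mul_ne_top h.top h.top)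
    · exact ENNReal.rpow_ne_top_of_nonneg hs.le (by norm_num)
  rintro f ⟨⟨K, hK⟩, x₀, r₀, hr₀⟩ x
  have hf : Continuous f := hK.continuous
  set C : ℝ≥0∞ := (D * D) ^ (1 / t) * 4 ^ s with hCdef
  set g : X → ℝ≥0∞ := fun y => fracEnergyKernel μ s t f y ^ (1 / t) with hg
  have hgm : Measurable g := (measurable_kernel μ s t hf).pow_const _
  have hfm : Measurable fun y => ENNReal.ofReal |f y| :=
    ENNReal.measurable_ofReal.comp (Continuous.measurable (by fun_prop))
  set a : ℤ → ℝ≥0∞ := fun j => av μ (2 ^ j) (fun y => ENNReal.ofReal |f y|) x with ha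
  set b : ℤ → ℝ≥0∞ := fun j => C * (ee j ^ s * av μ (2 ^ j) g x) with hb
  have step : ∀ j : ℤ, a j ≤ a (j + 1) + b j := by
    intro j
    have hj : (0:ℝ) < 2 ^ j := by positivity
    have hj1 : (0:ℝ) < 2 ^ (j + 1) := by positivity
    have hle : (2:ℝ) ^ j ≤ 2 ^ (j + 1) := zpow_le_zpow_right₀ (by norm_num) (by omega)
    have h1 : ∀ y ∈ ball x (2 ^ j : ℝ), ENNReal.ofReal |f y| ≤ a (j + 1) + C * ee j ^ s * g y := by
      intro y hy
      have hy' : y ∈ ball x (2 ^ (j + 1) : ℝ) := ball_subset_ball hle hy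
      calc ENNReal.ofReal |f y| = av μ (2 ^ (j + 1)) (fun _ => ENNReal.ofReal |f y|) x :=
            (av_const h hj1 _ x).symm
        _ ≤ av μ (2 ^ (j + 1)) (fun z => ENNReal.ofReal |f z| + ENNReal.ofReal |f y - f z|) x := by
            refine av_mono fun z _ => ?_
            rw [← ENNReal.ofReal_add (abs_nonneg _) (abs_nonneg _)]
            refine ENNReal.ofReal_le_ofReal ?_
            have := abs_add_le (f z) (f y - f z)
            simpa using this
        _ = a (j + 1) + av μ (2 ^ (j + 1)) (fun z => ENNReal.ofReal |f y - f z|) x := av_add hfm x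
        _ ≤ a (j + 1) + C * ee j ^ s * g y := by
            gcongr
            refine (osc h s t hs ht hf hj1 hy').trans (le_of_eq ?_)
            have : ENNReal.ofReal (2 * 2 ^ (j + 1)) = 4 * ee j := by
              rw [zpow_add_one₀ (by norm_num), show (2:ℝ) * (2 ^ j * 2) = 4 * 2 ^ j by ring,
                ENNReal.ofReal_mul (by norm_num), ee]
              norm_num
            rw [this, ENNReal.mul_rpow_of_nonneg _ _ hs.le, hCdef, ← mul_assoc]
    calc a j ≤ av μ (2 ^ j) (fun y => a (j + 1) + C * ee j ^ s * g y) x := av_mono h1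
      _ = a (j + 1) + b j := by
          rw [av_add measurable_const, av_const h hj, av_const_mul _ hgm, hb, mul_assoc]
  have tele : ∀ (m : ℕ) (j : ℤ), a j ≤ a (j + m) + ∑ i ∈ Finset.range m, b (j + i) := by
    intro m j
    induction m with
    | zero => simp
    | succ m ih =>
      refine ih.trans ?_
      rw [Finset.sum_range_succ]
      have := step (j + m)
      calc _ ≤ (a (j + m + 1) + b (j + m)) + ∑ i ∈ Finset.range m, b (j + i) := by gcongr
        _ = _ := by push_cast; rw [← add_assoc j]; ring
  have tele2 : ∀ n : ℕ, a (-n) ≤ a n + ∑' j, b j := by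
    intro n
    have := tele (2 * n) (-n)
    have e : (-(n:ℤ) + ((2 * n : ℕ) : ℤ)) = n := by push_cast; ring
    rw [e] at this
    refine this.trans ?_
    gcongr
    have hinj : Function.Injective (fun i : ℕ => (-(n:ℤ) + (i:ℤ))) := by
      intro i j hij
      simp only at hij
      omega
    exact (ENNReal.sum_le_tsum _).trans (ENNReal.tsum_comp_le_tsum_of_injective hinj b)
  have hloc : ∀ n : ℕ, ENNReal.ofReal |f x| ≤ a (-n) + ENNReal.ofReal (K * 2 ^ (-(n:ℤ))) := by
    intro n
    have hj : (0:ℝ) < 2 ^ (-(n:ℤ)) := by positivity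
    calc ENNReal.ofReal |f x| = av μ (2 ^ (-(n:ℤ))) (fun _ => ENNReal.ofReal |f x|) x :=
            (av_const h hj _ x).symm
      _ ≤ av μ (2 ^ (-(n:ℤ))) (fun z => ENNReal.ofReal |f z| + ENNReal.ofReal (K * 2 ^ (-(n:ℤ)))) x := by
            refine av_mono fun z hz => ?_
            rw [← ENNReal.ofReal_add (abs_nonneg _) (by positivity)]
            refine ENNReal.ofReal_le_ofReal ?_
            have h1 := abs_add_le (f z) (f x - f z)
            have h2 := hK.dist_le_mul x z
            rw [Real.dist_eq] at h2
            have h3 : dist x z ≤ 2 ^ (-(n:ℤ)) := by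
              rw [dist_comm]; exact (mem_ball.1 hz).le
            have h4 : (K:ℝ) * dist x z ≤ K * 2 ^ (-(n:ℤ)) := by gcongr
            have h5 : f z + (f x - f z) = f x := by ring
            rw [h5] at h1
            linarith
      _ = _ := by rw [av_add hfm, av_const h hj]
  set I : ℝ≥0∞ := ∫⁻ y, ENNReal.ofReal |f y| ∂μ with hI
  have hIfin : I ≠ ⊤ := by
    have hb : ∀ y, ENNReal.ofReal |f y| ≤
        (ball x₀ (max r₀ 1)).indicator (fun _ => ENNReal.ofReal (|f x₀| + K * max r₀ 1)) y := by
      intro y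
      by_cases hy : y ∈ ball x₀ (max r₀ 1)
      · rw [indicator_of_mem hy]
        refine ENNReal.ofReal_le_ofReal ?_
        have h1 := abs_add_le (f x₀) (f y - f x₀)
        have h2 := hK.dist_le_mul y x₀
        rw [Real.dist_eq] at h2
        have h3 : dist y x₀ ≤ max r₀ 1 := (mem_ball.1 hy).le
        have h4 : (K:ℝ) * dist y x₀ ≤ K * max r₀ 1 := by gcongr
        have h5 : f x₀ + (f y - f x₀) = f y := by ring
        rw [h5] at h1
        linarith
      · have : f y = 0 := hr₀ y (fun h => hy (ball_subset_ball (le_max_left _ _) h))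
        simp [this]
    refine ne_top_of_le_ne_top ?_ (lintegral_mono hb)
    rw [lintegral_indicator measurableSet_ball, setLIntegral_const]
    exact ENNReal.mul_ne_top ENNReal.ofReal_ne_top (h.fin (lt_max_of_lt_right one_pos))
  have hglob : ∀ n : ℕ, a n ≤ I / ENNReal.ofReal (c * (2 ^ n) ^ Q) := by
    intro n
    rw [ha]
    simp only [av, zpow_natCast]
    refine ENNReal.div_le_div (setLIntegral_le_lintegral _ _) (hlow x _ (by positivity))
  have hall : ∀ n : ℕ, ENNReal.ofReal |f x| ≤
      I / ENNReal.ofReal (c * (2 ^ n) ^ Q) + ∑' j, b j + ENNReal.ofReal (K * 2 ^ (-(n:ℤ))) := by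
    intro n
    refine (hloc n).trans ?_
    gcongr
    refine (tele2 n).trans ?_
    gcongr
    exact hglob n
  have lim1 : Filter.Tendsto (fun n : ℕ => I / ENNReal.ofReal (c * (2 ^ n) ^ Q)) Filter.atTop (nhds 0) := by
    have t1 : Filter.Tendsto (fun n : ℕ => c * ((2:ℝ) ^ n) ^ Q) Filter.atTop Filter.atTop := by
      refine Filter.Tendsto.const_mul_atTop hc ?_
      exact (tendsto_rpow_atTop hQ).comp (tendsto_pow_atTop_atTop_of_one_lt (by norm_num))
    have t2 := ENNReal.tendsto_ofReal_atTop.comp t1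
    have t3 := ENNReal.Tendsto.const_div (a := I) t2 (Or.inr hIfin)
    simpa using t3
  have lim2 : Filter.Tendsto (fun n : ℕ => ENNReal.ofReal (K * 2 ^ (-(n:ℤ)))) Filter.atTop (nhds 0) := by
    have t1 : Filter.Tendsto (fun n : ℕ => (K:ℝ) * 2 ^ (-(n:ℤ))) Filter.atTop (nhds 0) := by
      have := (tendsto_pow_atTop_nhds_zero_of_lt_one (r := (1/2:ℝ)) (by norm_num) (by norm_num)).const_mul (K:ℝ)
      simpa using this
    have := ENNReal.tendsto_ofReal t1
    simpa using this
  have lim := (lim1.add (tendsto_const_nhds (x := ∑' j, b j))).add lim2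
  have := ge_of_tendsto' lim hall
  simpa [hb, ENNReal.tsum_mul_left] using this

/-- Distance to `E` as an extended nonnegative real. -/
def dd (E : Set X) (x : X) : ℝ≥0∞ := ENNReal.ofReal (infDist x E)

lemma dd_ne_top (E : Set X) (x : X) : dd E x ≠ ⊤ := ENNReal.ofReal_ne_top

lemma measurable_dd (E : Set X) : Measurable (dd E) :=
  ENNReal.measurable_ofReal.comp (continuous_infDist_pt E).measurable

/-- Quantitative codimension bound. -/
def CodimBd (μ : Measure X) (E : Set X) (ρ C : ℝ) : Prop :=
  ∀ x ∈ E, ∀ r R : ℝ, 0 < r → r < R →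
    μ ({y : X | infDist y E < r} ∩ ball x R) ≤ ENNReal.ofReal (C * (r / R) ^ ρ) * μ (ball x R)

lemma dd_rpow_le_tsum (E : Set X) (a : ℝ) (ha : 0 < a) (R : ℝ) (hR : 0 < R) (y : X)
    (hy : infDist y E ≤ R) :
    dd E y ^ (-a) ≤ ∑' j : ℕ, {z : X | infDist z E < (1/2) ^ j * (2 * R)}.indicator
      (fun _ => ENNReal.ofReal R ^ (-a) * (2:ℝ≥0∞) ^ ((j + 1) * a)) y := by
  have hR0 : ENNReal.ofReal R ≠ 0 := by simpa using hR
  rcases (infDist_nonneg (x := y) (s := E)).eq_or_lt with h0 | h0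
  · have h1 : ∀ j : ℕ, ENNReal.ofReal R ^ (-a) ≤ {z : X | infDist z E < (1/2) ^ j * (2 * R)}.indicator
      (fun _ => ENNReal.ofReal R ^ (-a) * (2:ℝ≥0∞) ^ ((j + 1) * a)) y := by
      intro j
      rw [indicator_of_mem]
      · nth_rw 1 [← mul_one (ENNReal.ofReal R ^ (-a))]
        gcongr
        exact ENNReal.one_le_rpow (by norm_num) (by positivity)
      · change infDist y E < _
        rw [← h0]; positivity
    refine le_trans le_top (le_trans (le_of_eq ?_) (ENNReal.tsum_le_tsum h1))
    refine (ENNReal.tsum_const_eq_top_of_ne_zero ?_).symm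
    exact (ENNReal.rpow_pos (pos_iff_ne_zero.2 hR0) ENNReal.ofReal_ne_top).ne'
  · obtain ⟨n, hn1, hn2⟩ := exists_nat_pow_near_of_lt_one (x := infDist y E / R) (y := (1/2:ℝ))
      (by positivity) ((div_le_one hR).2 hy) (by norm_num) (by norm_num)
    refine le_trans ?_ (ENNReal.le_tsum n)
    rw [indicator_of_mem]
    · have h2 : ENNReal.ofReal R * (2:ℝ≥0∞) ^ (-((n:ℝ) + 1)) ≤ dd E y := by
        have : (2:ℝ≥0∞) ^ (-((n:ℝ) + 1)) = ENNReal.ofReal ((1/2) ^ (n + 1)) := by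
          rw [ENNReal.ofReal_pow (by norm_num), one_div, ENNReal.ofReal_inv_of_pos (by norm_num),
            ← ENNReal.inv_pow, ENNReal.rpow_neg, ← ENNReal.rpow_natCast]
          norm_num
        rw [this, ← ENNReal.ofReal_mul hR.le, dd]
        refine ENNReal.ofReal_le_ofReal ?_
        rw [lt_div_iff₀ hR] at hn1
        linarith
      have h3 : ENNReal.ofReal R ^ (-a) * (2:ℝ≥0∞) ^ ((n + 1) * a) =
          (ENNReal.ofReal R * (2:ℝ≥0∞) ^ (-((n:ℝ) + 1))) ^ (-a) := by
        rw [mul_rpow' _ _ _ hR0 ENNReal.ofReal_ne_top, ← ENNReal.rpow_mul]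
        congr 2; ring
      rw [h3, ENNReal.rpow_neg, ENNReal.rpow_neg]
      gcongr
    · change infDist y E < _
      rw [div_le_iff₀ hR] at hn2
      have : 0 < (1/2:ℝ) ^ n * R := by positivity
      linarith

lemma aikawa_center {μ : Measure X} {D : ℝ≥0∞} (h : Dbl μ D) (E : Set X) (ρ C₀ : ℝ)
    (hC₀ : 0 ≤ C₀) (hco : CodimBd μ E ρ C₀) (a : ℝ) (ha : 0 < a) (haρ : a < ρ) :
    ∃ C : ℝ≥0∞, C ≠ ⊤ ∧ ∀ x ∈ E, ∀ R : ℝ, 0 < R →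
      ∫⁻ y in ball x R, dd E y ^ (-a) ∂μ ≤ C * ENNReal.ofReal R ^ (-a) * μ (ball x R) := by
  have hlt : (2:ℝ≥0∞) ^ (a - ρ) < 1 := by
    rw [show a - ρ = -(ρ - a) by ring, ENNReal.rpow_neg]
    exact ENNReal.inv_lt_one.2 (ENNReal.one_lt_rpow (by norm_num) (by linarith))
  refine ⟨2 ^ a * ENNReal.ofReal C₀ * (D * D) * (1 - (2:ℝ≥0∞) ^ (a - ρ))⁻¹, ?_, ?_⟩
  · refine ENNReal.mul_ne_top (ENNReal.mul_ne_top (ENNReal.mul_ne_top ?_ ENNReal.ofReal_ne_top)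
      (ENNReal.mul_ne_top h.top h.top)) ?_
    · exact ENNReal.rpow_ne_top_of_nonneg ha.le (by norm_num)
    · rw [Ne, ENNReal.inv_eq_top]
      exact (tsub_pos_of_lt hlt).ne'
  intro x hx R hR
  have hms : ∀ j : ℕ, MeasurableSet {z : X | infDist z E < (1/2:ℝ) ^ j * (2 * R)} := fun j =>
    (isOpen_lt (continuous_infDist_pt E) continuous_const).measurableSet
  have hvol : μ (ball x (4 * R)) ≤ D * (D * μ (ball x R)) := by
    rw [show 4 * R = 2 * (2 * R) by ring]
    refine (h.dbl x (2 * R) (by positivity)).trans ?_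
    gcongr
    exact h.dbl x R hR
  have hterm : ∀ j : ℕ, μ ({z : X | infDist z E < (1/2:ℝ) ^ j * (2 * R)} ∩ ball x R) ≤
      ENNReal.ofReal C₀ * (2:ℝ≥0∞) ^ (-(j * ρ)) * (D * (D * μ (ball x R))) := by
    intro j
    have hle1 : (1/2:ℝ) ^ j ≤ 1 := pow_le_one₀ (by norm_num) (by norm_num)
    calc μ ({z : X | infDist z E < (1/2:ℝ) ^ j * (2 * R)} ∩ ball x R)
        ≤ μ ({z : X | infDist z E < (1/2:ℝ) ^ j * (2 * R)} ∩ ball x (4 * R)) := by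
          refine measure_mono (inter_subset_inter_right _ (ball_subset_ball (by linarith)))
      _ ≤ ENNReal.ofReal (C₀ * ((1/2:ℝ) ^ j * (2 * R) / (4 * R)) ^ ρ) * μ (ball x (4 * R)) := by
          refine hco x hx _ _ (by positivity) ?_
          nlinarith
      _ ≤ ENNReal.ofReal C₀ * (2:ℝ≥0∞) ^ (-(j * ρ)) * (D * (D * μ (ball x R))) := by
          gcongr
          rw [ENNReal.ofReal_mul hC₀]
          gcongr
          have : (2:ℝ≥0∞) ^ (-(j * ρ)) = ENNReal.ofReal (((1/2:ℝ) ^ j) ^ ρ) := by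
            rw [← ENNReal.ofReal_rpow_of_pos (by positivity), ENNReal.ofReal_pow (by norm_num), one_div,
              ENNReal.ofReal_inv_of_pos (by norm_num), ← ENNReal.inv_pow, ENNReal.inv_rpow,
              ← ENNReal.rpow_natCast, ← ENNReal.rpow_mul, ENNReal.rpow_neg]
            norm_num
          rw [this]
          refine ENNReal.ofReal_le_ofReal (Real.rpow_le_rpow (by positivity) ?_ (by linarith))
          rw [div_le_iff₀ (by positivity)]
          have : 0 < (1/2:ℝ) ^ j * R := by positivity
          linarith
  have hpt : ∀ y ∈ ball x R, dd E y ^ (-a) ≤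
      ∑' j : ℕ, {z : X | infDist z E < (1/2) ^ j * (2 * R)}.indicator
      (fun _ => ENNReal.ofReal R ^ (-a) * (2:ℝ≥0∞) ^ ((j + 1) * a)) y := by
    intro y hy
    refine dd_rpow_le_tsum E a ha R hR y ?_
    exact (infDist_le_dist_of_mem hx).trans (mem_ball.1 hy).le
  calc ∫⁻ y in ball x R, dd E y ^ (-a) ∂μ
      ≤ ∫⁻ y in ball x R, (∑' j : ℕ, {z : X | infDist z E < (1/2) ^ j * (2 * R)}.indicator
      (fun _ => ENNReal.ofReal R ^ (-a) * (2:ℝ≥0∞) ^ ((j + 1) * a)) y) ∂μ :=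
        setLIntegral_mono' measurableSet_ball hpt
    _ = ∑' j : ℕ, (ENNReal.ofReal R ^ (-a) * (2:ℝ≥0∞) ^ ((j + 1) * a)) *
          μ ({z : X | infDist z E < (1/2) ^ j * (2 * R)} ∩ ball x R) := by
        rw [lintegral_tsum fun j => (measurable_const.indicator (hms j)).aemeasurable]
        congr 1
        ext j
        rw [lintegral_indicator (hms j), setLIntegral_const, Measure.restrict_apply (hms j)]
    _ ≤ ∑' j : ℕ, (2 ^ a * ENNReal.ofReal C₀ * (D * D) * ENNReal.ofReal R ^ (-a) * μ (ball x R)) *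
          ((2:ℝ≥0∞) ^ (a - ρ)) ^ j := by
        refine ENNReal.tsum_le_tsum fun j => ?_
        calc _ ≤ (ENNReal.ofReal R ^ (-a) * (2:ℝ≥0∞) ^ ((j + 1) * a)) *
              (ENNReal.ofReal C₀ * (2:ℝ≥0∞) ^ (-(j * ρ)) * (D * (D * μ (ball x R)))) := by
              gcongr; exact hterm j
          _ = (ENNReal.ofReal C₀ * (D * D) * ENNReal.ofReal R ^ (-a) * μ (ball x R)) *
              ((2:ℝ≥0∞) ^ ((j + 1) * a) * (2:ℝ≥0∞) ^ (-(j * ρ))) := by ring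
          _ = (ENNReal.ofReal C₀ * (D * D) * ENNReal.ofReal R ^ (-a) * μ (ball x R)) *
              (2 ^ a * ((2:ℝ≥0∞) ^ (a - ρ)) ^ j) := by
              congr 1
              rw [← ENNReal.rpow_natCast, ← ENNReal.rpow_mul,
                ← ENNReal.rpow_add _ _ (by norm_num) (by norm_num),
                ← ENNReal.rpow_add _ _ (by norm_num) (by norm_num)]
              congr 1; ring
          _ = _ := by ring
    _ = _ := by
        rw [ENNReal.tsum_mul_left, ENNReal.tsum_geometric]; ring

lemma aikawa {μ : Measure X} {D : ℝ≥0∞} (h : Dbl μ D) (E : Set X) (hE : E.Nonempty) (ρ C₀ : ℝ)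
    (hρ : 0 < ρ) (hC₀ : 0 ≤ C₀) (hco : CodimBd μ E ρ C₀) (a : ℝ) (haρ : a < ρ) :
    ∃ C : ℝ≥0∞, C ≠ ⊤ ∧ ∀ (x : X) (r : ℝ), 0 < r → infDist x E ≤ 3 * r →
      av μ r (fun y => dd E y ^ (-a)) x ≤ C * ENNReal.ofReal r ^ (-a) := by
  set b := max a (ρ / 2) with hb
  have hb0 : 0 < b := lt_max_of_lt_right (by linarith)
  have hbρ : b < ρ := max_lt haρ (by linarith)
  have hab : a ≤ b := le_max_left _ _
  obtain ⟨C, hC, hA⟩ := aikawa_center h E ρ C₀ hC₀ hco b hb0 hbρ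
  refine ⟨4 ^ (b - a) * (C * (D * (D * (D * D)))), ?_, ?_⟩
  · refine ENNReal.mul_ne_top (ENNReal.rpow_ne_top_of_nonneg (by linarith) (by norm_num)) ?_
    have := h.top
    exact ENNReal.mul_ne_top hC (ENNReal.mul_ne_top this (ENNReal.mul_ne_top this
      (ENNReal.mul_ne_top this this)))
  intro x r hr hx
  obtain ⟨x₀, hx₀, hd⟩ := (infDist_lt_iff hE).1 (show infDist x E < 4 * r by linarith)
  have hr0 : ENNReal.ofReal r ≠ 0 := by simpa using hr
  have h4r0 : ENNReal.ofReal (4 * r) ≠ 0 := by simpa using hr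
  have h1 : ∫⁻ y in ball x r, dd E y ^ (-b) ∂μ ≤
      C * ENNReal.ofReal r ^ (-b) * (D * (D * (D * (D * μ (ball x r))))) := by
    have hsub : ball x r ⊆ ball x₀ (8 * r) := by
      intro y hy
      rw [mem_ball] at hy ⊢
      have := dist_triangle y x x₀
      linarith
    have hsub2 : ball x₀ (8 * r) ⊆ ball x (2 * (2 * (2 * (2 * r)))) := by
      intro y hy
      rw [mem_ball] at hy ⊢
      have := dist_triangle_right y x x₀
      linarith
    refine (lintegral_mono_set hsub).trans ((hA x₀ hx₀ (8 * r) (by positivity)).trans ?_)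
    gcongr C * ?_ * ?_
    · rw [ENNReal.rpow_neg, ENNReal.rpow_neg]
      gcongr
      linarith
    · refine (measure_mono hsub2).trans ((h.dbl _ _ (by positivity)).trans ?_)
      gcongr
      refine (h.dbl _ _ (by positivity)).trans ?_
      gcongr
      refine (h.dbl _ _ (by positivity)).trans ?_
      gcongr
      exact h.dbl _ _ hr
  have h2 : av μ r (fun y => dd E y ^ (-b)) x ≤ C * ENNReal.ofReal r ^ (-b) * (D * (D * (D * D))) := by
    refine ENNReal.div_le_of_le_mul (h1.trans (le_of_eq ?_))
    ring
  have hm : Measurable fun y => dd E y ^ (-b) := (measurable_dd E).pow_const _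
  calc av μ r (fun y => dd E y ^ (-a)) x
      ≤ av μ r (fun y => ENNReal.ofReal (4 * r) ^ (b - a) * dd E y ^ (-b)) x := by
        refine av_mono fun y hy => ?_
        refine rpow_le_change _ _ _ _ hab hb0 h4r0 ENNReal.ofReal_ne_top ?_
        refine ENNReal.ofReal_le_ofReal ?_
        have h3 := infDist_le_infDist_add_dist (s := E) (x := y) (y := x)
        have h4 := mem_ball.1 hy
        linarith
    _ = ENNReal.ofReal (4 * r) ^ (b - a) * av μ r (fun y => dd E y ^ (-b)) x := av_const_mul _ hm _
    _ ≤ ENNReal.ofReal (4 * r) ^ (b - a) * (C * ENNReal.ofReal r ^ (-b) * (D * (D * (D * D)))) := by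
        gcongr
    _ = 4 ^ (b - a) * (C * (D * (D * (D * D)))) * (ENNReal.ofReal r ^ (b - a) * ENNReal.ofReal r ^ (-b)) := by
        rw [ENNReal.ofReal_mul (by norm_num), ENNReal.mul_rpow_of_nonneg _ _ (by linarith)]
        norm_num
        ring
    _ = _ := by
        rw [← ENNReal.rpow_add _ _ hr0 ENNReal.ofReal_ne_top]
        congr 2; ring

lemma dd_ae {μ : Measure X} {D : ℝ≥0∞} (h : Dbl μ D) (E : Set X) (hE : E.Nonempty) (ρ C₀ : ℝ)
    (hρ : 0 < ρ) (hC₀ : 0 ≤ C₀) (hco : CodimBd μ E ρ C₀) : ∀ᵐ x ∂μ, dd E x ≠ 0 := by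
  obtain ⟨C, hC, hA⟩ := aikawa_center h E ρ C₀ hC₀ hco (ρ / 2) (by linarith) (by linarith)
  obtain ⟨x₀, hx₀⟩ := hE
  have hn : ∀ n : ℕ, ∀ᵐ x ∂μ, x ∈ ball x₀ (n + 1 : ℝ) → dd E x ≠ 0 := by
    intro n
    have hr : (0:ℝ) < n + 1 := by positivity
    have hfin : ∫⁻ y in ball x₀ (n + 1 : ℝ), dd E y ^ (-(ρ / 2)) ∂μ ≠ ⊤ := by
      refine ne_top_of_le_ne_top ?_ (hA x₀ hx₀ _ hr)
      refine ENNReal.mul_ne_top (ENNReal.mul_ne_top hC ?_) (h.fin hr)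
      have : ENNReal.ofReal ((n:ℝ) + 1) ≠ 0 := by simpa using hr
      simp [ENNReal.rpow_eq_top_iff, this]
    have := ae_lt_top ((measurable_dd E).pow_const _) hfin
    rw [ae_restrict_iff' measurableSet_ball] at this
    filter_upwards [this] with x hx hxb h0
    have := hx hxb
    rw [h0, ENNReal.zero_rpow_of_neg (by linarith)] at this
    exact lt_irrefl _ this
  filter_upwards [ae_all_iff.2 hn] with x hx
  obtain ⟨n, hn⟩ := exists_nat_gt (dist x x₀)
  exact hx n (by rw [mem_ball]; linarith)

lemma dd_le_nat (E : Set X) (y : X) (j : ℤ) (n : ℕ) :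
    dd E y ≤ n * ee j ↔ infDist y E ≤ n * 2 ^ j := by
  have : (n : ℝ≥0∞) * ee j = ENNReal.ofReal (n * 2 ^ j) := by
    rw [ENNReal.ofReal_mul (by positivity), ee]; simp
  rw [this, dd, ENNReal.ofReal_le_ofReal_iff (by positivity)]

lemma dd_le_two (E : Set X) (y : X) (j : ℤ) :
    dd E y ≤ 2 * ee j ↔ infDist y E ≤ 2 * 2 ^ j := by
  simpa using dd_le_nat E y j 2

lemma dd_le_three (E : Set X) (y : X) (j : ℤ) :
    dd E y ≤ 3 * ee j ↔ infDist y E ≤ 3 * 2 ^ j := by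
  simpa using dd_le_nat E y j 3

lemma av_eq {μ : Measure X} (r : ℝ) (u : X → ℝ≥0∞) (x : X) :
    av μ r u x = ∫⁻ y, u y ∂((μ (ball x r))⁻¹ • μ.restrict (ball x r)) := by
  rw [lintegral_smul_measure, av, ENNReal.div_eq_inv_mul, smul_eq_mul]

lemma le_av_ae {μ : Measure X} {r : ℝ} {u v : X → ℝ≥0∞} {x : X}
    (huv : ∀ᵐ y ∂μ, y ∈ ball x r → u y ≤ v y) : av μ r u x ≤ av μ r v x := by
  unfold av
  refine ENNReal.div_le_div_right ?_ _
  exact lintegral_mono_ae ((ae_restrict_iff' measurableSet_ball).2 huv)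

/-- summation step in the far part -/
lemma far_sum (q e1 : ℝ) (hq : 1 < q) (he1 : 0 < e1) : ∃ C : ℝ≥0∞, C ≠ ⊤ ∧
    ∀ (d : ℝ≥0∞), d ≠ 0 → d ≠ ⊤ → ∀ A : ℤ → ℝ≥0∞,
      (∑' j, if d ≤ 2 * ee j then A j else 0) ^ q ≤
        C * ∑' j, (if d ≤ 2 * ee j then ee j ^ e1 * d ^ (-e1) * A j ^ q else 0) := by
  set ε1 := e1 / (q - 1) with hε1
  have hq1 : 0 < q - 1 := by linarith
  have hε1p : 0 < ε1 := by positivity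
  obtain ⟨C, hC, hC0, hgeo⟩ := geo_ge ε1 hε1p
  have h20 : (2:ℝ≥0∞) ^ ε1 ≠ ⊤ := ENNReal.rpow_ne_top_of_nonneg hε1p.le (by norm_num)
  refine ⟨(C * 2 ^ ε1) ^ (q - 1), ENNReal.rpow_ne_top_of_nonneg hq1.le (ENNReal.mul_ne_top hC h20), ?_⟩
  intro d hd0 hd A
  have key := jensen_tsum (fun j => if d ≤ 2 * ee j then ee j ^ (-ε1) * d ^ ε1 else 0)
    (fun j => ee j ^ ε1 * d ^ (-ε1) * A j) q hq.le
  have e1' : ∀ j, (if d ≤ 2 * ee j then ee j ^ (-ε1) * d ^ ε1 else 0) *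
      (ee j ^ ε1 * d ^ (-ε1) * A j) = if d ≤ 2 * ee j then A j else 0 := by
    intro j
    split_ifs
    · calc _ = (ee j ^ (-ε1) * ee j ^ ε1) * (d ^ ε1 * d ^ (-ε1)) * A j := by ring
        _ = A j := by
          rw [← ENNReal.rpow_add _ _ (ee_ne_zero j) (ee_ne_top j), ← ENNReal.rpow_add _ _ hd0 hd]
          simp
    · simp
  have e2' : ∀ j, (if d ≤ 2 * ee j then ee j ^ (-ε1) * d ^ ε1 else 0) *
      (ee j ^ ε1 * d ^ (-ε1) * A j) ^ q =
      if d ≤ 2 * ee j then ee j ^ e1 * d ^ (-e1) * A j ^ q else 0 := by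
    intro j
    split_ifs
    · rw [ENNReal.mul_rpow_of_nonneg _ _ (by linarith), ENNReal.mul_rpow_of_nonneg _ _ (by linarith),
        ← ENNReal.rpow_mul, ← ENNReal.rpow_mul]
      calc _ = (ee j ^ (-ε1) * ee j ^ (ε1 * q)) * (d ^ ε1 * d ^ (-ε1 * q)) * A j ^ q := by ring
        _ = _ := by
          rw [← ENNReal.rpow_add _ _ (ee_ne_zero j) (ee_ne_top j), ← ENNReal.rpow_add _ _ hd0 hd]
          have : ε1 * (q - 1) = e1 := by rw [hε1]; field_simp
          congr 3 <;> linarith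
    · simp
  have e3' : ∑' j, (if d ≤ 2 * ee j then ee j ^ (-ε1) * d ^ ε1 else 0) ≤ C * 2 ^ ε1 := by
    have : ∀ j, (if d ≤ 2 * ee j then ee j ^ (-ε1) * d ^ ε1 else 0) =
        (if d / 2 ≤ ee j then ee j ^ (-ε1) else 0) * d ^ ε1 := by
      intro j
      have : d / 2 ≤ ee j ↔ d ≤ 2 * ee j := by
        rw [ENNReal.div_le_iff_le_mul (by simp) (by simp), mul_comm]
      simp only [this]
      split_ifs <;> simp
    simp only [this]
    rw [ENNReal.tsum_mul_right]
    calc _ ≤ C * (d / 2) ^ (-ε1) * d ^ ε1 := by gcongr; exact hgeo _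
      _ = C * 2 ^ ε1 * (d ^ (-ε1) * d ^ ε1) := by
        rw [ENNReal.div_eq_inv_mul, mul_rpow' _ _ _ (by simp) (by simp), ENNReal.inv_rpow,
          ENNReal.rpow_neg 2, inv_inv]
        ring
      _ = _ := by
        rw [← ENNReal.rpow_add _ _ hd0 hd]; simp
  simp only [e1', e2'] at key
  refine key.trans ?_
  gcongr

/-- one scale estimate in the far part -/
lemma far_scale {μ : Measure X} {D : ℝ≥0∞} (h : Dbl μ D) (E : Set X)
    (hae : ∀ᵐ x ∂μ, dd E x ≠ 0) (s Q c p q β ε α : ℝ) (hs : 0 < s) (hc : 0 < c)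
    (hlow : ∀ (x : X) (r : ℝ), 0 < r → ENNReal.ofReal (c * r ^ Q) ≤ μ (ball x r))
    (hp : 1 < p) (hpq : p ≤ q) (hε : 0 < ε)
    (hα : α = Q - q / p * (Q - s * p + β)) (C₂ : ℝ≥0∞) (hC₂ : C₂ ≠ ⊤)
    (haik : ∀ (x : X) (r : ℝ), 0 < r → infDist x E ≤ 3 * r →
      av μ r (fun y => dd E y ^ (-((β + ε) / (p - 1)))) x ≤ C₂ * ENNReal.ofReal r ^ (-((β + ε) / (p - 1)))) :
    ∃ C : ℝ≥0∞, C ≠ ⊤ ∧ ∀ g : X → ℝ≥0∞, Measurable g → ∀ (j : ℤ) (x : X), dd E x ≤ 2 * ee j →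
      (ee j ^ s * av μ (2 ^ j) g x) ^ q ≤
        C * (∫⁻ y, g y ^ p * dd E y ^ β ∂μ) ^ (q / p - 1) * ee j ^ (α - ε) *
        av μ (2 ^ j) (fun y => if dd E y ≤ 3 * ee j then g y ^ p * dd E y ^ β * dd E y ^ ε else 0) x := by
  have hp0 : 0 < p := by linarith
  have hp1 : 0 < p - 1 := by linarith
  have hq0 : 0 < q := by linarith
  have hqp : 0 ≤ q / p - 1 := by
    rw [sub_nonneg, le_div_iff₀ hp0]; linarith
  set a2 := (β + ε) / (p - 1) with ha2
  have ha2p : a2 * (p - 1) = β + ε := by rw [ha2]; field_simp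
  have hc0 : ENNReal.ofReal c ≠ 0 := by simpa using hc
  refine ⟨(C₂ ^ (p - 1)) ^ (q / p) * (3 ^ ε * (ENNReal.ofReal c)⁻¹) ^ (q / p - 1), ?_, ?_⟩
  · refine ENNReal.mul_ne_top (ENNReal.rpow_ne_top_of_nonneg (by positivity)
      (ENNReal.rpow_ne_top_of_nonneg hp1.le hC₂)) (ENNReal.rpow_ne_top_of_nonneg hqp
      (ENNReal.mul_ne_top (ENNReal.rpow_ne_top_of_nonneg hε.le (by norm_num)) (by simpa using hc)))
  intro g hg j x hx
  set N := ∫⁻ y, g y ^ p * dd E y ^ β ∂μ with hN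
  set K : X → ℝ≥0∞ := fun y => if dd E y ≤ 3 * ee j then g y ^ p * dd E y ^ β * dd E y ^ ε else 0 with hK
  have hr : (0:ℝ) < 2 ^ j := by positivity
  have hx' := (dd_le_two E x j).1 hx
  have hdy : ∀ y ∈ ball x ((2:ℝ) ^ j), dd E y ≤ 3 * ee j := by
    intro y hy
    rw [dd_le_three]
    have h3 := infDist_le_infDist_add_dist (s := E) (x := y) (y := x)
    have h4 := mem_ball.1 hy
    linarith
  have hdm := measurable_dd E
  -- Hölder
  have h1 : av μ (2 ^ j) g x ^ p ≤ C₂ ^ (p - 1) * ee j ^ (-(β + ε)) * av μ (2 ^ j) K x := by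
    have key := jensen_mul ((μ (ball x (2 ^ j)))⁻¹ • μ.restrict (ball x (2 ^ j)))
      (fun y => dd E y ^ (-a2)) (fun y => dd E y ^ a2 * g y) (hdm.pow_const _).aemeasurable
      ((hdm.pow_const _).mul hg).aemeasurable p hp.le
    rw [← av_eq, ← av_eq, ← av_eq] at key
    calc av μ (2 ^ j) g x ^ p ≤ av μ (2 ^ j) (fun y => dd E y ^ (-a2) * (dd E y ^ a2 * g y)) x ^ p := by
          refine ENNReal.rpow_le_rpow ?_ hp0.le
          refine le_av_ae ?_
          filter_upwards [hae] with y hy _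
          rw [← mul_assoc, ← ENNReal.rpow_add _ _ hy (dd_ne_top E y)]
          simp
      _ ≤ av μ (2 ^ j) (fun y => dd E y ^ (-a2)) x ^ (p - 1) *
            av μ (2 ^ j) (fun y => dd E y ^ (-a2) * (dd E y ^ a2 * g y) ^ p) x := key
      _ ≤ (C₂ * ee j ^ (-a2)) ^ (p - 1) * av μ (2 ^ j) K x := by
          gcongr ?_ ^ (p - 1) * ?_
          · exact haik x _ hr (by linarith)
          · refine le_av_ae ?_
            filter_upwards [hae] with y hy hyb
            rw [hK]
            simp only [hdy y hyb, if_true]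
            rw [ENNReal.mul_rpow_of_nonneg _ _ hp0.le, ← ENNReal.rpow_mul, ← mul_assoc,
              ← ENNReal.rpow_add _ _ hy (dd_ne_top E y), mul_assoc,
              ← ENNReal.rpow_add _ _ hy (dd_ne_top E y), mul_comm]
            refine le_of_eq ?_
            congr 2
            linarith
      _ = _ := by
          rw [ENNReal.mul_rpow_of_nonneg _ _ hp1.le, ← ENNReal.rpow_mul]
          congr 3
          linarith
  have h2 : av μ (2 ^ j) K x ≤ 3 ^ ε * (ENNReal.ofReal c)⁻¹ * ee j ^ (ε - Q) * N := by
    have hKN : ∫⁻ y in ball x (2 ^ j), K y ∂μ ≤ (3 * ee j) ^ ε * N := by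
      refine (setLIntegral_le_lintegral _ _).trans ?_
      have hGm : Measurable fun y => g y ^ p * dd E y ^ β := (hg.pow_const _).mul (hdm.pow_const _)
      rw [hN, ← lintegral_const_mul _ hGm]
      refine lintegral_mono fun y => ?_
      rw [hK]
      simp only
      split_ifs with hy
      · rw [mul_comm]
        gcongr
      · exact bot_le
    have hV : ENNReal.ofReal c * ee j ^ Q ≤ μ (ball x (2 ^ j)) := by
      refine le_trans (le_of_eq ?_) (hlow x _ hr)
      rw [ENNReal.ofReal_mul hc.le, ee, ENNReal.ofReal_rpow_of_pos hr]
    calc av μ (2 ^ j) K x ≤ ((3 * ee j) ^ ε * N) / (ENNReal.ofReal c * ee j ^ Q) :=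
          ENNReal.div_le_div hKN hV
      _ = 3 ^ ε * (ENNReal.ofReal c)⁻¹ * (ee j ^ ε * ee j ^ (-Q)) * N := by
          rw [div_eq_mul_inv, ENNReal.mul_inv (Or.inl hc0) (Or.inl ENNReal.ofReal_ne_top),
            ENNReal.mul_rpow_of_nonneg _ _ hε.le, ENNReal.rpow_neg]
          ring
      _ = _ := by
          rw [← ENNReal.rpow_add _ _ (ee_ne_zero j) (ee_ne_top j)]; rfl
  have hqp' : q = p * (q / p) := by field_simp
  calc (ee j ^ s * av μ (2 ^ j) g x) ^ q
      = ee j ^ (s * q) * (av μ (2 ^ j) g x ^ p) ^ (q / p) := by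
        rw [ENNReal.mul_rpow_of_nonneg _ _ hq0.le, ← ENNReal.rpow_mul, ← ENNReal.rpow_mul, ← hqp']
    _ ≤ ee j ^ (s * q) * (C₂ ^ (p - 1) * ee j ^ (-(β + ε)) * av μ (2 ^ j) K x) ^ (q / p) := by
        gcongr
    _ = ee j ^ (s * q) * ((C₂ ^ (p - 1)) ^ (q / p) * ee j ^ (-(β + ε) * (q / p)) *
          (av μ (2 ^ j) K x * av μ (2 ^ j) K x ^ (q / p - 1))) := by
        rw [ENNReal.mul_rpow_of_nonneg _ _ (by positivity), ENNReal.mul_rpow_of_nonneg _ _ (by positivity),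
          ← ENNReal.rpow_mul (ee j)]
        congr 2
        nth_rw 2 [← ENNReal.rpow_one (av μ (2 ^ j) K x)]
        rw [← ENNReal.rpow_add_of_nonneg _ _ zero_le_one hqp]
        congr 1; ring
    _ ≤ ee j ^ (s * q) * ((C₂ ^ (p - 1)) ^ (q / p) * ee j ^ (-(β + ε) * (q / p)) *
          (av μ (2 ^ j) K x * (3 ^ ε * (ENNReal.ofReal c)⁻¹ * ee j ^ (ε - Q) * N) ^ (q / p - 1))) := by
        gcongr
    _ = (C₂ ^ (p - 1)) ^ (q / p) * (3 ^ ε * (ENNReal.ofReal c)⁻¹) ^ (q / p - 1) * N ^ (q / p - 1) *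
        (ee j ^ (s * q) * ee j ^ (-(β + ε) * (q / p)) * ee j ^ ((ε - Q) * (q / p - 1))) *
        av μ (2 ^ j) K x := by
        rw [ENNReal.mul_rpow_of_nonneg _ _ hqp, ENNReal.mul_rpow_of_nonneg (3 ^ ε * (ENNReal.ofReal c)⁻¹) _ hqp,
          ← ENNReal.rpow_mul (ee j)]
        ring
    _ = _ := by
        rw [← ENNReal.rpow_add _ _ (ee_ne_zero j) (ee_ne_top j),
          ← ENNReal.rpow_add _ _ (ee_ne_zero j) (ee_ne_top j)]
        congr 3
        rw [hα]
        field_simp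
        ring

lemma measurable_tsum_int {f : ℤ → X → ℝ≥0∞} (hf : ∀ j, Measurable (f j)) :
    Measurable fun x => ∑' j, f j x := Measurable.ennreal_tsum hf

lemma far [SecondCountableTopology X] {μ : Measure X} [SFinite μ] {D : ℝ≥0∞} (h : Dbl μ D)
    (E : Set X) (hE : E.Nonempty) (ρ C₀ : ℝ) (hρ : 0 < ρ) (hC₀ : 0 ≤ C₀) (hco : CodimBd μ E ρ C₀)
    (s Q c p q β α : ℝ) (hs : 0 < s) (hc : 0 < c)
    (hlow : ∀ (x : X) (r : ℝ), 0 < r → ENNReal.ofReal (c * r ^ Q) ≤ μ (ball x r))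
    (hp : 1 < p) (hpq : p ≤ q) (hα : α = Q - q / p * (Q - s * p + β))
    (hαρ : α < ρ) (hβρ : β / (p - 1) < ρ) :
    ∃ C : ℝ≥0∞, C ≠ ⊤ ∧ ∀ g : X → ℝ≥0∞, Measurable g →
      ∫⁻ x, (∑' j : ℤ, if dd E x ≤ 2 * ee j then ee j ^ s * av μ (2 ^ j) g x else 0) ^ q *
        dd E x ^ (-α) ∂μ ≤ C * (∫⁻ y, g y ^ p * dd E y ^ β ∂μ) ^ (q / p) := by
  have hae := dd_ae h E hE ρ C₀ hρ hC₀ hco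
  have hp0 : 0 < p := by linarith
  have hp1 : 0 < p - 1 := by linarith
  have hqp : 0 ≤ q / p - 1 := by
    rw [sub_nonneg, le_div_iff₀ hp0]; linarith
  have hdm := measurable_dd E
  obtain ⟨e1, he1, he1'⟩ : ∃ e1 : ℝ, 0 < e1 ∧ α + e1 < ρ := ⟨(ρ - α) / 2, by linarith, by linarith⟩
  obtain ⟨ε, hε, hε'⟩ : ∃ ε : ℝ, 0 < ε ∧ (β + ε) / (p - 1) < ρ := by
    refine ⟨(ρ * (p - 1) - β) / 2, ?_, ?_⟩
    · rw [div_lt_iff₀ hp1] at hβρ; linarith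
    · rw [div_lt_iff₀ hp1] at hβρ ⊢; linarith
  obtain ⟨C₁, hC₁, hsum⟩ := far_sum q e1 (by linarith) he1
  obtain ⟨C₂, hC₂, haik⟩ := aikawa h E hE ρ C₀ hρ hC₀ hco _ hε'
  obtain ⟨C₃, hC₃, haik3⟩ := aikawa h E hE ρ C₀ hρ hC₀ hco _ he1'
  obtain ⟨C₄, hC₄, hscale⟩ := far_scale h E hae s Q c p q β ε α hs hc hlow hp hpq hε hα C₂ hC₂ haik
  obtain ⟨C₅, hC₅, hC₅0, hgeo⟩ := geo_ge ε hε
  have h3ε : (3:ℝ≥0∞) ^ ε ≠ ⊤ := ENNReal.rpow_ne_top_of_nonneg hε.le (by norm_num)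
  refine ⟨C₁ * C₄ * (D * C₃) * (C₅ * 3 ^ ε), ?_, ?_⟩
  · exact ENNReal.mul_ne_top (ENNReal.mul_ne_top (ENNReal.mul_ne_top hC₁ hC₄)
      (ENNReal.mul_ne_top h.top hC₃)) (ENNReal.mul_ne_top hC₅ h3ε)
  intro g hg
  set G : X → ℝ≥0∞ := fun y => g y ^ p * dd E y ^ β with hG
  have hGm : Measurable G := (hg.pow_const _).mul (hdm.pow_const _)
  set N := ∫⁻ y, G y ∂μ with hN
  set K : ℤ → X → ℝ≥0∞ := fun j y => if dd E y ≤ 3 * ee j then G y * dd E y ^ ε else 0 with hK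
  have hKm : ∀ j, Measurable (K j) := fun j =>
    Measurable.ite (measurableSet_le hdm measurable_const) (hGm.mul (hdm.pow_const _)) measurable_const
  set W : X → ℝ≥0∞ := fun x => dd E x ^ (-(α + e1)) with hW
  have hWm : Measurable W := hdm.pow_const _
  have step1 : ∀ᵐ x ∂μ, (∑' j : ℤ, if dd E x ≤ 2 * ee j then ee j ^ s * av μ (2 ^ j) g x else 0) ^ q *
      dd E x ^ (-α) ≤ C₁ * C₄ * N ^ (q / p - 1) * ∑' j : ℤ, ee j ^ (e1 + (α - ε)) * (W x * av μ (2 ^ j) (K j) x) := by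
    filter_upwards [hae] with x hx
    calc _ ≤ (C₁ * ∑' j, (if dd E x ≤ 2 * ee j then ee j ^ e1 * dd E x ^ (-e1) *
          (ee j ^ s * av μ (2 ^ j) g x) ^ q else 0)) * dd E x ^ (-α) := by
          gcongr
          exact hsum _ hx (dd_ne_top E x) _
      _ ≤ (C₁ * ∑' j, (ee j ^ e1 * dd E x ^ (-e1) *
          (C₄ * N ^ (q / p - 1) * ee j ^ (α - ε) * av μ (2 ^ j) (K j) x))) * dd E x ^ (-α) := by
          gcongr with j
          split_ifs with hj
          · gcongr
            exact hscale g hg j x hj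
          · exact bot_le
      _ = _ := by
          rw [mul_assoc C₁ _ (dd E x ^ (-α)), ← ENNReal.tsum_mul_right, ← ENNReal.tsum_mul_left,
            ← ENNReal.tsum_mul_left]
          refine tsum_congr fun j => ?_
          rw [hW]
          simp only
          rw [neg_add, ENNReal.rpow_add _ _ hx (dd_ne_top E x),
            ENNReal.rpow_add _ _ (ee_ne_zero j) (ee_ne_top j)]
          ring
  have step2 : ∀ j : ℤ, ∫⁻ x, W x * av μ (2 ^ j) (K j) x ∂μ ≤
      D * C₃ * ee j ^ (-(α + e1)) * ∫⁻ y, K j y ∂μ := by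
    intro j
    have hr : (0:ℝ) < 2 ^ j := by positivity
    refine (av_fubini h hr (hKm j) hWm).trans ?_
    rw [mul_assoc D, mul_assoc D]
    gcongr
    rw [← lintegral_const_mul _ (hKm j)]
    refine lintegral_mono fun y => ?_
    by_cases hy : dd E y ≤ 3 * ee j
    · rw [mul_comm]
      gcongr
      exact haik3 y _ hr ((dd_le_three E y j).1 hy)
    · simp [hK, hy]
  have step3 : ∑' j : ℤ, ee j ^ (-ε) * ∫⁻ y, K j y ∂μ ≤ C₅ * 3 ^ ε * N := by
    have : ∀ j : ℤ, ee j ^ (-ε) * ∫⁻ y, K j y ∂μ = ∫⁻ y, ee j ^ (-ε) * K j y ∂μ := fun j =>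
      (lintegral_const_mul _ (hKm j)).symm
    simp only [this]
    rw [← lintegral_tsum fun j => ((hKm j).const_mul _).aemeasurable, hN, ← lintegral_const_mul _ hGm]
    refine lintegral_mono_ae ?_
    filter_upwards [hae] with y hy
    have e : ∀ j : ℤ, ee j ^ (-ε) * K j y =
        (if dd E y / 3 ≤ ee j then ee j ^ (-ε) else 0) * (G y * dd E y ^ ε) := by
      intro j
      have : dd E y / 3 ≤ ee j ↔ dd E y ≤ 3 * ee j := by
        rw [ENNReal.div_le_iff_le_mul (by simp) (by simp), mul_comm]
      simp only [this, hK]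
      split_ifs <;> simp
    simp only [e]
    rw [ENNReal.tsum_mul_right]
    calc _ ≤ C₅ * (dd E y / 3) ^ (-ε) * (G y * dd E y ^ ε) := by gcongr; exact hgeo _
      _ = C₅ * 3 ^ ε * G y * (dd E y ^ (-ε) * dd E y ^ ε) := by
        rw [ENNReal.div_eq_inv_mul, mul_rpow' _ _ _ (by simp) (by simp), ENNReal.inv_rpow,
          ENNReal.rpow_neg 3, inv_inv]
        ring
      _ = _ := by
        rw [← ENNReal.rpow_add _ _ hy (dd_ne_top E y)]; simp
  calc _ ≤ ∫⁻ x, C₁ * C₄ * N ^ (q / p - 1) *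
        ∑' j : ℤ, ee j ^ (e1 + (α - ε)) * (W x * av μ (2 ^ j) (K j) x) ∂μ := lintegral_mono_ae step1
    _ = C₁ * C₄ * N ^ (q / p - 1) *
        ∑' j : ℤ, ee j ^ (e1 + (α - ε)) * ∫⁻ x, W x * av μ (2 ^ j) (K j) x ∂μ := by
        have hm1 : ∀ j : ℤ, Measurable fun x => W x * av μ (2 ^ j) (K j) x := fun j =>
          hWm.mul (measurable_av μ _ (hKm j))
        rw [lintegral_const_mul _ (Measurable.ennreal_tsum fun j => (hm1 j).const_mul _),
          lintegral_tsum fun j => ((hm1 j).const_mul _).aemeasurable]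
        congr 2
        ext j
        rw [lintegral_const_mul _ (hm1 j)]
    _ ≤ C₁ * C₄ * N ^ (q / p - 1) *
        ∑' j : ℤ, D * C₃ * (ee j ^ (-ε) * ∫⁻ y, K j y ∂μ) := by
        refine mul_le_mul' le_rfl (ENNReal.tsum_le_tsum fun j => ?_)
        calc _ ≤ ee j ^ (e1 + (α - ε)) * (D * C₃ * ee j ^ (-(α + e1)) * ∫⁻ y, K j y ∂μ) := by
              gcongr; exact step2 j
          _ = D * C₃ * ((ee j ^ (e1 + (α - ε)) * ee j ^ (-(α + e1))) * ∫⁻ y, K j y ∂μ) := by ring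
          _ = _ := by
            rw [← ENNReal.rpow_add _ _ (ee_ne_zero j) (ee_ne_top j)]
            congr 4; ring
    _ ≤ C₁ * C₄ * N ^ (q / p - 1) * (D * C₃ * (C₅ * 3 ^ ε * N)) := by
        rw [ENNReal.tsum_mul_left]
        gcongr
    _ = C₁ * C₄ * (D * C₃) * (C₅ * 3 ^ ε) * (N ^ (q / p - 1) * N ^ (1:ℝ)) := by
        rw [ENNReal.rpow_one]; ring
    _ = _ := by
        rw [← ENNReal.rpow_add_of_nonneg _ _ hqp zero_le_one]
        congr 2; ring

lemma rpow_lt_neg {a b : ℝ≥0∞} {z : ℝ} (hz : z < 0) (hab : a < b) : b ^ z < a ^ z := by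
  obtain ⟨w, rfl⟩ : ∃ w, z = -w := ⟨-z, by simp⟩
  rw [ENNReal.rpow_neg, ENNReal.rpow_neg, ENNReal.inv_lt_inv]
  exact ENNReal.rpow_lt_rpow hab (by linarith)

lemma rpow_le_neg {a b : ℝ≥0∞} {z : ℝ} (hz : z < 0) (hab : a ≤ b) : b ^ z ≤ a ^ z := by
  obtain ⟨w, rfl⟩ : ∃ w, z = -w := ⟨-z, by simp⟩
  rw [ENNReal.rpow_neg, ENNReal.rpow_neg, ENNReal.inv_le_inv]
  exact ENNReal.rpow_le_rpow hab (by linarith)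

lemma hls_weak [SecondCountableTopology X] {μ : Measure X} [SFinite μ] {D : ℝ≥0∞} (h : Dbl μ D)
    (Q c p q : ℝ) (hQ : 0 < Q) (hc : 0 < c)
    (hlow : ∀ (x : X) (r : ℝ), 0 < r → ENNReal.ofReal (c * r ^ Q) ≤ μ (ball x r))
    (hp : 1 < p) (hpq : p < q) :
    ∃ C₁ C₂ : ℝ≥0∞, C₁ ≠ ⊤ ∧ C₁ ≠ 0 ∧ C₂ ≠ ⊤ ∧ C₂ ≠ 0 ∧ ∀ u : X → ℝ≥0∞, Measurable u →
      ∫⁻ y, u y ^ p ∂μ ≤ 1 → ∀ m : ℤ,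
      μ {x | 4 * (C₁ * ee m ^ (-(Q / q))) < ∑' j : ℤ, ee j ^ (Q / p - Q / q) * av μ (2 ^ j) u x} ≤
        D * C₂ * C₁⁻¹ * ee m ^ (Q / p) *
          ∫⁻ y, (if C₁ * C₂⁻¹ * ee m ^ (-(Q / p)) < u y then u y else 0) ∂μ := by
  have hp0 : 0 < p := by linarith
  have hq0 : 0 < q := by linarith
  have hθ : 0 < Q / p - Q / q := by
    rw [sub_pos]; exact div_lt_div_of_pos_left hQ hp0 hpq
  set θ := Q / p - Q / q with hθd
  obtain ⟨Cg, hCg, hCg0, hgeo⟩ := geo_ge (Q / q) (by positivity)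
  obtain ⟨C₂, hC₂, hC₂0, hgeo2⟩ := geo_le θ hθ
  have hc0 : ENNReal.ofReal c ≠ 0 := by simpa using hc
  set b : ℝ≥0∞ := (ENNReal.ofReal c)⁻¹ ^ (1 / p) with hb
  have hbt : b ≠ ⊤ := ENNReal.rpow_ne_top_of_nonneg (by positivity) (by simpa using hc)
  have hb0 : b ≠ 0 := by
    rw [hb, Ne, ENNReal.rpow_eq_zero_iff]
    simp [hp0]
    intro h1; linarith
  have hC₁t : b * Cg ≠ ⊤ := ENNReal.mul_ne_top hbt hCg
  have hC₁0 : b * Cg ≠ 0 := mul_ne_zero hb0 hCg0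
  refine ⟨b * Cg, C₂, hC₁t, hC₁0, hC₂, hC₂0, ?_⟩
  set C₁ := b * Cg with hC₁
  intro u hu hN m
  set τ := C₁ * C₂⁻¹ * ee m ^ (-(Q / p)) with hτ
  set u' : X → ℝ≥0∞ := fun y => if τ < u y then u y else 0 with hu'
  have hu'm : Measurable u' := Measurable.ite (measurableSet_lt measurable_const hu) hu measurable_const
  set L := C₁ * ee m ^ (-(Q / q)) with hL
  have hem : ∀ z : ℝ, ee m ^ z ≠ ⊤ := fun z => ENNReal.rpow_ne_top_of_ne_zero (ee_ne_zero m) (ee_ne_top m)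
  have hem0 : ∀ z : ℝ, ee m ^ z ≠ 0 := fun z => by
    rw [Ne, ENNReal.rpow_eq_zero_iff]; simp [ee_ne_zero m, ee_ne_top m]
  have hLt : L ≠ ⊤ := ENNReal.mul_ne_top hC₁t (hem _)
  have hL0 : L ≠ 0 := mul_ne_zero hC₁0 (hem0 _)
  set G : X → ℝ≥0∞ := fun x => ∑' j : ℤ, (if ee j ≤ ee m then ee j ^ θ else 0) * av μ (2 ^ j) u' x with hG
  have hA : ∀ j : ℤ, ∀ x, av μ (2 ^ j) u x ≤ b * ee j ^ (-(Q / p)) := by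
    intro j x
    have hr : (0:ℝ) < 2 ^ j := by positivity
    have h1 := av_jensen h hr hu x p hp.le
    have hV : ENNReal.ofReal c * ee j ^ Q ≤ μ (ball x (2 ^ j)) := by
      refine le_trans (le_of_eq ?_) (hlow x _ hr)
      rw [ENNReal.ofReal_mul hc.le, ee, ENNReal.ofReal_rpow_of_pos hr]
    have h2 : av μ (2 ^ j) (fun y => u y ^ p) x ≤ 1 / (ENNReal.ofReal c * ee j ^ Q) :=
      ENNReal.div_le_div ((setLIntegral_le_lintegral _ _).trans hN) hV
    have h3 := (ENNReal.le_rpow_inv_iff hp0).2 (h1.trans h2)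
    refine h3.trans (le_of_eq ?_)
    rw [one_div, ENNReal.mul_inv (Or.inl hc0) (Or.inl ENNReal.ofReal_ne_top),
      ENNReal.mul_rpow_of_nonneg _ _ (by positivity), hb, one_div, ← ENNReal.rpow_neg, ← ENNReal.rpow_mul]
    congr 2
    field_simp
  have hmain : ∀ x, ∑' j : ℤ, ee j ^ θ * av μ (2 ^ j) u x ≤ L + (L + G x) := by
    intro x
    have hj : ∀ j : ℤ, ee j ^ θ * av μ (2 ^ j) u x ≤
        b * (if ee m ≤ ee j then ee j ^ (-(Q / q)) else 0) +
          (τ * (if ee j ≤ ee m then ee j ^ θ else 0) +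
            (if ee j ≤ ee m then ee j ^ θ else 0) * av μ (2 ^ j) u' x) := by
      intro j
      have hr : (0:ℝ) < 2 ^ j := by positivity
      rcases le_total (ee m) (ee j) with hmj | hmj
      · refine le_trans ?_ le_self_add
        rw [if_pos hmj]
        calc _ ≤ ee j ^ θ * (b * ee j ^ (-(Q / p))) := by gcongr; exact hA j x
          _ = b * (ee j ^ θ * ee j ^ (-(Q / p))) := by ring
          _ = _ := by
            rw [← ENNReal.rpow_add _ _ (ee_ne_zero j) (ee_ne_top j)]
            congr 2; rw [hθd]; ring
          _ ≤ _ := le_rfl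
      · refine le_trans ?_ le_add_self
        rw [if_pos hmj, mul_comm τ, ← mul_add]
        gcongr
        calc _ ≤ av μ (2 ^ j) (fun y => τ + u' y) x := by
              refine av_mono fun y _ => ?_
              rw [hu']
              simp only
              split_ifs with hy
              · exact le_add_self
              · simpa using not_lt.1 hy
          _ = _ := by rw [av_add measurable_const, av_const h hr]
    refine (ENNReal.tsum_le_tsum hj).trans ?_
    rw [ENNReal.tsum_add, ENNReal.tsum_add, ENNReal.tsum_mul_left, ENNReal.tsum_mul_left]
    gcongr
    · calc _ ≤ b * (Cg * ee m ^ (-(Q / q))) := by gcongr; exact hgeo _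
        _ = L := by rw [hL, hC₁, mul_assoc]
    · calc _ ≤ τ * (C₂ * ee m ^ θ) := by gcongr; exact hgeo2 _
        _ = C₁ * (C₂⁻¹ * C₂) * (ee m ^ (-(Q / p)) * ee m ^ θ) := by rw [hτ]; ring
        _ = L := by
          rw [ENNReal.inv_mul_cancel hC₂0 hC₂, ← ENNReal.rpow_add _ _ (ee_ne_zero m) (ee_ne_top m), hL, mul_one]
          congr 2; rw [hθd]; ring
  have hsub : {x | 4 * L < ∑' j : ℤ, ee j ^ θ * av μ (2 ^ j) u x} ⊆ {x | L ≤ G x} := by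
    intro x hx
    change 4 * L < _ at hx
    change L ≤ G x
    by_contra hcon
    have := hx.trans_le (hmain x)
    have h5 : L + (L + G x) ≤ 4 * L := by
      calc _ ≤ L + (L + L) := by gcongr; exact (not_le.1 hcon).le
        _ ≤ L + (L + L) + L := le_self_add
        _ = 4 * L := by ring
    exact absurd this (not_lt.2 h5)
  have hGint : ∫⁻ x, G x ∂μ ≤ C₂ * ee m ^ θ * (D * ∫⁻ y, u' y ∂μ) := by
    have hm1 : ∀ j : ℤ, Measurable fun x => av μ (2 ^ j) u' x := fun j => measurable_av μ _ hu'm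
    rw [hG, lintegral_tsum fun j => ((hm1 j).const_mul _).aemeasurable]
    calc _ ≤ ∑' j : ℤ, (if ee j ≤ ee m then ee j ^ θ else 0) * (D * ∫⁻ y, u' y ∂μ) := by
          refine ENNReal.tsum_le_tsum fun j => ?_
          have hr : (0:ℝ) < 2 ^ j := by positivity
          rw [lintegral_const_mul _ (hm1 j)]
          gcongr
          exact av_integral_le h hr hu'm
      _ ≤ _ := by
          rw [ENNReal.tsum_mul_right]
          gcongr
          exact hgeo2 _
  have hGm : Measurable G := Measurable.ennreal_tsum fun j => (measurable_av μ _ hu'm).const_mul _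
  calc _ ≤ μ {x | L ≤ G x} := measure_mono hsub
    _ ≤ (∫⁻ x, G x ∂μ) / L := meas_ge_le_lintegral_div hGm.aemeasurable hL0 hLt
    _ ≤ (C₂ * ee m ^ θ * (D * ∫⁻ y, u' y ∂μ)) / L := by gcongr
    _ = D * C₂ * C₁⁻¹ * (ee m ^ θ * ee m ^ (Q / q)) * ∫⁻ y, u' y ∂μ := by
        rw [div_eq_mul_inv, hL, ENNReal.mul_inv (Or.inl hC₁0) (Or.inl hC₁t), ← ENNReal.rpow_neg, neg_neg]
        ring
    _ = _ := by
        rw [← ENNReal.rpow_add _ _ (ee_ne_zero m) (ee_ne_top m)]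
        congr 3; rw [hθd]; ring

lemma layer (Q q : ℝ) (hQ : 0 < Q) (hq : 0 < q) (L : ℝ≥0∞) (hL0 : L ≠ 0) (hLt : L ≠ ⊤) (F : ℝ≥0∞) :
    F ^ q ≤ (L ^ q * 2 ^ Q) * ∑' m : ℤ, if L * ee m ^ (-(Q / q)) < F then ee m ^ (-Q) else 0 := by
  have key : ∀ y : ℝ≥0∞, y ≠ ⊤ → y ≤ F →
      y ^ q ≤ (L ^ q * 2 ^ Q) * ∑' m : ℤ, if L * ee m ^ (-(Q / q)) < F then ee m ^ (-Q) else 0 := by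
    intro y hyt hyF
    by_cases hy0 : y = 0
    · rw [hy0, ENNReal.zero_rpow_of_pos hq]; exact bot_le
    set z := y / L with hz
    have hz0 : z ≠ 0 := ENNReal.div_ne_zero.2 ⟨hy0, hLt⟩
    have hzt : z ≠ ⊤ := ENNReal.div_ne_top hyt hL0
    have hyz : y = L * z := (ENNReal.mul_div_cancel hL0 hLt).symm
    obtain ⟨n, hn1, hn2⟩ := exists_ee (z ^ (-(q / Q)))
      (by rw [Ne, ENNReal.rpow_eq_zero_iff]; simp [hz0, hzt])
      (ENNReal.rpow_ne_top_of_ne_zero hz0 hzt)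
    have hzz : z = (z ^ (-(q / Q))) ^ (-(Q / q)) := by
      rw [← ENNReal.rpow_mul]
      have : -(q / Q) * -(Q / q) = 1 := by field_simp
      rw [this, ENNReal.rpow_one]
    have hneg : -(Q / q) < 0 := by rw [neg_lt_zero]; positivity
    have h1 : ee (n + 1) ^ (-(Q / q)) < z := by
      rw [hzz]; exact rpow_lt_neg hneg hn2
    have h2 : z ≤ ee n ^ (-(Q / q)) := by
      rw [hzz]; exact rpow_le_neg hneg hn1
    have h3 : L * ee (n + 1) ^ (-(Q / q)) < F := by
      refine lt_of_lt_of_le ?_ hyF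
      rw [hyz]
      exact (ENNReal.mul_lt_mul_iff_right hL0 hLt).2 h1
    calc y ^ q ≤ (L * ee n ^ (-(Q / q))) ^ q := by rw [hyz]; gcongr
      _ = L ^ q * 2 ^ Q * ee (n + 1) ^ (-Q) := by
        rw [ENNReal.mul_rpow_of_nonneg _ _ hq.le, ← ENNReal.rpow_mul, ee_eq, ee_eq, ← ENNReal.rpow_mul,
          ← ENNReal.rpow_mul, mul_assoc, ← ENNReal.rpow_add _ _ (by norm_num) (by norm_num)]
        congr 2
        push_cast
        field_simp
        ring
      _ ≤ _ := by
        gcongr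
        refine le_trans (le_of_eq ?_) (ENNReal.le_tsum (n + 1))
        rw [if_pos h3]
  by_cases hF : F = ⊤
  · by_contra hcon
    rw [not_le] at hcon
    set Z := (L ^ q * 2 ^ Q) * ∑' m : ℤ, if L * ee m ^ (-(Q / q)) < F then ee m ^ (-Q) else 0
    have hZ : Z ≠ ⊤ := hcon.ne_top
    have := key ((Z + 1) ^ (1 / q)) (ENNReal.rpow_ne_top_of_nonneg (by positivity) (by simpa using hZ))
      (by rw [hF]; exact le_top)
    rw [← ENNReal.rpow_mul, one_div, inv_mul_cancel₀ hq.ne', ENNReal.rpow_one] at this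
    exact absurd (ENNReal.lt_add_right hZ one_ne_zero) (not_lt.2 this)
  · exact key F hF le_rfl

lemma hls_one [SecondCountableTopology X] {μ : Measure X} [SFinite μ] {D : ℝ≥0∞} (h : Dbl μ D)
    (Q c p q : ℝ) (hQ : 0 < Q) (hc : 0 < c)
    (hlow : ∀ (x : X) (r : ℝ), 0 < r → ENNReal.ofReal (c * r ^ Q) ≤ μ (ball x r))
    (hp : 1 < p) (hpq : p < q) :
    ∃ C : ℝ≥0∞, C ≠ ⊤ ∧ ∀ u : X → ℝ≥0∞, Measurable u →
      ∫⁻ y, u y ^ p ∂μ ≤ 1 →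
      ∫⁻ x, (∑' j : ℤ, ee j ^ (Q / p - Q / q) * av μ (2 ^ j) u x) ^ q ∂μ ≤ C := by
  have hp0 : 0 < p := by linarith
  have hq0 : 0 < q := by linarith
  have hp1 : 0 < p - 1 := by linarith
  obtain ⟨C₁, C₂, hC₁, hC₁0, hC₂, hC₂0, hweak⟩ := hls_weak h Q c p q hQ hc hlow hp hpq
  set a := Q - Q / p with ha
  have ha0 : 0 < a := by
    rw [ha, sub_pos, div_lt_iff₀ hp0]; nlinarith
  obtain ⟨C₃, hC₃, hC₃0, hgeo⟩ := geo_ge a ha0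
  set k := C₁ * C₂⁻¹ with hk
  have hk0 : k ≠ 0 := mul_ne_zero hC₁0 (by simpa using hC₂)
  have hkt : k ≠ ⊤ := ENNReal.mul_ne_top hC₁ (by simpa using hC₂0)
  set L := 4 * C₁ with hL
  have hL0 : L ≠ 0 := mul_ne_zero (by norm_num) hC₁0
  have hLt : L ≠ ⊤ := ENNReal.mul_ne_top (by norm_num) hC₁
  set B := L ^ q * 2 ^ Q with hB
  have hBt : B ≠ ⊤ := ENNReal.mul_ne_top (ENNReal.rpow_ne_top_of_nonneg hq0.le hLt)
    (ENNReal.rpow_ne_top_of_nonneg hQ.le (by norm_num))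
  refine ⟨B * (D * C₂ * C₁⁻¹) * (C₃ * k⁻¹ ^ (p - 1)), ?_, ?_⟩
  · refine ENNReal.mul_ne_top (ENNReal.mul_ne_top hBt (ENNReal.mul_ne_top (ENNReal.mul_ne_top h.top hC₂)
      (by simpa using hC₁0))) (ENNReal.mul_ne_top hC₃ (ENNReal.rpow_ne_top_of_nonneg hp1.le (by simpa using hk0)))
  intro u hu hN
  set F : X → ℝ≥0∞ := fun x => ∑' j : ℤ, ee j ^ (Q / p - Q / q) * av μ (2 ^ j) u x with hF
  have hFm : Measurable F := Measurable.ennreal_tsum fun j => (measurable_av μ _ hu).const_mul _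
  have hum : ∀ τ : ℝ≥0∞, Measurable fun y => if τ < u y then u y else 0 := fun τ =>
    Measurable.ite (measurableSet_lt measurable_const hu) hu measurable_const
  have hset : ∀ m : ℤ, MeasurableSet {x | L * ee m ^ (-(Q / q)) < F x} := fun m =>
    measurableSet_lt measurable_const hFm
  have hFm2 : ∀ m : ℤ, Measurable fun x => if L * ee m ^ (-(Q / q)) < F x then ee m ^ (-Q) else 0 := fun m =>
    Measurable.ite (hset m) measurable_const measurable_const
  calc ∫⁻ x, F x ^ q ∂μ
      ≤ ∫⁻ x, B * ∑' m : ℤ, (if L * ee m ^ (-(Q / q)) < F x then ee m ^ (-Q) else 0) ∂μ :=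
        lintegral_mono fun x => layer Q q hQ hq0 L hL0 hLt (F x)
    _ = B * ∑' m : ℤ, ee m ^ (-Q) * μ {x | L * ee m ^ (-(Q / q)) < F x} := by
        rw [lintegral_const_mul _ (Measurable.ennreal_tsum hFm2),
          lintegral_tsum fun m => (hFm2 m).aemeasurable]
        refine congrArg (B * ·) (tsum_congr fun m => ?_)
        rw [← lintegral_indicator_const (hset m)]
        refine lintegral_congr fun x => ?_
        simp [indicator]
    _ ≤ B * ∑' m : ℤ, (D * C₂ * C₁⁻¹) *
          ∫⁻ y, ee m ^ (-a) * (if k * ee m ^ (-(Q / p)) < u y then u y else 0) ∂μ := by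
        refine mul_le_mul' le_rfl (ENNReal.tsum_le_tsum fun m => ?_)
        rw [lintegral_const_mul _ (hum _)]
        have := hweak u hu hN m
        rw [← mul_assoc 4] at this
        calc _ ≤ ee m ^ (-Q) * (D * C₂ * C₁⁻¹ * ee m ^ (Q / p) *
            ∫⁻ y, (if C₁ * C₂⁻¹ * ee m ^ (-(Q / p)) < u y then u y else 0) ∂μ) := by gcongr
          _ = (D * C₂ * C₁⁻¹) * ((ee m ^ (-Q) * ee m ^ (Q / p)) *
            ∫⁻ y, (if C₁ * C₂⁻¹ * ee m ^ (-(Q / p)) < u y then u y else 0) ∂μ) := by ring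
          _ = _ := by
            rw [← ENNReal.rpow_add _ _ (ee_ne_zero m) (ee_ne_top m)]
            have : -Q + Q / p = -a := by rw [ha]; ring
            rw [this]
    _ = B * (D * C₂ * C₁⁻¹) * ∫⁻ y, (∑' m : ℤ,
          ee m ^ (-a) * (if k * ee m ^ (-(Q / p)) < u y then u y else 0)) ∂μ := by
        rw [ENNReal.tsum_mul_left, lintegral_tsum fun m => ((hum _).const_mul _).aemeasurable, mul_assoc B]
    _ ≤ B * (D * C₂ * C₁⁻¹) * ∫⁻ y, (C₃ * k⁻¹ ^ (p - 1)) * u y ^ p ∂μ := by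
        refine mul_le_mul' le_rfl (lintegral_mono fun y => ?_)
        by_cases hy0 : u y = 0
        · simp [hy0]
        set x := (u y * k⁻¹) ^ (-(p / Q)) with hx
        have hxe : ∀ m : ℤ, k * ee m ^ (-(Q / p)) < u y → x ≤ ee m := by
          intro m hm
          have h1 : ee m ^ (-(Q / p)) ≤ u y * k⁻¹ := by
            rw [← div_eq_mul_inv, ENNReal.le_div_iff_mul_le (Or.inl hk0) (Or.inl hkt), mul_comm]
            exact hm.le
          have h2 : x ≤ (ee m ^ (-(Q / p))) ^ (-(p / Q)) :=
            rpow_le_neg (by rw [neg_lt_zero]; positivity) h1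
          refine h2.trans (le_of_eq ?_)
          rw [← ENNReal.rpow_mul]
          have : -(Q / p) * -(p / Q) = 1 := by field_simp
          rw [this, ENNReal.rpow_one]
        calc _ ≤ ∑' m : ℤ, (if x ≤ ee m then ee m ^ (-a) else 0) * u y := by
              refine ENNReal.tsum_le_tsum fun m => ?_
              by_cases hm : k * ee m ^ (-(Q / p)) < u y
              · rw [if_pos hm, if_pos (hxe m hm)]
              · rw [if_neg hm, mul_zero]; exact bot_le
          _ ≤ C₃ * x ^ (-a) * u y := by
              rw [ENNReal.tsum_mul_right]; gcongr; exact hgeo x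
          _ = C₃ * k⁻¹ ^ (p - 1) * (u y ^ (p - 1) * u y ^ (1:ℝ)) := by
              rw [hx, ← ENNReal.rpow_mul]
              have : -(p / Q) * -a = p - 1 := by rw [ha]; field_simp
              rw [this, ENNReal.mul_rpow_of_nonneg _ _ hp1.le, ENNReal.rpow_one]
              ring
          _ = _ := by
              rw [← ENNReal.rpow_add_of_nonneg _ _ hp1.le zero_le_one]; congr 2; ring
    _ = B * (D * C₂ * C₁⁻¹) * ((C₃ * k⁻¹ ^ (p - 1)) * ∫⁻ y, u y ^ p ∂μ) := by
        rw [lintegral_const_mul _ (hu.pow_const _)]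
    _ ≤ B * (D * C₂ * C₁⁻¹) * ((C₃ * k⁻¹ ^ (p - 1)) * 1) := by gcongr
    _ = _ := by rw [mul_one]

lemma hls [SecondCountableTopology X] {μ : Measure X} [SFinite μ] {D : ℝ≥0∞} (h : Dbl μ D)
    (Q c p q : ℝ) (hQ : 0 < Q) (hc : 0 < c)
    (hlow : ∀ (x : X) (r : ℝ), 0 < r → ENNReal.ofReal (c * r ^ Q) ≤ μ (ball x r))
    (hp : 1 < p) (hpq : p < q) :
    ∃ C : ℝ≥0∞, C ≠ ⊤ ∧ ∀ u : X → ℝ≥0∞, Measurable u →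
      ∫⁻ x, (∑' j : ℤ, ee j ^ (Q / p - Q / q) * av μ (2 ^ j) u x) ^ q ∂μ ≤
        C * (∫⁻ y, u y ^ p ∂μ) ^ (q / p) := by
  have hp0 : 0 < p := by linarith
  have hq0 : 0 < q := by linarith
  obtain ⟨C, hC, hone⟩ := hls_one h Q c p q hQ hc hlow hp hpq
  refine ⟨C + 1, by simpa using hC, fun u hu => ?_⟩
  set N := ∫⁻ y, u y ^ p ∂μ with hN
  by_cases hNt : N = ⊤
  · rw [hNt, ENNReal.top_rpow_of_pos (by positivity), ENNReal.mul_top (by simp)]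
    exact le_top
  by_cases hN0 : N = 0
  · have h0 : ∀ᵐ y ∂μ, u y = 0 := by
      have := (lintegral_eq_zero_iff (hu.pow_const p)).1 hN0
      filter_upwards [this] with y hy
      simpa [ENNReal.rpow_eq_zero_iff, hp0, hp0.le, not_lt.2 hp0.le] using hy
    have hz : ∀ (j : ℤ) (x : X), av μ (2 ^ j) u x = 0 := by
      intro j x
      have : av μ (2 ^ j) u x ≤ av μ (2 ^ j) (fun _ => 0) x := by
        refine le_av_ae ?_
        filter_upwards [h0] with y hy _
        exact hy.le
      rw [av_const h (by positivity)] at this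
      exact le_antisymm this bot_le
    simp [hz, hq0]
  set k := N ^ (-(1 / p)) with hk
  have hkt : k ≠ ⊤ := ENNReal.rpow_ne_top_of_ne_zero hN0 hNt
  have hk0 : k ≠ 0 := by rw [hk, Ne, ENNReal.rpow_eq_zero_iff]; simp [hN0, hNt]
  have h1 := hone (fun y => k * u y) (hu.const_mul _) (by
    simp only [ENNReal.mul_rpow_of_nonneg _ _ hp0.le]
    rw [lintegral_const_mul _ (hu.pow_const _), hk, ← ENNReal.rpow_mul]
    have : -(1 / p) * p = -1 := by field_simp
    rw [this, ENNReal.rpow_neg_one, ← hN, ENNReal.inv_mul_cancel hN0 hNt])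
  have hFm : Measurable fun x => (∑' j : ℤ, ee j ^ (Q / p - Q / q) * av μ (2 ^ j) u x) ^ q :=
    (Measurable.ennreal_tsum fun j => (measurable_av μ _ hu).const_mul _).pow_const _
  have h2 : ∫⁻ x, (∑' j : ℤ, ee j ^ (Q / p - Q / q) * av μ (2 ^ j) (fun y => k * u y) x) ^ q ∂μ =
      k ^ q * ∫⁻ x, (∑' j : ℤ, ee j ^ (Q / p - Q / q) * av μ (2 ^ j) u x) ^ q ∂μ := by
    rw [← lintegral_const_mul _ hFm]
    refine lintegral_congr fun x => ?_
    rw [← ENNReal.mul_rpow_of_nonneg _ _ hq0.le, ← ENNReal.tsum_mul_left]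
    congr 1
    refine tsum_congr fun j => ?_
    rw [av_const_mul k hu]; ring
  rw [h2] at h1
  have h3 : N ^ (q / p) * k ^ q = 1 := by
    rw [hk, ← ENNReal.rpow_mul, ← ENNReal.rpow_add _ _ hN0 hNt]
    have : q / p + -(1 / p) * q = 0 := by ring
    rw [this, ENNReal.rpow_zero]
  set I := ∫⁻ x, (∑' j : ℤ, ee j ^ (Q / p - Q / q) * av μ (2 ^ j) u x) ^ q ∂μ
  calc I = N ^ (q / p) * (k ^ q * I) := by rw [← mul_assoc, h3, one_mul]
    _ ≤ N ^ (q / p) * C := by gcongr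
    _ ≤ (C + 1) * N ^ (q / p) := by
      rw [mul_comm]; gcongr; exact le_self_add

lemma rpow_comp {a b : ℝ≥0∞} (z : ℝ) (hab : a ≤ 2 * b) (hba : b ≤ 2 * a) : a ^ z ≤ 2 ^ |z| * b ^ z := by
  rcases le_or_gt 0 z with hz | hz
  · rw [abs_of_nonneg hz, ← ENNReal.mul_rpow_of_nonneg _ _ hz]
    gcongr
  · have h1 := rpow_le_neg hz hba
    rw [mul_rpow' _ _ _ (by norm_num) (by norm_num)] at h1
    rw [abs_of_neg hz]
    calc a ^ z = 2 ^ (-z) * (2 ^ z * a ^ z) := by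
          rw [← mul_assoc, ← ENNReal.rpow_add _ _ (by norm_num) (by norm_num)]; simp
      _ ≤ _ := by gcongr

lemma dd_near (E : Set X) {x y : X} {j : ℤ} (hj : ¬ dd E x ≤ 2 * ee j) (hy : dist y x < 2 ^ j) :
    dd E y ≤ 2 * dd E x ∧ dd E x ≤ 2 * dd E y ∧ ee j ≤ dd E y ∧ ee j ≤ dd E x := by
  rw [dd_le_two, not_le] at hj
  have hr : (0:ℝ) < 2 ^ j := by positivity
  have h1 := infDist_le_infDist_add_dist (s := E) (x := y) (y := x)
  have h2 := infDist_le_infDist_add_dist (s := E) (x := x) (y := y)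
  rw [dist_comm] at h2
  have e2 : (2:ℝ≥0∞) = ENNReal.ofReal 2 := by simp
  refine ⟨?_, ?_, ENNReal.ofReal_le_ofReal (by linarith), ENNReal.ofReal_le_ofReal (by linarith)⟩
  · rw [dd, dd, e2, ← ENNReal.ofReal_mul (by norm_num)]
    exact ENNReal.ofReal_le_ofReal (by linarith)
  · rw [dd, dd, e2, ← ENNReal.ofReal_mul (by norm_num)]
    exact ENNReal.ofReal_le_ofReal (by linarith)

lemma loc_reduce {μ : Measure X} (E : Set X) (s p q β α : ℝ) (hq : 0 < q)
    {g : X → ℝ≥0∞} (hg : Measurable g) {x : X} (hx : dd E x ≠ 0) :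
    (∑' j : ℤ, if dd E x ≤ 2 * ee j then 0 else ee j ^ s * av μ (2 ^ j) g x) ^ q * dd E x ^ (-α) ≤
    (2 ^ |(-(β / p))|) ^ q * (∑' j : ℤ, if dd E x ≤ 2 * ee j then 0 else
      dd E x ^ (-(α / q + β / p)) * ee j ^ s * av μ (2 ^ j) (fun y => g y * dd E y ^ (β / p)) x) ^ q := by
  have hdm := measurable_dd E
  have hum : Measurable fun y => g y * dd E y ^ (β / p) := hg.mul (hdm.pow_const _)
  have e : dd E x ^ (-α) = (dd E x ^ (-(α / q))) ^ q := by
    rw [← ENNReal.rpow_mul]; congr 1; field_simp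
  rw [e, ← ENNReal.mul_rpow_of_nonneg _ _ hq.le, ← ENNReal.mul_rpow_of_nonneg _ _ hq.le]
  refine ENNReal.rpow_le_rpow ?_ hq.le
  rw [← ENNReal.tsum_mul_left, ← ENNReal.tsum_mul_right]
  refine ENNReal.tsum_le_tsum fun j => ?_
  split_ifs with hj
  · simp
  have h1 : av μ (2 ^ j) g x ≤
      (2 ^ |(-(β / p))| * dd E x ^ (-(β / p))) * av μ (2 ^ j) (fun y => g y * dd E y ^ (β / p)) x := by
    rw [← av_const_mul _ hum]
    refine av_mono fun y hy => ?_
    obtain ⟨n1, n2, n3, n4⟩ := dd_near E hj (mem_ball.1 hy)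
    have hy0 : dd E y ≠ 0 := fun h0 => ee_ne_zero j (le_antisymm (h0 ▸ n3) bot_le)
    calc g y = dd E y ^ (-(β / p)) * (g y * dd E y ^ (β / p)) := by
          rw [mul_left_comm, ← ENNReal.rpow_add _ _ hy0 (dd_ne_top E y)]; simp
      _ ≤ _ := by
          gcongr
          exact rpow_comp _ n1 n2
  calc _ ≤ ee j ^ s * ((2 ^ |(-(β / p))| * dd E x ^ (-(β / p))) *
        av μ (2 ^ j) (fun y => g y * dd E y ^ (β / p)) x) * dd E x ^ (-(α / q)) := by gcongr
    _ = _ := by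
        rw [neg_add, ENNReal.rpow_add _ _ hx (dd_ne_top E x)]
        ring

lemma loc_eq [SecondCountableTopology X] {μ : Measure X} [SFinite μ] {D : ℝ≥0∞} (h : Dbl μ D)
    (E : Set X) (hae : ∀ᵐ x ∂μ, dd E x ≠ 0) (s p : ℝ) (hs : 0 < s) (hp : 1 < p) :
    ∃ C : ℝ≥0∞, C ≠ ⊤ ∧ ∀ u : X → ℝ≥0∞, Measurable u →
      ∫⁻ x, (∑' j : ℤ, if dd E x ≤ 2 * ee j then 0 else
        dd E x ^ (-s) * ee j ^ s * av μ (2 ^ j) u x) ^ p ∂μ ≤ C * ∫⁻ y, u y ^ p ∂μ := by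
  have hp1 : 0 < p - 1 := by linarith
  obtain ⟨C, hC, hC0, hgeo⟩ := geo_le s hs
  have hdm := measurable_dd E
  have h2s : (2:ℝ≥0∞) ^ s ≠ ⊤ := ENNReal.rpow_ne_top_of_nonneg hs.le (by norm_num)
  refine ⟨C ^ (p - 1) * (D * (2 ^ s * C)), ENNReal.mul_ne_top (ENNReal.rpow_ne_top_of_nonneg hp1.le hC)
    (ENNReal.mul_ne_top h.top (ENNReal.mul_ne_top h2s hC)), fun u hu => ?_⟩
  have hum : Measurable fun y => u y ^ p := hu.pow_const _
  set w : ℤ → X → ℝ≥0∞ := fun j x => if dd E x ≤ 2 * ee j then 0 else dd E x ^ (-s) * ee j ^ s with hw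
  have hwm : ∀ j, Measurable (w j) := fun j =>
    Measurable.ite (measurableSet_le hdm measurable_const) measurable_const ((hdm.pow_const _).mul_const _)
  have hself : ∀ x, dd E x ^ (-s) * dd E x ^ s ≤ 1 := fun x => by
    rw [ENNReal.rpow_neg]; exact ENNReal.inv_mul_le_one _
  have hwsum : ∀ x, ∑' j, w j x ≤ C := by
    intro x
    calc _ ≤ ∑' j : ℤ, dd E x ^ (-s) * (if ee j ≤ dd E x then ee j ^ s else 0) := by
          refine ENNReal.tsum_le_tsum fun j => ?_
          rw [hw]
          simp only
          split_ifs with h1 h2 h2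
          · exact bot_le
          · exact bot_le
          · exact le_rfl
          · exact absurd (dd_near E h1 (y := x) (by rw [dist_self]; positivity)).2.2.1 h2
      _ ≤ dd E x ^ (-s) * (C * dd E x ^ s) := by
          rw [ENNReal.tsum_mul_left]; gcongr; exact hgeo _
      _ = C * (dd E x ^ (-s) * dd E x ^ s) := by ring
      _ ≤ C * 1 := by gcongr; exact hself x
      _ = C := mul_one _
  have hpt : ∀ x, (∑' j : ℤ, if dd E x ≤ 2 * ee j then 0 else
        dd E x ^ (-s) * ee j ^ s * av μ (2 ^ j) u x) ^ p ≤
        C ^ (p - 1) * ∑' j : ℤ, w j x * av μ (2 ^ j) (fun y => u y ^ p) x := by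
    intro x
    have e : (∑' j : ℤ, if dd E x ≤ 2 * ee j then 0 else
        dd E x ^ (-s) * ee j ^ s * av μ (2 ^ j) u x) = ∑' j : ℤ, w j x * av μ (2 ^ j) u x := by
      refine tsum_congr fun j => ?_
      rw [hw]
      simp only
      split_ifs <;> simp
    rw [e]
    refine (jensen_tsum (fun j => w j x) (fun j => av μ (2 ^ j) u x) p hp.le).trans ?_
    refine mul_le_mul' (ENNReal.rpow_le_rpow (hwsum x) hp1.le) (ENNReal.tsum_le_tsum fun j => ?_)
    gcongr
    exact av_jensen h (by positivity) hu x p hp.le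
  have hw' : ∀ (j : ℤ) (y : X), av μ (2 ^ j) (w j) y ≤
      2 ^ s * dd E y ^ (-s) * (if ee j ≤ dd E y then ee j ^ s else 0) := by
    intro j y
    have hr : (0:ℝ) < 2 ^ j := by positivity
    rw [← av_const h hr (2 ^ s * dd E y ^ (-s) * (if ee j ≤ dd E y then ee j ^ s else 0)) y]
    refine av_mono fun x hx => ?_
    rw [hw]
    simp only
    split_ifs with h1 h2 h2
    · exact bot_le
    · exact bot_le
    · obtain ⟨n1, n2, n3, n4⟩ := dd_near E h1 (y := y) (by rw [dist_comm]; exact mem_ball.1 hx)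
      gcongr
      have := rpow_comp (-s) n2 n1
      rwa [abs_neg, abs_of_pos hs] at this
    · exact absurd (dd_near E h1 (y := y) (by rw [dist_comm]; exact mem_ball.1 hx)).2.2.1 h2
  have hAm : ∀ j : ℤ, Measurable fun x => w j x * av μ (2 ^ j) (fun y => u y ^ p) x := fun j =>
    (hwm j).mul (measurable_av μ _ hum)
  have hBm : ∀ j : ℤ, Measurable fun y => u y ^ p * av μ (2 ^ j) (w j) y := fun j =>
    hum.mul (measurable_av μ _ (hwm j))
  calc _ ≤ ∫⁻ x, C ^ (p - 1) * ∑' j : ℤ, w j x * av μ (2 ^ j) (fun y => u y ^ p) x ∂μ := lintegral_mono hpt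
    _ = C ^ (p - 1) * ∑' j : ℤ, ∫⁻ x, w j x * av μ (2 ^ j) (fun y => u y ^ p) x ∂μ := by
        rw [lintegral_const_mul _ (Measurable.ennreal_tsum hAm), lintegral_tsum fun j => (hAm j).aemeasurable]
    _ ≤ C ^ (p - 1) * ∑' j : ℤ, D * ∫⁻ y, u y ^ p * av μ (2 ^ j) (w j) y ∂μ := by
        refine mul_le_mul' le_rfl (ENNReal.tsum_le_tsum fun j => ?_)
        exact av_fubini h (by positivity) hum (hwm j)
    _ = C ^ (p - 1) * (D * ∫⁻ y, (∑' j : ℤ, u y ^ p * av μ (2 ^ j) (w j) y) ∂μ) := by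
        rw [ENNReal.tsum_mul_left, lintegral_tsum fun j => (hBm j).aemeasurable]
    _ ≤ C ^ (p - 1) * (D * ∫⁻ y, (2 ^ s * C) * u y ^ p ∂μ) := by
        refine mul_le_mul' le_rfl (mul_le_mul' le_rfl (lintegral_mono fun y => ?_))
        rw [ENNReal.tsum_mul_left, mul_comm]
        gcongr
        calc _ ≤ ∑' j : ℤ, 2 ^ s * dd E y ^ (-s) * (if ee j ≤ dd E y then ee j ^ s else 0) :=
              ENNReal.tsum_le_tsum fun j => hw' j y
          _ ≤ 2 ^ s * dd E y ^ (-s) * (C * dd E y ^ s) := by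
              rw [ENNReal.tsum_mul_left]; gcongr; exact hgeo _
          _ = 2 ^ s * C * (dd E y ^ (-s) * dd E y ^ s) := by ring
          _ ≤ 2 ^ s * C * 1 := by gcongr; exact hself y
          _ = _ := mul_one _
    _ = _ := by
        rw [lintegral_const_mul _ hum]; ring

lemma loc [SecondCountableTopology X] {μ : Measure X} [SFinite μ] {D : ℝ≥0∞} (h : Dbl μ D)
    (E : Set X) (hae : ∀ᵐ x ∂μ, dd E x ≠ 0)
    (s Q c p q β α : ℝ) (hs : 0 < s) (hQ : 0 < Q) (hc : 0 < c)
    (hlow : ∀ (x : X) (r : ℝ), 0 < r → ENNReal.ofReal (c * r ^ Q) ≤ μ (ball x r))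
    (hp : 1 < p) (hpq : p ≤ q) (hα : α = Q - q / p * (Q - s * p + β))
    (hsp : s * p < Q) (hq : q ≤ Q * p / (Q - s * p)) :
    ∃ C : ℝ≥0∞, C ≠ ⊤ ∧ ∀ g : X → ℝ≥0∞, Measurable g →
      ∫⁻ x, (∑' j : ℤ, if dd E x ≤ 2 * ee j then 0 else ee j ^ s * av μ (2 ^ j) g x) ^ q *
        dd E x ^ (-α) ∂μ ≤ C * (∫⁻ y, g y ^ p * dd E y ^ β ∂μ) ^ (q / p) := by
  have hp0 : 0 < p := by linarith
  have hq0 : 0 < q := by linarith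
  have hdm := measurable_dd E
  set κ := α / q + β / p with hκ
  have hκθ : κ = s - (Q / p - Q / q) := by
    rw [hκ, hα]; field_simp; ring
  have hκ0 : 0 ≤ κ := by
    rw [le_div_iff₀ (by linarith)] at hq
    have : κ = (Q * p - q * (Q - s * p)) / (p * q) := by
      rw [hκθ]; field_simp; ring
    rw [this]
    exact div_nonneg (by linarith) (by positivity)
  have hC2 : ((2:ℝ≥0∞) ^ |(-(β / p))|) ^ q ≠ ⊤ :=
    ENNReal.rpow_ne_top_of_nonneg hq0.le (ENNReal.rpow_ne_top_of_nonneg (abs_nonneg _) (by norm_num))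
  obtain ⟨C, hC, hmain⟩ : ∃ C : ℝ≥0∞, C ≠ ⊤ ∧ ∀ u : X → ℝ≥0∞, Measurable u →
      ∫⁻ x, (∑' j : ℤ, if dd E x ≤ 2 * ee j then 0 else
        dd E x ^ (-κ) * ee j ^ s * av μ (2 ^ j) u x) ^ q ∂μ ≤ C * (∫⁻ y, u y ^ p ∂μ) ^ (q / p) := by
    rcases hpq.eq_or_lt with hpq' | hpq'
    · obtain ⟨C, hC, h1⟩ := loc_eq h E hae s p hs hp
      refine ⟨C, hC, fun u hu => ?_⟩
      have e1 : κ = s := by rw [hκθ, hpq']; ring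
      have e2 : q / p = 1 := by rw [hpq']; field_simp
      rw [e1, e2, ENNReal.rpow_one, ← hpq']
      exact h1 u hu
    · obtain ⟨C, hC, h1⟩ := hls h Q c p q hQ hc hlow hp hpq'
      refine ⟨C, hC, fun u hu => (lintegral_mono fun x => ?_).trans (h1 u hu)⟩
      refine ENNReal.rpow_le_rpow (ENNReal.tsum_le_tsum fun j => ?_) hq0.le
      split_ifs with hj
      · exact bot_le
      gcongr
      have hd : ee j ≤ dd E x := (dd_near E hj (y := x) (by rw [dist_self]; positivity)).2.2.1
      calc _ ≤ ee j ^ (-κ) * ee j ^ s := by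
            refine mul_le_mul' ?_ le_rfl
            rw [ENNReal.rpow_neg, ENNReal.rpow_neg]
            exact ENNReal.inv_le_inv.2 (ENNReal.rpow_le_rpow hd hκ0)
        _ = _ := by
            rw [← ENNReal.rpow_add _ _ (ee_ne_zero j) (ee_ne_top j)]
            congr 1; rw [hκθ]; ring
  refine ⟨(2 ^ |(-(β / p))|) ^ q * C, ENNReal.mul_ne_top hC2 hC, fun g hg => ?_⟩
  have hum : Measurable fun y => g y * dd E y ^ (β / p) := hg.mul (hdm.pow_const _)
  have hFm : Measurable fun x => (∑' j : ℤ, if dd E x ≤ 2 * ee j then 0 else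
      dd E x ^ (-κ) * ee j ^ s * av μ (2 ^ j) (fun y => g y * dd E y ^ (β / p)) x) ^ q := by
    refine (Measurable.ennreal_tsum fun j => ?_).pow_const _
    exact Measurable.ite (measurableSet_le hdm measurable_const) measurable_const
      (((hdm.pow_const _).mul_const _).mul (measurable_av μ _ hum))
  have hN : ∫⁻ y, (g y * dd E y ^ (β / p)) ^ p ∂μ = ∫⁻ y, g y ^ p * dd E y ^ β ∂μ := by
    refine lintegral_congr fun y => ?_
    rw [ENNReal.mul_rpow_of_nonneg _ _ hp0.le, ← ENNReal.rpow_mul, div_mul_cancel₀ _ hp0.ne']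
  have hm := hmain _ hum
  rw [hN] at hm
  calc _ ≤ ∫⁻ x, (2 ^ |(-(β / p))|) ^ q * (∑' j : ℤ, if dd E x ≤ 2 * ee j then 0 else
      dd E x ^ (-κ) * ee j ^ s * av μ (2 ^ j) (fun y => g y * dd E y ^ (β / p)) x) ^ q ∂μ := by
        refine lintegral_mono_ae ?_
        filter_upwards [hae] with x hx
        exact loc_reduce E s p q β α hq0 hg hx
    _ ≤ _ := by
        rw [lintegral_const_mul _ hFm, mul_assoc]
        gcongr

theorem fractional_hardy_sobolev [Nontrivial X]
    (μ : Measure X) (s : ℝ) (hs0 : 0 < s) (hs1 : s < 1)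
    (hsa : StandingAssumptions μ) (hballs : BallsPosFinite μ) (hdbl : Doubling μ)
    (hchain : ChainCondition X 1) (hrev : ReverseDoubling μ s)
    (Q c : ℝ) (hQ : s < Q) (hc : 0 < c)
    (hlow : ∀ (x : X) (r : ℝ), 0 < r → ENNReal.ofReal (c * r ^ Q) ≤ μ (ball x r))
    (E : Set X) (hE : E.Nonempty) (hEc : IsClosed E)
    (p q β : ℝ) (hp : 1 < p) (hpq : p ≤ q) (hsp : s * p < Q)
    (hq : q ≤ Q * p / (Q - s * p))
    (hcodim : max (Q - q / p * (Q - s * p + β)) (β / (p - 1)) < assouadCodim μ E) :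
    ∀ t : ℝ, 1 ≤ t → ∃ C : ℝ, 0 < C ∧ ∀ f : X → ℝ, MemLip0 f →
      (∫⁻ x, ENNReal.ofReal |f x| ^ q *
          ENNReal.ofReal (infDist x E) ^ (q / p * (Q - s * p + β) - Q) ∂μ) ^ (1 / q) ≤
        ENNReal.ofReal C *
          (∫⁻ y, fracEnergyKernel μ s t f y ^ (p / t) *
            ENNReal.ofReal (infDist y E) ^ β ∂μ) ^ (1 / p) := by
  intro t ht
  have hp0 : 0 < p := by linarith
  have hq0 : 0 < q := by linarith
  have hQ0 : 0 < Q := by linarith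
  have hp1 : 0 < p - 1 := by linarith
  have hsp' : 0 < Q - s * p := by linarith
  obtain ⟨D', hD', hDW⟩ := hdbl
  have h : Dbl μ (ENNReal.ofReal D') := ⟨hballs, ENNReal.ofReal_ne_top, hDW⟩
  haveI : Nonempty X := ⟨hE.some⟩
  haveI := h.sigmaFinite
  haveI := h.secondCountable
  obtain ⟨α, hα⟩ : ∃ α, α = Q - q / p * (Q - s * p + β) := ⟨_, rfl⟩
  rw [← hα] at hcodim
  have hmax : 0 ≤ max α (β / (p - 1)) := by
    rcases le_or_gt β 0 with hβ | hβ
    · refine le_trans ?_ (le_max_left _ _)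
      rw [le_div_iff₀ hsp'] at hq
      have h1 : α = (Q * p - q * (Q - s * p) + q * (-β)) / p := by rw [hα]; field_simp; ring
      rw [h1]
      have h2 : 0 ≤ q * (-β) := mul_nonneg hq0.le (by linarith)
      exact div_nonneg (by linarith) hp0.le
    · exact le_trans (by positivity) (le_max_right _ _)
  have hne : (assouadCodimBddSet μ E).Nonempty := by
    by_contra hcon
    rw [not_nonempty_iff_eq_empty] at hcon
    rw [assouadCodim, hcon, Real.sSup_empty] at hcodim
    linarith
  obtain ⟨ρ, ⟨-, C₀, hC₀, hco'⟩, hρ⟩ := exists_lt_of_lt_csSup hne hcodim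
  have hdiam : EMetric.diam (univ : Set X) = ⊤ := by
    by_contra hcon
    exact hsa.1 (Metric.isBounded_iff_ediam_ne_top.2 hcon)
  have hco : CodimBd μ E ρ C₀ := by
    intro x hx r R hr hrR
    refine hco' x hx r R hr hrR ?_
    rw [hdiam, ENNReal.mul_top (by norm_num)]
    exact ENNReal.ofReal_lt_top
  have hρ0 : 0 < ρ := hmax.trans_lt hρ
  have hC₀0 : 0 ≤ C₀ := by linarith
  have hαρ : α < ρ := (le_max_left _ _).trans_lt hρ
  have hβρ : β / (p - 1) < ρ := (le_max_right _ _).trans_lt hρ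
  have hae := dd_ae h E hE ρ C₀ hρ0 hC₀0 hco
  obtain ⟨C₁, hC₁, hpw⟩ := pointwise h s t hs0 ht Q c hQ0 hc hlow
  obtain ⟨C₂, hC₂, hfar⟩ := far h E hE ρ C₀ hρ0 hC₀0 hco s Q c p q β α hs0 hc hlow hp hpq hα hαρ hβρ
  obtain ⟨C₃, hC₃, hloc⟩ := loc h E hae s Q c p q β α hs0 hQ0 hc hlow hp hpq hα hsp hq
  have hdm := measurable_dd E
  obtain ⟨A, hA⟩ : ∃ A : ℝ≥0∞, A = C₁ ^ q * 2 ^ (q - 1) * (C₂ + C₃) := ⟨_, rfl⟩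
  have hAt : A ≠ ⊤ := by
    rw [hA]
    exact ENNReal.mul_ne_top (ENNReal.mul_ne_top (ENNReal.rpow_ne_top_of_nonneg hq0.le hC₁)
      (ENNReal.rpow_ne_top_of_nonneg (by linarith) (by norm_num))) (ENNReal.add_ne_top.2 ⟨hC₂, hC₃⟩)
  have hAq : A ^ (1 / q) ≠ ⊤ := ENNReal.rpow_ne_top_of_nonneg (by positivity) hAt
  refine ⟨(A ^ (1 / q)).toReal + 1, by positivity, fun f hf => ?_⟩
  have hfc : Continuous f := by
    obtain ⟨⟨K, hK⟩, -⟩ := hf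
    exact hK.continuous
  set g : X → ℝ≥0∞ := fun y => fracEnergyKernel μ s t f y ^ (1 / t) with hg
  have hgm : Measurable g := (measurable_kernel μ s t hfc).pow_const _
  have hgp : ∀ y, fracEnergyKernel μ s t f y ^ (p / t) * ENNReal.ofReal (infDist y E) ^ β =
      g y ^ p * dd E y ^ β := by
    intro y
    rw [hg]
    simp only
    rw [← ENNReal.rpow_mul, dd]
    congr 2
    ring
  simp only [hgp]
  set N := ∫⁻ y, g y ^ p * dd E y ^ β ∂μ with hN
  have hw : q / p * (Q - s * p + β) - Q = -α := by rw [hα]; ring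
  rw [hw]
  set Fa : X → ℝ≥0∞ := fun x => ∑' j : ℤ, if dd E x ≤ 2 * ee j then ee j ^ s * av μ (2 ^ j) g x else 0 with hFa
  set Fl : X → ℝ≥0∞ := fun x => ∑' j : ℤ, if dd E x ≤ 2 * ee j then 0 else ee j ^ s * av μ (2 ^ j) g x with hFl
  have hFam : Measurable fun x => Fa x ^ q * dd E x ^ (-α) := by
    refine Measurable.mul (Measurable.pow_const (Measurable.ennreal_tsum fun j => ?_) _) (hdm.pow_const _)
    exact Measurable.ite (measurableSet_le hdm measurable_const)
      ((measurable_av μ _ hgm).const_mul _) measurable_const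
  have hpt : ∀ x, ENNReal.ofReal |f x| ^ q * ENNReal.ofReal (infDist x E) ^ (-α) ≤
      C₁ ^ q * 2 ^ (q - 1) * (Fa x ^ q * dd E x ^ (-α) + Fl x ^ q * dd E x ^ (-α)) := by
    intro x
    have h1 : ENNReal.ofReal |f x| ≤ C₁ * (Fa x + Fl x) := by
      refine (hpw f hf x).trans (le_of_eq ?_)
      rw [hFa, hFl]
      simp only
      rw [← ENNReal.tsum_add]
      congr 1
      refine tsum_congr fun j => ?_
      split_ifs <;> simp [hg]
    calc _ ≤ (C₁ * (Fa x + Fl x)) ^ q * dd E x ^ (-α) := by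
          exact mul_le_mul' (ENNReal.rpow_le_rpow h1 hq0.le) le_rfl
      _ = C₁ ^ q * (Fa x + Fl x) ^ q * dd E x ^ (-α) := by rw [ENNReal.mul_rpow_of_nonneg _ _ hq0.le]
      _ ≤ C₁ ^ q * (2 ^ (q - 1) * (Fa x ^ q + Fl x ^ q)) * dd E x ^ (-α) := by
          gcongr
          exact ENNReal.rpow_add_le_mul_rpow_add_rpow _ _ (by linarith)
      _ = _ := by ring
  have hB : C₁ ^ q * (2:ℝ≥0∞) ^ (q - 1) ≠ ⊤ := ENNReal.mul_ne_top (ENNReal.rpow_ne_top_of_nonneg hq0.le hC₁)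
      (ENNReal.rpow_ne_top_of_nonneg (by linarith) (by norm_num))
  have hfin_int : ∫⁻ x, ENNReal.ofReal |f x| ^ q * ENNReal.ofReal (infDist x E) ^ (-α) ∂μ ≤ A * N ^ (q / p) := by
    refine (lintegral_mono hpt).trans ?_
    rw [lintegral_const_mul' _ _ hB, lintegral_add_left hFam, hA, mul_assoc (C₁ ^ q * 2 ^ (q - 1)), add_mul]
    gcongr
    · exact hfar g hgm
    · exact hloc g hgm
  calc _ ≤ (A * N ^ (q / p)) ^ (1 / q) := ENNReal.rpow_le_rpow hfin_int (by positivity)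
    _ = A ^ (1 / q) * N ^ (1 / p) := by
      rw [ENNReal.mul_rpow_of_nonneg _ _ (by positivity), ← ENNReal.rpow_mul]
      congr 2
      field_simp
    _ ≤ _ := by
      gcongr
      refine (ENNReal.le_ofReal_iff_toReal_le hAq (by positivity)).2 (by linarith)

end
end ApDistance
end

section
/- Let 0 < s < 1 and assume X is Ahlfors Q-regular with Q > s, i.e., there exists C_A ≥ 1 such that C_A^{-1} r^Q ≤ μ(B(x,r)) ≤ C_A r^Q for each x ∈ X and every 0 < r < ∞ (and the standing assumptions hold). Let ∅ ≠ E ⊂ X be a closed set with codim_A(E) > 0, let 1 < p ≤ q ≤ Qp/(Q−sp) < ∞ and β ≥ 0, and suppose that for some 1 ≤ t ≤ q and C_H > 0 the inequality (∫_X |f(x)|^q δ_E(x)^{(q/p)(Q−sp+β)−Q} dμ(x))^{1/q} ≤ C_H (∫_X (∫_X |f(y)−f(z)|^t / (d(y,z)^{st} μ(B(y,d(y,z)))) dμ(z))^{p/t} δ_E(y)^β dμ(y))^{1/p} holds for all f ∈ Lip_0(X). Then codim_A(E) > Q − (q/p)(Q−sp+β). -/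
open MeasureTheory Metric Set
open scoped ENNReal NNReal

namespace ApDistance

noncomputable section

variable {X : Type*} [MetricSpace X] [MeasurableSpace X] [BorelSpace X]

lemma tail_bound (μ : Measure X) (Q CA : ℝ) (hQ : 0 < Q) (hCA : 0 ≤ CA)
    (hup : ∀ (x : X) (r : ℝ), 0 < r → μ (ball x r) ≤ ENNReal.ofReal (CA * r ^ Q))
    (a : ℝ) (ha : 0 < a) :
    ∃ C : ℝ, 0 ≤ C ∧ ∀ (y : X) (R : ℝ), 0 < R →
      ∫⁻ z in {z | R ≤ dist y z}, ENNReal.ofReal (dist y z ^ (-a - Q)) ∂μ ≤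
        ENNReal.ofReal (C * R ^ (-a)) := by
  have hlt : (2 : ℝ) ^ (-a) < 1 := Real.rpow_lt_one_of_one_lt_of_neg (by norm_num) (by linarith)
  have hpos : (0 : ℝ) < (2 : ℝ) ^ (-a) := by positivity
  have hsum : Summable (fun k : ℕ => ((2 : ℝ) ^ (-a)) ^ k) :=
    summable_geometric_of_lt_one hpos.le hlt
  refine ⟨CA * 2 ^ Q * ∑' k : ℕ, ((2 : ℝ) ^ (-a)) ^ k, by positivity, ?_⟩
  intro y R hR
  let S : ℕ → Set X := fun k => {z | 2 ^ k * R ≤ dist y z ∧ dist y z < 2 ^ (k + 1) * R}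
  have hSm : ∀ k, MeasurableSet (S k) := by
    intro k
    have hd : Measurable (fun z : X => dist y z) := (continuous_const.dist continuous_id).measurable
    exact (measurableSet_le measurable_const hd).inter (measurableSet_lt hd measurable_const)
  have hcov : {z | R ≤ dist y z} ⊆ ⋃ k, S k := by
    intro z hz
    have hz' : 1 ≤ dist y z / R := by rw [le_div_iff₀ hR]; simpa using hz
    obtain ⟨n, h1, h2⟩ := exists_nat_pow_near hz' (by norm_num : (1 : ℝ) < 2)
    refine mem_iUnion.2 ⟨n, ?_, ?_⟩
    · rwa [le_div_iff₀ hR] at h1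
    · rwa [div_lt_iff₀ hR] at h2
  have hterm : ∀ k, ∫⁻ z in S k, ENNReal.ofReal (dist y z ^ (-a - Q)) ∂μ ≤
      ENNReal.ofReal (CA * 2 ^ Q * R ^ (-a) * ((2 : ℝ) ^ (-a)) ^ k) := by
    intro k
    have hu : (0 : ℝ) < 2 ^ k * R := by positivity
    calc ∫⁻ z in S k, ENNReal.ofReal (dist y z ^ (-a - Q)) ∂μ
        ≤ ∫⁻ z in S k, ENNReal.ofReal ((2 ^ k * R) ^ (-a - Q)) ∂μ := by
          refine setLIntegral_mono' (hSm k) fun z hz => ENNReal.ofReal_le_ofReal ?_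
          exact Real.rpow_le_rpow_of_nonpos hu hz.1 (by linarith)
      _ = ENNReal.ofReal ((2 ^ k * R) ^ (-a - Q)) * μ (S k) := setLIntegral_const _ _
      _ ≤ ENNReal.ofReal ((2 ^ k * R) ^ (-a - Q)) * ENNReal.ofReal (CA * (2 ^ (k + 1) * R) ^ Q) := by
          gcongr
          refine (measure_mono ?_).trans (hup y _ (by positivity))
          intro z hz
          rw [mem_ball, dist_comm]; exact hz.2
      _ = _ := by
          rw [← ENNReal.ofReal_mul (by positivity)]
          congr 1
          have e1 : (2 : ℝ) ^ (k + 1) * R = 2 * (2 ^ k * R) := by ring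
          have e2 : ((2 : ℝ) ^ k * R) ^ (-a) = ((2 : ℝ) ^ (-a)) ^ k * R ^ (-a) := by
            rw [Real.mul_rpow (by positivity) hR.le, ← Real.rpow_natCast, ← Real.rpow_natCast,
              ← Real.rpow_mul (by norm_num), ← Real.rpow_mul (by norm_num), mul_comm (k : ℝ)]
          rw [e1, Real.mul_rpow (by norm_num) hu.le]
          have e3 : ((2 : ℝ) ^ k * R) ^ (-a - Q) * (2 ^ k * R) ^ Q = (2 ^ k * R) ^ (-a) := by
            rw [← Real.rpow_add hu]; congr 1; ring
          calc _ = CA * 2 ^ Q * (((2 : ℝ) ^ k * R) ^ (-a - Q) * (2 ^ k * R) ^ Q) := by ring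
            _ = _ := by rw [e3, e2]; ring
  calc _ ≤ ∫⁻ z in ⋃ k, S k, ENNReal.ofReal (dist y z ^ (-a - Q)) ∂μ := lintegral_mono_set hcov
    _ ≤ ∑' k, ∫⁻ z in S k, ENNReal.ofReal (dist y z ^ (-a - Q)) ∂μ := lintegral_iUnion_le _ _
    _ ≤ ∑' k, ENNReal.ofReal (CA * 2 ^ Q * R ^ (-a) * ((2 : ℝ) ^ (-a)) ^ k) :=
        ENNReal.tsum_le_tsum hterm
    _ = _ := by
      rw [← ENNReal.ofReal_tsum_of_nonneg (fun k => by positivity) (hsum.mul_left _), tsum_mul_left]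
      congr 1; ring

lemma near_bound (μ : Measure X) (Q CA : ℝ) (hQ : 0 < Q) (hCA : 0 ≤ CA)
    (hup : ∀ (x : X) (r : ℝ), 0 < r → μ (ball x r) ≤ ENNReal.ofReal (CA * r ^ Q))
    (a : ℝ) (ha : 0 < a) :
    ∃ C : ℝ, 0 ≤ C ∧ ∀ (y : X) (R : ℝ), 0 < R →
      ∫⁻ z in {z | 0 < dist y z ∧ dist y z < R}, ENNReal.ofReal (dist y z ^ (a - Q)) ∂μ ≤
        ENNReal.ofReal (C * R ^ a) := by
  have hlt : (1 / 2 : ℝ) ^ a < 1 := Real.rpow_lt_one (by norm_num) (by norm_num) ha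
  have hpos : (0 : ℝ) < (1 / 2 : ℝ) ^ a := by positivity
  have hsum : Summable (fun k : ℕ => ((1 / 2 : ℝ) ^ a) ^ k) :=
    summable_geometric_of_lt_one hpos.le hlt
  refine ⟨CA * 2 ^ a * 4 ^ Q * (1 / 2 : ℝ) ^ a * ∑' k : ℕ, ((1 / 2 : ℝ) ^ a) ^ k,
    by positivity, ?_⟩
  intro y R hR
  let S : ℕ → Set X := fun k => {z | (1 / 2) ^ (k + 1) * R ≤ dist y z ∧ dist y z ≤ (1 / 2) ^ k * R}
  have hSm : ∀ k, MeasurableSet (S k) := by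
    intro k
    have hd : Measurable (fun z : X => dist y z) := (continuous_const.dist continuous_id).measurable
    exact (measurableSet_le measurable_const hd).inter (measurableSet_le hd measurable_const)
  have hcov : {z | 0 < dist y z ∧ dist y z < R} ⊆ ⋃ k, S k := by
    rintro z ⟨hz0, hz1⟩
    have hz' : dist y z / R ≤ 1 := by rw [div_le_iff₀ hR]; linarith
    obtain ⟨n, h1, h2⟩ := exists_nat_pow_near_of_lt_one (div_pos hz0 hR) hz'
      (by norm_num : (0 : ℝ) < 1 / 2) (by norm_num)
    refine mem_iUnion.2 ⟨n, ?_, ?_⟩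
    · rw [lt_div_iff₀ hR] at h1; exact h1.le
    · rwa [div_le_iff₀ hR] at h2
  have hterm : ∀ k, ∫⁻ z in S k, ENNReal.ofReal (dist y z ^ (a - Q)) ∂μ ≤
      ENNReal.ofReal (CA * 2 ^ a * 4 ^ Q * (1 / 2 : ℝ) ^ a * R ^ a * ((1 / 2 : ℝ) ^ a) ^ k) := by
    intro k
    have hu : (0 : ℝ) < (1 / 2) ^ (k + 1) * R := by positivity
    set u : ℝ := (1 / 2) ^ (k + 1) * R with hudef
    have e1 : (1 / 2 : ℝ) ^ k * R = 2 * u := by rw [hudef]; ring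
    calc ∫⁻ z in S k, ENNReal.ofReal (dist y z ^ (a - Q)) ∂μ
        ≤ ∫⁻ z in S k, ENNReal.ofReal ((2 * u) ^ a * u ^ (-Q)) ∂μ := by
          refine setLIntegral_mono' (hSm k) fun z hz => ENNReal.ofReal_le_ofReal ?_
          have hz1 : u ≤ dist y z := hz.1
          have hz2 : dist y z ≤ 2 * u := e1 ▸ hz.2
          have hz0 : 0 < dist y z := hu.trans_le hz1
          rw [sub_eq_add_neg, Real.rpow_add hz0]
          gcongr ?_ * ?_
          · exact Real.rpow_le_rpow hz0.le hz2 ha.le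
          · exact Real.rpow_le_rpow_of_nonpos hu hz1 (by linarith)
      _ = ENNReal.ofReal ((2 * u) ^ a * u ^ (-Q)) * μ (S k) := setLIntegral_const _ _
      _ ≤ ENNReal.ofReal ((2 * u) ^ a * u ^ (-Q)) * ENNReal.ofReal (CA * (4 * u) ^ Q) := by
          gcongr
          refine (measure_mono ?_).trans (hup y _ (by positivity))
          intro z hz
          have hz2 : dist y z ≤ 2 * u := e1 ▸ hz.2
          rw [mem_ball, dist_comm]; linarith
      _ = _ := by
          rw [← ENNReal.ofReal_mul (by positivity)]
          congr 1
          have e2 : u ^ a = (1 / 2 : ℝ) ^ a * ((1 / 2 : ℝ) ^ a) ^ k * R ^ a := by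
            rw [hudef, Real.mul_rpow (by positivity) hR.le, ← pow_succ', ← Real.rpow_natCast,
              ← Real.rpow_natCast,
              ← Real.rpow_mul (by norm_num), ← Real.rpow_mul (by norm_num), mul_comm a]
          rw [Real.mul_rpow (by norm_num) hu.le, Real.mul_rpow (by norm_num) hu.le]
          have e3 : u ^ (-Q) * u ^ Q = 1 := by
            rw [← Real.rpow_add hu]; simp
          calc _ = CA * 2 ^ a * 4 ^ Q * u ^ a * (u ^ (-Q) * u ^ Q) := by ring
            _ = _ := by rw [e3, e2]; ring
  calc _ ≤ ∫⁻ z in ⋃ k, S k, ENNReal.ofReal (dist y z ^ (a - Q)) ∂μ := lintegral_mono_set hcov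
    _ ≤ ∑' k, ∫⁻ z in S k, ENNReal.ofReal (dist y z ^ (a - Q)) ∂μ := lintegral_iUnion_le _ _
    _ ≤ ∑' k, ENNReal.ofReal (CA * 2 ^ a * 4 ^ Q * (1 / 2 : ℝ) ^ a * R ^ a *
          ((1 / 2 : ℝ) ^ a) ^ k) := ENNReal.tsum_le_tsum hterm
    _ = _ := by
      rw [← ENNReal.ofReal_tsum_of_nonneg (fun k => by positivity) (hsum.mul_left _), tsum_mul_left]
      congr 1; ring

lemma integrand_le (μ : Measure X) (Q CA : ℝ) (hCA : 0 < CA)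
    (hlo : ∀ (x : X) (r : ℝ), 0 < r → ENNReal.ofReal (CA⁻¹ * r ^ Q) ≤ μ (ball x r))
    (b : ℝ) (y : X) (D v V : ℝ) (hD : 0 < D) (hvV : v ≤ V) :
    ENNReal.ofReal v / (ENNReal.ofReal (D ^ b) * μ (ball y D)) ≤
      ENNReal.ofReal (V * CA * D ^ (-b - Q)) := by
  calc ENNReal.ofReal v / (ENNReal.ofReal (D ^ b) * μ (ball y D))
      ≤ ENNReal.ofReal V / (ENNReal.ofReal (D ^ b) * ENNReal.ofReal (CA⁻¹ * D ^ Q)) := by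
        gcongr
        exact hlo y D hD
    _ = _ := by
        rw [← ENNReal.ofReal_mul (by positivity), ← ENNReal.ofReal_div_of_pos (by positivity)]
        congr 1
        rw [sub_eq_add_neg, Real.rpow_add hD, Real.rpow_neg hD.le, Real.rpow_neg hD.le]
        field_simp

lemma kernel_le (μ : Measure X) (hpt : ∀ x : X, μ {x} = 0) (s t Q CA : ℝ)
    (hs0 : 0 < s) (hs1 : s < 1) (ht : 1 ≤ t)
    (hQ : 0 < Q) (hCA : 0 < CA)
    (hlo : ∀ (x : X) (r : ℝ), 0 < r → ENNReal.ofReal (CA⁻¹ * r ^ Q) ≤ μ (ball x r))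
    (hup : ∀ (x : X) (r : ℝ), 0 < r → μ (ball x r) ≤ ENNReal.ofReal (CA * r ^ Q)) :
    ∃ C : ℝ, 0 ≤ C ∧ ∀ (R : ℝ), 0 < R → ∀ f : X → ℝ, (∀ y z, |f y - f z| ≤ 1) →
      (∀ y z, |f y - f z| ≤ dist y z / R) → ∀ y, fracEnergyKernel μ s t f y ≤
        ENNReal.ofReal (C * R ^ (-(s * t))) := by
  obtain ⟨C1, hC1, h1⟩ := tail_bound μ Q CA hQ hCA.le hup (s * t) (by positivity)
  obtain ⟨C2, hC2, h2⟩ := near_bound μ Q CA hQ hCA.le hup (t - s * t) (by nlinarith)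
  refine ⟨CA * C1 + CA * C2, by positivity, ?_⟩
  intro R hR f hf1 hf2 y
  have hd : Measurable (fun z : X => dist y z) := (continuous_const.dist continuous_id).measurable
  unfold fracEnergyKernel
  set g : X → ℝ≥0∞ := fun z => ENNReal.ofReal (|f y - f z| ^ t) /
    (ENNReal.ofReal (dist y z ^ (s * t)) * μ (ball y (dist y z))) with hg
  have hcov : (univ : Set X) = {z | R ≤ dist y z} ∪
      ({z | 0 < dist y z ∧ dist y z < R} ∪ {y}) := by
    ext z
    simp only [mem_univ, mem_union, mem_setOf_eq, mem_singleton_iff, true_iff]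
    rcases le_or_gt R (dist y z) with h | h
    · exact Or.inl h
    · rcases eq_or_ne z y with h' | h'
      · exact Or.inr (Or.inr h')
      · exact Or.inr (Or.inl ⟨dist_pos.2 h'.symm, h⟩)
  have hA : ∫⁻ z in {z | R ≤ dist y z}, g z ∂μ ≤ ENNReal.ofReal (CA * C1 * R ^ (-(s * t))) := by
    calc ∫⁻ z in {z | R ≤ dist y z}, g z ∂μ
        ≤ ∫⁻ z in {z | R ≤ dist y z},
            ENNReal.ofReal CA * ENNReal.ofReal (dist y z ^ (-(s * t) - Q)) ∂μ := by
          refine setLIntegral_mono' (measurableSet_le measurable_const hd) fun z hz => ?_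
          have hz' : R ≤ dist y z := hz
          rw [← ENNReal.ofReal_mul hCA.le]
          have := integrand_le μ Q CA hCA hlo (s * t) y (dist y z) (|f y - f z| ^ t) 1
            (hR.trans_le hz') (Real.rpow_le_one (abs_nonneg _) (hf1 y z) (by linarith))
          rwa [one_mul] at this
      _ = ENNReal.ofReal CA * ∫⁻ z in {z | R ≤ dist y z},
            ENNReal.ofReal (dist y z ^ (-(s * t) - Q)) ∂μ :=
          lintegral_const_mul' _ _ ENNReal.ofReal_ne_top
      _ ≤ ENNReal.ofReal CA * ENNReal.ofReal (C1 * R ^ (-(s * t))) := by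
          gcongr; exact h1 y R hR
      _ = _ := by rw [← ENNReal.ofReal_mul hCA.le]; congr 1; ring
  have hB : ∫⁻ z in {z | 0 < dist y z ∧ dist y z < R}, g z ∂μ ≤
      ENNReal.ofReal (CA * C2 * R ^ (-(s * t))) := by
    calc ∫⁻ z in {z | 0 < dist y z ∧ dist y z < R}, g z ∂μ
        ≤ ∫⁻ z in {z | 0 < dist y z ∧ dist y z < R},
            ENNReal.ofReal (CA * R ^ (-t)) * ENNReal.ofReal (dist y z ^ (t - s * t - Q)) ∂μ := by
          refine setLIntegral_mono' ((measurableSet_lt measurable_const hd).inter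
            (measurableSet_lt hd measurable_const)) fun z hz => ?_
          have hz' : 0 < dist y z := hz.1
          rw [← ENNReal.ofReal_mul (by positivity)]
          have := integrand_le μ Q CA hCA hlo (s * t) y (dist y z) (|f y - f z| ^ t)
            ((dist y z / R) ^ t) hz'
            (Real.rpow_le_rpow (abs_nonneg _) (hf2 y z) (by linarith))
          refine this.trans_eq ?_
          congr 1
          rw [Real.div_rpow hz'.le hR.le, Real.rpow_neg hR.le]
          have e : dist y z ^ (t - s * t - Q) = dist y z ^ t * dist y z ^ (-(s * t) - Q) := by
            rw [← Real.rpow_add hz']; congr 1; ring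
          rw [e]; field_simp
      _ = ENNReal.ofReal (CA * R ^ (-t)) * ∫⁻ z in {z | 0 < dist y z ∧ dist y z < R},
            ENNReal.ofReal (dist y z ^ (t - s * t - Q)) ∂μ :=
          lintegral_const_mul' _ _ ENNReal.ofReal_ne_top
      _ ≤ ENNReal.ofReal (CA * R ^ (-t)) * ENNReal.ofReal (C2 * R ^ (t - s * t)) := by
          gcongr; exact h2 y R hR
      _ = _ := by
          rw [← ENNReal.ofReal_mul (by positivity)]; congr 1
          have e : R ^ (-(s * t)) = R ^ (-t) * R ^ (t - s * t) := by
            rw [← Real.rpow_add hR]; congr 1; ring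
          rw [e]; ring
  have hC : ∫⁻ z in {y}, g z ∂μ = 0 := setLIntegral_measure_zero _ _ (hpt y)
  calc ∫⁻ z, g z ∂μ = ∫⁻ z in univ, g z ∂μ := by rw [setLIntegral_univ]
    _ ≤ ∫⁻ z in {z | R ≤ dist y z}, g z ∂μ +
        (∫⁻ z in {z | 0 < dist y z ∧ dist y z < R}, g z ∂μ + ∫⁻ z in {y}, g z ∂μ) := by
        rw [hcov]
        exact (lintegral_union_le _ _ _).trans (by gcongr; exact lintegral_union_le _ _ _)
    _ ≤ ENNReal.ofReal (CA * C1 * R ^ (-(s * t))) +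
        (ENNReal.ofReal (CA * C2 * R ^ (-(s * t))) + 0) := by
        gcongr
        exact hC.le
    _ = _ := by
        rw [add_zero, ← ENNReal.ofReal_add (by positivity) (by positivity)]; congr 1; ring

lemma kernel_far (μ : Measure X) (s t Q CA : ℝ)
    (hs0 : 0 < s) (ht : 1 ≤ t) (hQ : 0 < Q) (hCA : 0 < CA)
    (hlo : ∀ (x : X) (r : ℝ), 0 < r → ENNReal.ofReal (CA⁻¹ * r ^ Q) ≤ μ (ball x r))
    (hup : ∀ (x : X) (r : ℝ), 0 < r → μ (ball x r) ≤ ENNReal.ofReal (CA * r ^ Q))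
    (w : X) (R : ℝ) (hR : 0 < R) (f : X → ℝ) (hf1 : ∀ y z, |f y - f z| ≤ 1)
    (hf0 : ∀ z, 2 * R ≤ dist w z → f z = 0) (y : X) (hy : 4 * R ≤ dist w y) :
    fracEnergyKernel μ s t f y ≤
      ENNReal.ofReal (CA * CA * (2 * R) ^ Q * (dist w y / 2) ^ (-(s * t) - Q)) := by
  unfold fracEnergyKernel
  set g : X → ℝ≥0∞ := fun z => ENNReal.ofReal (|f y - f z| ^ t) /
    (ENNReal.ofReal (dist y z ^ (s * t)) * μ (ball y (dist y z))) with hg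
  have hfy : f y = 0 := hf0 y (by linarith)
  have hz0 : ∀ z ∈ (ball w (2 * R))ᶜ, g z = 0 := by
    intro z hz
    have : f z = 0 := hf0 z (by simpa [dist_comm] using hz)
    simp only [hg, hfy, this, sub_zero, abs_zero]
    rw [Real.zero_rpow (by linarith)]; simp
  have hin : ∀ z ∈ ball w (2 * R), g z ≤ ENNReal.ofReal (CA * (dist w y / 2) ^ (-(s * t) - Q)) := by
    intro z hz
    rw [mem_ball, dist_comm] at hz
    have htri : dist w y ≤ dist w z + dist y z := by
      rw [dist_comm y z]; exact dist_triangle w z y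
    have hD : dist w y / 2 ≤ dist y z := by linarith
    have hD0 : 0 < dist w y / 2 := by linarith
    have := integrand_le μ Q CA hCA hlo (s * t) y (dist y z) (|f y - f z| ^ t) 1
            (hD0.trans_le hD) (Real.rpow_le_one (abs_nonneg _) (hf1 y z) (by linarith))
    rw [one_mul] at this
    refine this.trans (ENNReal.ofReal_le_ofReal ?_)
    refine mul_le_mul_of_nonneg_left (Real.rpow_le_rpow_of_nonpos hD0 hD ?_) hCA.le
    have : 0 < s * t := by positivity
    linarith
  rw [← lintegral_add_compl g (measurableSet_ball : MeasurableSet (ball w (2 * R))),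
    setLIntegral_congr_fun measurableSet_ball.compl hz0]
  simp only [lintegral_zero, add_zero]
  calc _ ≤ ∫⁻ z in ball w (2 * R), ENNReal.ofReal (CA * (dist w y / 2) ^ (-(s * t) - Q)) ∂μ :=
        setLIntegral_mono' measurableSet_ball hin
    _ = ENNReal.ofReal (CA * (dist w y / 2) ^ (-(s * t) - Q)) * μ (ball w (2 * R)) :=
        setLIntegral_const _ _
    _ ≤ ENNReal.ofReal (CA * (dist w y / 2) ^ (-(s * t) - Q)) *
        ENNReal.ofReal (CA * (2 * R) ^ Q) := by gcongr; exact hup w _ (by positivity)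
    _ = _ := by rw [← ENNReal.ofReal_mul (by positivity)]; congr 1; ring

lemma energy_le (μ : Measure X) (hpt : ∀ x : X, μ {x} = 0) (s t Q CA p β : ℝ)
    (hs0 : 0 < s) (hs1 : s < 1) (ht : 1 ≤ t)
    (hQ : 0 < Q) (hCA : 0 < CA) (hp : 1 < p) (hβ : 0 ≤ β)
    (hlo : ∀ (x : X) (r : ℝ), 0 < r → ENNReal.ofReal (CA⁻¹ * r ^ Q) ≤ μ (ball x r))
    (hup : ∀ (x : X) (r : ℝ), 0 < r → μ (ball x r) ≤ ENNReal.ofReal (CA * r ^ Q))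
    (hexp : Q - s * p + β < Q * p / t) (E : Set X) :
    ∃ C : ℝ, 0 ≤ C ∧ ∀ w ∈ E, ∀ (R : ℝ), 0 < R → ∀ f : X → ℝ, (∀ y z, |f y - f z| ≤ 1) →
      (∀ y z, |f y - f z| ≤ dist y z / R) → (∀ z, 2 * R ≤ dist w z → f z = 0) →
      ∫⁻ y, fracEnergyKernel μ s t f y ^ (p / t) * ENNReal.ofReal (infDist y E) ^ β ∂μ ≤
        ENNReal.ofReal (C * R ^ (Q - s * p + β)) := by
  have ht0 : 0 < t := by linarith
  have hp0 : 0 < p := by linarith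
  have hpt0 : 0 < p / t := by positivity
  obtain ⟨C1, hC1, h1⟩ := kernel_le μ hpt s t Q CA hs0 hs1 ht hQ hCA hlo hup
  set a : ℝ := Q * p / t - (Q - s * p + β) with ha_def
  have ha : 0 < a := by rw [ha_def]; linarith
  obtain ⟨C3, hC3, h3⟩ := tail_bound μ Q CA hQ hCA.le hup a ha
  set M : ℝ := (CA * CA * 2 ^ Q * 2 ^ (s * t + Q)) ^ (p / t) with hM
  have hM0 : 0 ≤ M := by positivity
  refine ⟨C1 ^ (p / t) * 4 ^ β * CA * 4 ^ Q + M * C3 * 4 ^ (-a), by positivity, ?_⟩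
  intro w hw R hR f hf1 hf2 hf0
  have hd : Measurable (fun z : X => dist w z) := (continuous_const.dist continuous_id).measurable
  have hdist : ∀ y, infDist y E ≤ dist w y := fun y => by
    rw [dist_comm]; exact infDist_le_dist_of_mem hw
  set F : X → ℝ≥0∞ := fun y =>
    fracEnergyKernel μ s t f y ^ (p / t) * ENNReal.ofReal (infDist y E) ^ β with hF
  have hnear : ∫⁻ y in {y | dist w y < 4 * R}, F y ∂μ ≤
      ENNReal.ofReal (C1 ^ (p / t) * 4 ^ β * CA * 4 ^ Q * R ^ (Q - s * p + β)) := by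
    calc _ ≤ ∫⁻ y in {y | dist w y < 4 * R},
          ENNReal.ofReal (C1 * R ^ (-(s * t))) ^ (p / t) * ENNReal.ofReal (4 * R) ^ β ∂μ := by
          refine setLIntegral_mono' (measurableSet_lt hd measurable_const) fun y hy => ?_
          have hy' : dist w y < 4 * R := hy
          simp only [hF]
          gcongr
          · exact h1 R hR f hf1 hf2 y
          · exact (hdist y).trans hy'.le
      _ = ENNReal.ofReal (C1 * R ^ (-(s * t))) ^ (p / t) * ENNReal.ofReal (4 * R) ^ β *
          μ {y | dist w y < 4 * R} := setLIntegral_const _ _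
      _ ≤ ENNReal.ofReal (C1 * R ^ (-(s * t))) ^ (p / t) * ENNReal.ofReal (4 * R) ^ β *
          ENNReal.ofReal (CA * (4 * R) ^ Q) := by
          gcongr
          refine (measure_mono ?_).trans (hup w _ (by positivity))
          intro z hz
          rw [mem_ball, dist_comm]; exact hz
      _ = _ := by
          rw [ENNReal.ofReal_rpow_of_nonneg (by positivity) hpt0.le,
            ENNReal.ofReal_rpow_of_nonneg (by positivity) hβ,
            ← ENNReal.ofReal_mul (by positivity), ← ENNReal.ofReal_mul (by positivity)]
          congr 1
          have e : R ^ (Q - s * p + β) = (R ^ (-(s * t))) ^ (p / t) * R ^ β * R ^ Q := by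
            rw [← Real.rpow_mul hR.le, ← Real.rpow_add hR, ← Real.rpow_add hR]
            congr 1; field_simp; ring
          rw [e, Real.mul_rpow hC1 (by positivity), Real.mul_rpow (by norm_num) hR.le,
            Real.mul_rpow (by norm_num) hR.le]
          ring
  have hfar : ∫⁻ y in {y | 4 * R ≤ dist w y}, F y ∂μ ≤
      ENNReal.ofReal (M * C3 * 4 ^ (-a) * R ^ (Q - s * p + β)) := by
    calc _ ≤ ∫⁻ y in {y | 4 * R ≤ dist w y},
          ENNReal.ofReal (M * R ^ (Q * p / t)) * ENNReal.ofReal (dist w y ^ (-a - Q)) ∂μ := by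
          refine setLIntegral_mono' (measurableSet_le measurable_const hd) fun y hy => ?_
          have hy' : 4 * R ≤ dist w y := hy
          have hy0 : 0 < dist w y := by linarith
          simp only [hF]
          calc _ ≤ ENNReal.ofReal (CA * CA * (2 * R) ^ Q * (dist w y / 2) ^ (-(s * t) - Q)) ^ (p / t)
                * ENNReal.ofReal (dist w y) ^ β := by
                gcongr
                · exact kernel_far μ s t Q CA hs0 ht hQ hCA hlo hup w R hR f hf1 hf0 y hy'
                · exact hdist y
            _ = _ := by
                rw [ENNReal.ofReal_rpow_of_nonneg (by positivity) hpt0.le,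
                  ENNReal.ofReal_rpow_of_nonneg (by positivity) hβ,
                  ← ENNReal.ofReal_mul (by positivity), ← ENNReal.ofReal_mul (by positivity)]
                congr 1
                have e1 : CA * CA * (2 * R) ^ Q * (dist w y / 2) ^ (-(s * t) - Q) =
                    (CA * CA * 2 ^ Q * 2 ^ (s * t + Q)) * R ^ Q * dist w y ^ (-(s * t) - Q) := by
                  have : (2 : ℝ) ^ (s * t + Q) = (2 ^ (-(s * t) - Q))⁻¹ := by
                    rw [← Real.rpow_neg (by norm_num)]; congr 1; ring
                  rw [Real.mul_rpow (by norm_num) hR.le, Real.div_rpow hy0.le (by norm_num), this]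
                  field_simp
                rw [e1, Real.mul_rpow (by positivity) (by positivity),
                  Real.mul_rpow (by positivity) (by positivity), ← hM, ← Real.rpow_mul hR.le,
                  ← Real.rpow_mul hy0.le]
                have e2 : dist w y ^ (-a - Q) =
                    dist w y ^ ((-(s * t) - Q) * (p / t)) * dist w y ^ β := by
                  rw [← Real.rpow_add hy0]; congr 1; rw [ha_def]; field_simp; ring
                rw [e2, mul_div_assoc]; ring
      _ = ENNReal.ofReal (M * R ^ (Q * p / t)) * ∫⁻ y in {y | 4 * R ≤ dist w y},
          ENNReal.ofReal (dist w y ^ (-a - Q)) ∂μ :=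
          lintegral_const_mul' _ _ ENNReal.ofReal_ne_top
      _ ≤ ENNReal.ofReal (M * R ^ (Q * p / t)) * ENNReal.ofReal (C3 * (4 * R) ^ (-a)) := by
          gcongr; exact h3 w _ (by positivity)
      _ = _ := by
          rw [← ENNReal.ofReal_mul (by positivity)]
          congr 1
          have e : R ^ (Q - s * p + β) = R ^ (Q * p / t) * R ^ (-a) := by
            rw [← Real.rpow_add hR]; congr 1; rw [ha_def]; ring
          rw [e, Real.mul_rpow (by norm_num) hR.le]; ring
  have hcov : (univ : Set X) = {y | dist w y < 4 * R} ∪ {y | 4 * R ≤ dist w y} := by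
    ext z
    have := lt_or_ge (dist w z) (4 * R)
    simpa using this
  calc ∫⁻ z, F z ∂μ = ∫⁻ z in univ, F z ∂μ := by rw [setLIntegral_univ]
    _ ≤ _ := by rw [hcov]; exact lintegral_union_le _ _ _
    _ ≤ _ := add_le_add hnear hfar
    _ = _ := by
        rw [← ENNReal.ofReal_add (by positivity) (by positivity)]; congr 1; ring

lemma cutoff_exists (w : X) (R : ℝ) (hR : 0 < R) :
    ∃ f : X → ℝ, MemLip0 f ∧ (∀ y z, |f y - f z| ≤ 1) ∧
      (∀ y z, |f y - f z| ≤ dist y z / R) ∧ (∀ z, 2 * R ≤ dist w z → f z = 0) ∧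
      (∀ z ∈ ball w R, f z = 1) := by
  set f : X → ℝ := fun y => max 0 (min 1 (2 - dist w y / R)) with hf
  have h0 : ∀ y, 0 ≤ f y := fun y => le_max_left _ _
  have h1 : ∀ y, f y ≤ 1 := fun y => max_le (by norm_num) (min_le_left _ _)
  have hlip : ∀ y z, |f y - f z| ≤ dist y z / R := by
    intro y z
    have a1 : |f y - f z| ≤ |min 1 (2 - dist w y / R) - min 1 (2 - dist w z / R)| := by
      have := abs_max_sub_max_le_max (0 : ℝ) (min 1 (2 - dist w y / R)) 0 (min 1 (2 - dist w z / R))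
      simpa using this
    have a2 : |min 1 (2 - dist w y / R) - min 1 (2 - dist w z / R)| ≤
        |(2 - dist w y / R) - (2 - dist w z / R)| := by
      have := abs_min_sub_min_le_max (1 : ℝ) (2 - dist w y / R) 1 (2 - dist w z / R)
      simpa using this
    have a3 : |(2 - dist w y / R) - (2 - dist w z / R)| ≤ dist y z / R := by
      have : (2 - dist w y / R) - (2 - dist w z / R) = (dist w z - dist w y) / R := by ring
      rw [this, abs_div, abs_of_pos hR]
      gcongr
      rw [dist_comm y z, dist_comm w z, dist_comm w y]
      exact abs_dist_sub_le z y w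
    exact a1.trans (a2.trans a3)
  have hz : ∀ z, 2 * R ≤ dist w z → f z = 0 := by
    intro z hz
    have : 2 ≤ dist w z / R := by rwa [le_div_iff₀ hR]
    exact max_eq_left ((min_le_right _ _).trans (by linarith))
  refine ⟨f, ⟨⟨(1 / R).toNNReal, ?_⟩, w, 2 * R, ?_⟩, ?_, hlip, hz, ?_⟩
  · refine LipschitzWith.of_dist_le_mul fun y z => ?_
    rw [Real.dist_eq, Real.coe_toNNReal _ (by positivity)]
    refine (hlip y z).trans_eq (by ring)
  · intro y hy
    exact hz y (by simpa [dist_comm] using hy)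
  · intro y z
    rw [abs_le]; constructor <;> linarith [h0 y, h0 z, h1 y, h1 z]
  · intro z hz'
    rw [mem_ball, dist_comm] at hz'
    have : dist w z / R < 1 := by rwa [div_lt_one hR]
    simp only [hf]
    rw [min_eq_left (by linarith), max_eq_right (by norm_num)]

lemma aikawa_of_hardy (μ : Measure X) (hpt : ∀ x : X, μ {x} = 0) (s t Q CA p q β CH : ℝ)
    (hs0 : 0 < s) (hs1 : s < 1) (ht : 1 ≤ t) (htq : t ≤ q)
    (hQ : 0 < Q) (hCA : 0 < CA) (hp : 1 < p) (hβ : 0 ≤ β) (hCH : 0 < CH)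
    (hlo : ∀ (x : X) (r : ℝ), 0 < r → ENNReal.ofReal (CA⁻¹ * r ^ Q) ≤ μ (ball x r))
    (hup : ∀ (x : X) (r : ℝ), 0 < r → μ (ball x r) ≤ ENNReal.ofReal (CA * r ^ Q))
    (E : Set X)
    (hHS : ∀ f : X → ℝ, MemLip0 f →
      (∫⁻ x, ENNReal.ofReal |f x| ^ q *
          ENNReal.ofReal (infDist x E) ^ (q / p * (Q - s * p + β) - Q) ∂μ) ^ (1 / q) ≤
        ENNReal.ofReal CH *
          (∫⁻ y, fracEnergyKernel μ s t f y ^ (p / t) *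
            ENNReal.ofReal (infDist y E) ^ β ∂μ) ^ (1 / p))
    (γ : ℝ) (hγdef : γ = Q - q / p * (Q - s * p + β)) (hγ : 0 < γ) :
    ∃ C : ℝ, 0 < C ∧ ∀ w ∈ E, ∀ R : ℝ, 0 < R →
      ∫⁻ y in ball w R, ENNReal.ofReal (infDist y E) ^ (-γ) ∂μ ≤
        ENNReal.ofReal (C * R ^ (Q - γ)) := by
  have ht0 : 0 < t := by linarith
  have hp0 : 0 < p := by linarith
  have hq0 : 0 < q := by linarith
  have hexp : Q - s * p + β < Q * p / t := by
    have h1 : q / p * (Q - s * p + β) < Q := by linarith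
    have h2 : Q - s * p + β < Q * p / q := by
      rw [lt_div_iff₀ hq0]
      rw [div_mul_eq_mul_div, div_lt_iff₀ hp0] at h1
      linarith
    refine h2.trans_le ?_
    gcongr
  obtain ⟨C, hC, h⟩ := energy_le μ hpt s t Q CA p β hs0 hs1 ht hQ hCA hp hβ hlo hup hexp E
  refine ⟨CH ^ q * (C + 1) ^ (q / p), by positivity, ?_⟩
  intro w hw R hR
  obtain ⟨f, hfL, hf1, hf2, hf0, hfb⟩ := cutoff_exists w R hR
  have hH := hHS f hfL
  have hEn := h w hw R hR f hf1 hf2 hf0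
  have hleft : ∫⁻ y in ball w R, ENNReal.ofReal (infDist y E) ^ (-γ) ∂μ ≤
      ∫⁻ x, ENNReal.ofReal |f x| ^ q *
          ENNReal.ofReal (infDist x E) ^ (q / p * (Q - s * p + β) - Q) ∂μ := by
    refine le_trans ?_ (setLIntegral_le_lintegral (ball w R) _)
    refine setLIntegral_mono' measurableSet_ball fun y hy => ?_
    rw [hfb y hy, show q / p * (Q - s * p + β) - Q = -γ by rw [hγdef]; ring]
    simp
  have hpow : ∫⁻ y in ball w R, ENNReal.ofReal (infDist y E) ^ (-γ) ∂μ ≤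
      (ENNReal.ofReal CH * ENNReal.ofReal ((C + 1) * R ^ (Q - s * p + β)) ^ (1 / p)) ^ q := by
    calc _ ≤ _ := hleft
      _ = ((∫⁻ x, ENNReal.ofReal |f x| ^ q *
          ENNReal.ofReal (infDist x E) ^ (q / p * (Q - s * p + β) - Q) ∂μ) ^ (1 / q)) ^ q := by
          rw [← ENNReal.rpow_mul, one_div_mul_cancel hq0.ne', ENNReal.rpow_one]
      _ ≤ _ := by
          refine ENNReal.rpow_le_rpow (hH.trans ?_) hq0.le
          gcongr
          refine hEn.trans (ENNReal.ofReal_le_ofReal ?_)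
          gcongr; linarith
  refine hpow.trans_eq ?_
  rw [ENNReal.ofReal_rpow_of_nonneg (by positivity) (by positivity),
    ← ENNReal.ofReal_mul (by positivity), ENNReal.ofReal_rpow_of_nonneg (by positivity) hq0.le]
  congr 1
  have e : R ^ (Q - γ) = (R ^ (Q - s * p + β)) ^ (q / p) := by
    rw [← Real.rpow_mul hR.le]; congr 1; rw [hγdef]; ring
  rw [e, Real.mul_rpow hCH.le (by positivity), ← Real.rpow_mul (by positivity),
    Real.mul_rpow (by positivity) (by positivity), show 1 / p * q = q / p by ring]
  ring

lemma weight_ge (E : Set X) (γ : ℝ) (hγ : 0 < γ) (y : X) (r : ℝ) (hr : 0 < r)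
    (h : infDist y E ≤ r) :
    ENNReal.ofReal (r ^ (-γ)) ≤ ENNReal.ofReal (infDist y E) ^ (-γ) := by
  rw [← ENNReal.ofReal_rpow_of_pos hr, ENNReal.rpow_neg, ENNReal.rpow_neg]
  gcongr

lemma measurable_infDist_lt (E : Set X) (r : ℝ) : MeasurableSet {y : X | infDist y E < r} :=
  measurableSet_lt (continuous_infDist_pt E).measurable measurable_const

lemma local_comparison (μ : Measure X) (Q CA γ C1 : ℝ) (hCA : 0 < CA) (hγ : 0 < γ)
    (hC1 : 0 < C1)
    (hlo : ∀ (x : X) (r : ℝ), 0 < r → ENNReal.ofReal (CA⁻¹ * r ^ Q) ≤ μ (ball x r))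
    (E : Set X)
    (hA : ∀ w ∈ E, ∀ R : ℝ, 0 < R →
      ∫⁻ y in ball w R, ENNReal.ofReal (infDist y E) ^ (-γ) ∂μ ≤
        ENNReal.ofReal (C1 * R ^ (Q - γ))) :
    ∃ θ K : ℝ, 0 < θ ∧ θ ≤ 1 / 2 ∧ 0 < K ∧ ∀ e ∈ E, ∀ r : ℝ, 0 < r →
      ∫⁻ y in ball e (3 * r), ENNReal.ofReal (infDist y E) ^ (-γ) ∂μ ≤
        ENNReal.ofReal K * ∫⁻ y in closedBall e (r / 2) \ {y | infDist y E < θ * r},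
          ENNReal.ofReal (infDist y E) ^ (-γ) ∂μ := by
  set b : ℝ := CA⁻¹ / (2 * C1) with hb
  have hb0 : 0 < b := by positivity
  set θ : ℝ := min (1 / 2) (1 / 2 * b ^ (1 / γ)) with hθ
  have hθ0 : 0 < θ := by rw [hθ]; positivity
  have hθb : (2 * θ) ^ γ ≤ b := by
    have : 2 * θ ≤ b ^ (1 / γ) := by
      have := min_le_right (1 / 2 : ℝ) (1 / 2 * b ^ (1 / γ))
      linarith
    calc (2 * θ) ^ γ ≤ (b ^ (1 / γ)) ^ γ := Real.rpow_le_rpow (by positivity) this hγ.le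
      _ = b := by rw [← Real.rpow_mul hb0.le, one_div_mul_cancel hγ.ne', Real.rpow_one]
  refine ⟨θ, C1 * 3 ^ (Q - γ) * (2 * CA * 2 ^ Q), hθ0, min_le_left _ _, by positivity, ?_⟩
  intro e he r hr
  set m : ℝ := CA⁻¹ / 2 * (r / 2) ^ Q with hm
  have hm0 : 0 < m := by positivity
  have hsmall : μ (ball e (r / 2) ∩ {y | infDist y E < θ * r}) ≤ ENNReal.ofReal m := by
    have h1 : ENNReal.ofReal ((θ * r) ^ (-γ)) * μ (ball e (r / 2) ∩ {y | infDist y E < θ * r}) ≤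
        ENNReal.ofReal (C1 * (r / 2) ^ (Q - γ)) := by
      calc _ = ∫⁻ y in ball e (r / 2) ∩ {y | infDist y E < θ * r},
            ENNReal.ofReal ((θ * r) ^ (-γ)) ∂μ := (setLIntegral_const _ _).symm
        _ ≤ ∫⁻ y in ball e (r / 2) ∩ {y | infDist y E < θ * r},
            ENNReal.ofReal (infDist y E) ^ (-γ) ∂μ := by
            refine setLIntegral_mono' (measurableSet_ball.inter (measurable_infDist_lt E _))
              fun y hy => ?_
            exact weight_ge E γ hγ y _ (by positivity) (le_of_lt hy.2)
        _ ≤ ∫⁻ y in ball e (r / 2), ENNReal.ofReal (infDist y E) ^ (-γ) ∂μ :=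
            lintegral_mono_set inter_subset_left
        _ ≤ _ := hA e he _ (by positivity)
    have h2 : μ (ball e (r / 2) ∩ {y | infDist y E < θ * r}) ≤
        ENNReal.ofReal ((θ * r) ^ γ) * ENNReal.ofReal (C1 * (r / 2) ^ (Q - γ)) := by
      calc _ = ENNReal.ofReal ((θ * r) ^ γ) * (ENNReal.ofReal ((θ * r) ^ (-γ)) *
            μ (ball e (r / 2) ∩ {y | infDist y E < θ * r})) := by
            rw [← mul_assoc, ← ENNReal.ofReal_mul (by positivity), ← Real.rpow_add (by positivity)]
            simp
        _ ≤ _ := by gcongr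
    refine h2.trans ?_
    rw [← ENNReal.ofReal_mul (by positivity)]
    apply ENNReal.ofReal_le_ofReal
    have e1 : θ * r = (2 * θ) * (r / 2) := by ring
    have e2 : (r / 2) ^ Q = (r / 2) ^ γ * (r / 2) ^ (Q - γ) := by
      rw [← Real.rpow_add (by positivity)]; congr 1; ring
    rw [e1, Real.mul_rpow (by positivity) (by positivity), hm, e2]
    calc _ = C1 * (2 * θ) ^ γ * ((r / 2) ^ γ * (r / 2) ^ (Q - γ)) := by ring
      _ ≤ C1 * b * ((r / 2) ^ γ * (r / 2) ^ (Q - γ)) := by gcongr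
      _ = _ := by rw [hb]; field_simp
  have hbig : ENNReal.ofReal m ≤ μ (closedBall e (r / 2) \ {y | infDist y E < θ * r}) := by
    have h1 : ENNReal.ofReal m + ENNReal.ofReal m ≤
        ENNReal.ofReal m + μ (closedBall e (r / 2) \ {y | infDist y E < θ * r}) := by
      calc _ = ENNReal.ofReal (CA⁻¹ * (r / 2) ^ Q) := by
            rw [← ENNReal.ofReal_add hm0.le hm0.le]; congr 1; rw [hm]; ring
        _ ≤ μ (ball e (r / 2)) := hlo e _ (by positivity)
        _ ≤ μ (ball e (r / 2) ∩ {y | infDist y E < θ * r}) +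
            μ (ball e (r / 2) \ {y | infDist y E < θ * r}) := measure_le_inter_add_sdiff _ _ _
        _ ≤ _ := by
            gcongr
            exact ball_subset_closedBall
    exact ENNReal.le_of_add_le_add_left ENNReal.ofReal_ne_top h1
  have hint : ENNReal.ofReal (r ^ (-γ) * m) ≤
      ∫⁻ y in closedBall e (r / 2) \ {y | infDist y E < θ * r},
          ENNReal.ofReal (infDist y E) ^ (-γ) ∂μ := by
    calc _ = ENNReal.ofReal (r ^ (-γ)) * ENNReal.ofReal m := ENNReal.ofReal_mul (by positivity)
      _ ≤ ENNReal.ofReal (r ^ (-γ)) * μ (closedBall e (r / 2) \ {y | infDist y E < θ * r}) := by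
          gcongr
      _ = ∫⁻ y in closedBall e (r / 2) \ {y | infDist y E < θ * r},
          ENNReal.ofReal (r ^ (-γ)) ∂μ := (setLIntegral_const _ _).symm
      _ ≤ _ := by
          refine setLIntegral_mono' (measurableSet_closedBall.diff (measurable_infDist_lt E _))
              fun y hy => ?_
          refine weight_ge E γ hγ y _ hr ?_
          have h1 := infDist_le_dist_of_mem (x := y) he
          have h2 : dist y e ≤ r / 2 := hy.1
          linarith
  refine (hA e he (3 * r) (by positivity)).trans ?_
  refine le_trans ?_ (mul_le_mul_right hint _)
  rw [← ENNReal.ofReal_mul (by positivity)]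
  apply ENNReal.ofReal_le_ofReal
  apply le_of_eq
  have e1 : r ^ (Q - γ) = r ^ (-γ) * r ^ Q := by
    rw [← Real.rpow_add hr]; congr 1; ring
  rw [hm, Real.mul_rpow (by norm_num) hr.le, Real.div_rpow hr.le (by norm_num), e1]
  field_simp

lemma global_comparison (μ : Measure X) (Q CA γ θ K : ℝ) (hCA : 0 < CA)
    (hθ1 : θ ≤ 1 / 2)
    (hlo : ∀ (x : X) (r : ℝ), 0 < r → ENNReal.ofReal (CA⁻¹ * r ^ Q) ≤ μ (ball x r))
    (hup : ∀ (x : X) (r : ℝ), 0 < r → μ (ball x r) ≤ ENNReal.ofReal (CA * r ^ Q))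
    (E : Set X) (hE : E.Nonempty)
    (hloc : ∀ e ∈ E, ∀ r : ℝ, 0 < r →
      ∫⁻ y in ball e (3 * r), ENNReal.ofReal (infDist y E) ^ (-γ) ∂μ ≤
        ENNReal.ofReal K * ∫⁻ y in closedBall e (r / 2) \ {y | infDist y E < θ * r},
          ENNReal.ofReal (infDist y E) ^ (-γ) ∂μ)
    (x : X) (r ρ : ℝ) (hr : 0 < r) (hρ : 0 < ρ) :
    ∫⁻ y in {y | infDist y E < θ * r} ∩ ball x ρ, ENNReal.ofReal (infDist y E) ^ (-γ) ∂μ ≤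
      ENNReal.ofReal K *
        ∫⁻ y in ({y | infDist y E < r} ∩ ball x (ρ + 2 * r)) \ {y | infDist y E < θ * r},
          ENNReal.ofReal (infDist y E) ^ (-γ) ∂μ := by
  set w : X → ℝ≥0∞ := fun y => ENNReal.ofReal (infDist y E) ^ (-γ) with hw
  set T : Set X := E ∩ ball x (ρ + r) with hT
  obtain ⟨u, huT, hdisj, hcov⟩ := Vitali.exists_disjoint_subfamily_covering_enlargement_closedBall
    T (fun e : X => e) (fun _ => r / 2) (r / 2) (fun _ _ => le_rfl) 5 (by norm_num)
  have hsub : ∀ e ∈ u, closedBall e (r / 2) ⊆ ball x (ρ + 2 * r) := by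
    intro e he z hz
    have h1 : dist e x < ρ + r := (huT he).2
    have h2 : dist z e ≤ r / 2 := hz
    rw [mem_ball]
    linarith [dist_triangle z e x]
  have hdisj' : Pairwise (Function.onFun Disjoint fun e : u => closedBall (e : X) (r / 2)) := by
    intro a b hab
    exact hdisj a.2 b.2 (fun h => hab (Subtype.ext h))
  have hcount : Countable u := by
    have := Measure.countable_meas_pos_of_disjoint_of_meas_iUnion_ne_top μ
      (As := fun e : u => closedBall (e : X) (r / 2)) (fun _ => measurableSet_closedBall)
      hdisj' ?_
    · have h2 : {i : u | 0 < μ (closedBall (i : X) (r / 2))} = univ := by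
        refine eq_univ_of_forall fun i => ?_
        have : 0 < μ (ball (i : X) (r / 2)) :=
          (ENNReal.ofReal_pos.2 (by positivity)).trans_le (hlo i (r / 2) (by positivity))
        exact this.trans_le (measure_mono ball_subset_closedBall)
      rw [h2] at this
      exact countable_univ_iff.1 this
    · refine ne_top_of_le_ne_top ENNReal.ofReal_ne_top
        ((measure_mono (iUnion_subset fun e : u => hsub e.1 e.2)).trans (hup x _ (by positivity)))
  have hcover : {y | infDist y E < θ * r} ∩ ball x ρ ⊆ ⋃ e : u, ball (e : X) (3 * r) := by
    rintro y ⟨hy1, hy2⟩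
    have hy1' : infDist y E < θ * r := hy1
    obtain ⟨e, he, hye⟩ := (infDist_lt_iff hE).1 hy1'
    have hθr : θ * r ≤ r / 2 := by nlinarith
    have heT : e ∈ T := by
      refine ⟨he, ?_⟩
      rw [mem_ball] at hy2 ⊢
      have := dist_triangle e y x
      rw [dist_comm e y] at this
      linarith
    obtain ⟨b, hb, hsubb⟩ := hcov e heT
    refine mem_iUnion.2 ⟨⟨b, hb⟩, ?_⟩
    have : y ∈ closedBall b (5 * (r / 2)) := hsubb (by rw [mem_closedBall]; linarith)
    rw [mem_closedBall] at this
    rw [mem_ball]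
    show dist y b < 3 * r
    linarith
  calc _ ≤ ∫⁻ y in ⋃ e : u, ball (e : X) (3 * r), w y ∂μ := lintegral_mono_set hcover
    _ ≤ ∑' e : u, ∫⁻ y in ball (e : X) (3 * r), w y ∂μ := lintegral_iUnion_le _ _
    _ ≤ ∑' e : u, ENNReal.ofReal K *
        ∫⁻ y in closedBall (e : X) (r / 2) \ {y | infDist y E < θ * r}, w y ∂μ :=
        ENNReal.tsum_le_tsum fun e => hloc e (huT e.2).1 r hr
    _ = ENNReal.ofReal K * ∑' e : u,
        ∫⁻ y in closedBall (e : X) (r / 2) \ {y | infDist y E < θ * r}, w y ∂μ :=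
        ENNReal.tsum_mul_left
    _ = ENNReal.ofReal K *
        ∫⁻ y in ⋃ e : u, closedBall (e : X) (r / 2) \ {y | infDist y E < θ * r}, w y ∂μ := by
        rw [lintegral_iUnion (fun e => measurableSet_closedBall.diff (measurable_infDist_lt E _))]
        intro a b hab
        exact (hdisj' hab).mono sdiff_subset sdiff_subset
    _ ≤ _ := by
        gcongr
        refine iUnion_subset fun e => ?_
        rintro y ⟨hy1, hy2⟩
        refine ⟨⟨?_, hsub e e.2 hy1⟩, hy2⟩
        have h1 := infDist_le_dist_of_mem (x := y) (huT e.2).1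
        have h2 : dist y e ≤ r / 2 := hy1
        show infDist y E < r
        linarith

lemma self_improve (μ : Measure X) (Q CA γ C1 : ℝ) (hQ : 0 < Q) (hCA : 0 < CA) (hγ : 0 < γ)
    (hC1 : 0 < C1)
    (hlo : ∀ (x : X) (r : ℝ), 0 < r → ENNReal.ofReal (CA⁻¹ * r ^ Q) ≤ μ (ball x r))
    (hup : ∀ (x : X) (r : ℝ), 0 < r → μ (ball x r) ≤ ENNReal.ofReal (CA * r ^ Q))
    (E : Set X) (hE : E.Nonempty)
    (hA : ∀ w ∈ E, ∀ R : ℝ, 0 < R →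
      ∫⁻ y in ball w R, ENNReal.ofReal (infDist y E) ^ (-γ) ∂μ ≤
        ENNReal.ofReal (C1 * R ^ (Q - γ))) :
    ∃ ε : ℝ, 0 < ε ∧ γ + ε ∈ assouadCodimBddSet μ E := by
  obtain ⟨θ, K, hθ0, hθ1, hK, hloc⟩ := local_comparison μ Q CA γ C1 hCA hγ hC1 hlo E hA
  set lam : ℝ := K / (1 + K) with hlam
  have hlam0 : 0 < lam := by positivity
  have hlam1 : lam < 1 := by rw [hlam, div_lt_one (by positivity)]; linarith
  set w : X → ℝ≥0∞ := fun y => ENNReal.ofReal (infDist y E) ^ (-γ) with hw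
  have hstep : ∀ (x : X) (r ρ : ℝ), 0 < r → 0 < ρ →
      ∫⁻ y in {y | infDist y E < θ * r} ∩ ball x ρ, w y ∂μ ≤ ENNReal.ofReal lam *
        ∫⁻ y in {y | infDist y E < r} ∩ ball x (ρ + 2 * r), w y ∂μ := by
    intro x r ρ hr hρ
    have hθr : θ * r ≤ r / 2 := by
      have := mul_le_mul_of_nonneg_right hθ1 hr.le
      linarith
    have hθr' : θ * r ≤ r := by linarith
    have hg := global_comparison μ Q CA γ θ K hCA hθ1 hlo hup E hE hloc x r ρ hr hρ
    set A := ∫⁻ y in {y | infDist y E < θ * r} ∩ ball x ρ, w y ∂μ with hAdef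
    set G := ({y | infDist y E < r} ∩ ball x (ρ + 2 * r)) \ {y | infDist y E < θ * r} with hG
    have hsum : ∫⁻ y in G, w y ∂μ + A ≤
        ∫⁻ y in {y | infDist y E < r} ∩ ball x (ρ + 2 * r), w y ∂μ := by
      rw [hAdef, ← lintegral_union ((measurable_infDist_lt E _).inter measurableSet_ball)]
      · refine lintegral_mono_set (union_subset sdiff_subset ?_)
        rintro y ⟨hy1, hy2⟩
        refine ⟨lt_of_lt_of_le hy1 hθr', ball_subset_ball (by linarith) hy2⟩
      · rw [Set.disjoint_left]
        rintro y hy hy'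
        exact hy.2 hy'.1
    have h1 : ENNReal.ofReal (1 + K) * A ≤ ENNReal.ofReal K *
        ∫⁻ y in {y | infDist y E < r} ∩ ball x (ρ + 2 * r), w y ∂μ := by
      calc _ = A + ENNReal.ofReal K * A := by
            rw [ENNReal.ofReal_add (by norm_num) hK.le, add_mul]; simp
        _ ≤ ENNReal.ofReal K * ∫⁻ y in G, w y ∂μ + ENNReal.ofReal K * A := by gcongr
        _ = ENNReal.ofReal K * (∫⁻ y in G, w y ∂μ + A) := by rw [mul_add]
        _ ≤ _ := by gcongr
    calc A = ENNReal.ofReal (1 + K)⁻¹ * (ENNReal.ofReal (1 + K) * A) := by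
          rw [← mul_assoc, ← ENNReal.ofReal_mul (by positivity), inv_mul_cancel₀ (by positivity)]
          simp
      _ ≤ ENNReal.ofReal (1 + K)⁻¹ * (ENNReal.ofReal K *
        ∫⁻ y in {y | infDist y E < r} ∩ ball x (ρ + 2 * r), w y ∂μ) := by gcongr
      _ = _ := by
          rw [← mul_assoc, ← ENNReal.ofReal_mul (by positivity), hlam]
          congr 2; field_simp
  have hiter : ∀ (x : X) (k : ℕ) (r ρ : ℝ), 0 < r → 0 < ρ →
      ∫⁻ y in {y | infDist y E < θ ^ k * r} ∩ ball x ρ, w y ∂μ ≤ ENNReal.ofReal (lam ^ k) *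
        ∫⁻ y in {y | infDist y E < r} ∩ ball x (ρ + 4 * r), w y ∂μ := by
    intro x k
    induction k with
    | zero =>
      intro r ρ hr hρ
      simp only [pow_zero, one_mul, ENNReal.ofReal_one]
      exact lintegral_mono_set (inter_subset_inter_right _ (ball_subset_ball (by linarith)))
    | succ k ih =>
      intro r ρ hr hρ
      have h1 := ih (θ * r) ρ (by positivity) hρ
      have h2 := hstep x r (ρ + 4 * (θ * r)) hr (by positivity)
      rw [show θ ^ (k + 1) * r = θ ^ k * (θ * r) by ring]
      refine h1.trans ((mul_le_mul_right h2 _).trans ?_)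
      rw [← mul_assoc, ← ENNReal.ofReal_mul (by positivity), ← pow_succ]
      have hθr := mul_le_mul_of_nonneg_right hθ1 hr.le
      refine mul_le_mul_right (lintegral_mono_set (inter_subset_inter_right _
        (ball_subset_ball ?_))) _
      linarith
  set ε : ℝ := Real.log lam / Real.log θ with hε
  have hθlt : θ < 1 := by linarith
  have hε0 : 0 < ε := div_pos_of_neg_of_neg (Real.log_neg hlam0 hlam1) (Real.log_neg hθ0 hθlt)
  have hθε : θ ^ ε = lam := by
    rw [Real.rpow_def_of_pos hθ0, hε, mul_div_cancel₀ _ (Real.log_neg hθ0 hθlt).ne,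
      Real.exp_log hlam0]
  set C : ℝ := lam⁻¹ * C1 * 5 ^ (Q - γ) * CA with hC
  have hC0 : 0 < C := by positivity
  refine ⟨ε, hε0, by positivity, C + 1, by linarith, ?_⟩
  intro x hx r R hr hrR _
  have hR : 0 < R := hr.trans hrR
  obtain ⟨k, hk1, hk2⟩ := exists_nat_pow_near_of_lt_one (div_pos hr hR)
    ((div_le_one hR).2 hrR.le) hθ0 hθlt
  have hlk : lam ^ k ≤ lam⁻¹ * (r / R) ^ ε := by
    have h1 : lam ^ (k + 1) ≤ (r / R) ^ ε := by
      have : lam ^ (k + 1) = (θ ^ (k + 1)) ^ ε := by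
        rw [← hθε, ← Real.rpow_natCast, ← Real.rpow_natCast, ← Real.rpow_mul hθ0.le,
          ← Real.rpow_mul hθ0.le, mul_comm]
      rw [this]
      exact Real.rpow_le_rpow (by positivity) hk1.le hε0.le
    calc lam ^ k = lam⁻¹ * lam ^ (k + 1) := by rw [pow_succ]; field_simp
      _ ≤ _ := by gcongr
  have hmain : ENNReal.ofReal (r ^ (-γ)) * μ ({y | infDist y E < r} ∩ ball x R) ≤
      ENNReal.ofReal (lam⁻¹ * (r / R) ^ ε * (C1 * (5 * R) ^ (Q - γ))) := by
    calc _ = ∫⁻ y in {y | infDist y E < r} ∩ ball x R, ENNReal.ofReal (r ^ (-γ)) ∂μ :=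
          (setLIntegral_const _ _).symm
      _ ≤ ∫⁻ y in {y | infDist y E < r} ∩ ball x R, w y ∂μ := by
          refine setLIntegral_mono' ((measurable_infDist_lt E _).inter measurableSet_ball)
              fun y hy => ?_
          exact weight_ge E γ hγ y _ hr (le_of_lt hy.1)
      _ ≤ ∫⁻ y in {y | infDist y E < θ ^ k * R} ∩ ball x R, w y ∂μ := by
          refine lintegral_mono_set (inter_subset_inter_left _ fun y hy => ?_)
          rw [div_le_iff₀ hR] at hk2
          exact lt_of_lt_of_le hy hk2
      _ ≤ ENNReal.ofReal (lam ^ k) *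
          ∫⁻ y in {y | infDist y E < R} ∩ ball x (R + 4 * R), w y ∂μ := hiter x k R R hR hR
      _ ≤ ENNReal.ofReal (lam⁻¹ * (r / R) ^ ε) * ENNReal.ofReal (C1 * (5 * R) ^ (Q - γ)) := by
          gcongr
          refine (lintegral_mono_set inter_subset_right).trans ?_
          rw [show R + 4 * R = 5 * R by ring]
          exact hA x hx _ (by positivity)
      _ = _ := (ENNReal.ofReal_mul (by positivity)).symm
  calc μ ({y | infDist y E < r} ∩ ball x R)
      = ENNReal.ofReal (r ^ γ) *
          (ENNReal.ofReal (r ^ (-γ)) * μ ({y | infDist y E < r} ∩ ball x R)) := by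
        rw [← mul_assoc, ← ENNReal.ofReal_mul (by positivity), ← Real.rpow_add hr]
        simp
    _ ≤ ENNReal.ofReal (r ^ γ) *
        ENNReal.ofReal (lam⁻¹ * (r / R) ^ ε * (C1 * (5 * R) ^ (Q - γ))) := by gcongr
    _ = ENNReal.ofReal (C * (r / R) ^ (γ + ε)) * ENNReal.ofReal (CA⁻¹ * R ^ Q) := by
        rw [← ENNReal.ofReal_mul (by positivity), ← ENNReal.ofReal_mul (by positivity)]
        congr 1
        rw [Real.rpow_add (by positivity), Real.mul_rpow (by norm_num) hR.le,
          Real.rpow_sub hR, Real.div_rpow hr.le hR.le γ, hC]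
        field_simp
    _ ≤ ENNReal.ofReal ((C + 1) * (r / R) ^ (γ + ε)) * μ (ball x R) := by
        gcongr
        · linarith
        · exact hlo x R hR

theorem codim_gt_of_fractional_hardy_sobolev [Nontrivial X]
    (μ : Measure X) (s : ℝ) (hs0 : 0 < s) (hs1 : s < 1)
    (hsa : StandingAssumptions μ) (hballs : BallsPosFinite μ) (hdbl : Doubling μ)
    (Q : ℝ) (hQ : s < Q)
    (CA : ℝ) (hCA : 1 ≤ CA)
    (hreg : ∀ (x : X) (r : ℝ), 0 < r →
      ENNReal.ofReal (CA⁻¹ * r ^ Q) ≤ μ (ball x r) ∧ μ (ball x r) ≤ ENNReal.ofReal (CA * r ^ Q))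
    (E : Set X) (hE : E.Nonempty) (hEc : IsClosed E) (hcodim0 : 0 < assouadCodim μ E)
    (p q β : ℝ) (hp : 1 < p) (hpq : p ≤ q) (hsp : s * p < Q)
    (hq : q ≤ Q * p / (Q - s * p)) (hβ : 0 ≤ β)
    (t CH : ℝ) (ht1 : 1 ≤ t) (htq : t ≤ q) (hCH : 0 < CH)
    (hHS : ∀ f : X → ℝ, MemLip0 f →
      (∫⁻ x, ENNReal.ofReal |f x| ^ q *
          ENNReal.ofReal (infDist x E) ^ (q / p * (Q - s * p + β) - Q) ∂μ) ^ (1 / q) ≤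
        ENNReal.ofReal CH *
          (∫⁻ y, fracEnergyKernel μ s t f y ^ (p / t) *
            ENNReal.ofReal (infDist y E) ^ β ∂μ) ^ (1 / p)) :
    Q - q / p * (Q - s * p + β) < assouadCodim μ E := by
  have hbdd : BddAbove (assouadCodimBddSet μ E) := by
    by_contra h
    rw [assouadCodim, Real.sSup_of_not_bddAbove h] at hcodim0
    exact lt_irrefl _ hcodim0
  rcases le_or_gt (Q - q / p * (Q - s * p + β)) 0 with h | h
  · exact h.trans_lt hcodim0
  · have hQ0 : 0 < Q := hs0.trans hQ
    have hCA0 : 0 < CA := by linarith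
    obtain ⟨C1, hC1, hA⟩ := aikawa_of_hardy μ hsa.2.1 s t Q CA p q β CH hs0 hs1 ht1 htq hQ0 hCA0
      hp hβ hCH (fun x r hr => (hreg x r hr).1) (fun x r hr => (hreg x r hr).2) E hHS _ rfl h
    obtain ⟨ε, hε, hmem⟩ := self_improve μ Q CA _ C1 hQ0 hCA0 h hC1
      (fun x r hr => (hreg x r hr).1) (fun x r hr => (hreg x r hr).2) E hE hA
    have := le_csSup hbdd hmem
    rw [assouadCodim]
    linarith

end
end ApDistance
end
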